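/- For every integer n ≥ 3, the generalized 3-connectivity of the split-star network satisfies κ₃(S_n²) = 2n − 4. -/

import Mathlib

/-- There exist `r` internally disjoint trees connecting `S` in `G`: `r` pairwise
edge-disjoint trees `T₁, …, T_r` of `G`, each containing `S`, with
`V(T_a) ∩ V(T_b) = S` for all `a ≠ b`. -/
def ConnectsSet {V : Type*} (G : SimpleGraph V) (S : Set V) (r : ℕ) : Prop :=
  ∃ T : Fin r → G.Subgraph,
    (∀ a, (T a).coe.IsTree) ∧
    (∀ a, S ⊆ (T a).verts) ∧
    (∀ a b, a ≠ b → (T a).verts ∩ (T b).verts = S) ∧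
    (∀ a b, a ≠ b → Disjoint (T a).edgeSet (T b).edgeSet)

/-- `κ_G(S)`: the maximum number of internally disjoint trees connecting `S` in `G`. -/
noncomputable def treeConn {V : Type*} (G : SimpleGraph V) (S : Set V) : ℕ :=
  sSup {r | ConnectsSet G S r}

/-- The generalized 3-connectivity `κ₃(G) = min {κ_G(S) : S ⊆ V(G), |S| = 3}`. -/
noncomputable def kappa3 {V : Type*} (G : SimpleGraph V) : ℕ :=
  sInf {k | ∃ S : Set V, S.ncard = 3 ∧ treeConn G S = k}

/-- The Cayley graph of a group with connection set `S`: `x` is adjacent to `x·s` for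
`s ∈ S` (symmetrized, loops removed). -/
def cayleyGraph {G : Type*} [Group G] (S : Set G) : SimpleGraph G :=
  SimpleGraph.fromRel (fun x y => ∃ s ∈ S, y = x * s)

/-- The split-star network `S_n²`: the Cayley graph of `Sym(n)` (permutations of the `n`
positions `0, …, n-1`, written as words) with connection set
`{(1 i) : 2 ≤ i ≤ n} ∪ {(2 i) : 3 ≤ i ≤ n}` (in 1-based notation). -/
def splitStar (n : ℕ) (hn : 3 ≤ n) : SimpleGraph (Equiv.Perm (Fin n)) :=
  cayleyGraph ({σ | ∃ i : Fin n, 1 ≤ (i : ℕ) ∧ σ = Equiv.swap ⟨0, by omega⟩ i} ∪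
    {σ | ∃ i : Fin n, 2 ≤ (i : ℕ) ∧ σ = Equiv.swap ⟨1, by omega⟩ i})

namespace SplitStar

open SimpleGraph Equiv

set_option linter.unusedSectionVars false

section Menger

variable {V : Type*}

/-- `u` and `v` are joined by a walk of `G` all of whose vertices lie in `U`. -/
def JoinedIn (G : SimpleGraph V) (U : Set V) (u v : V) : Prop :=
  ∃ p : G.Walk u v, ∀ w ∈ p.support, w ∈ U

variable {G : SimpleGraph V} {U W : Set V} {u v w : V}

lemma JoinedIn.refl (h : u ∈ U) : JoinedIn G U u u :=
  ⟨Walk.nil, by simpa using h⟩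

lemma JoinedIn.symm (h : JoinedIn G U u v) : JoinedIn G U v u := by
  obtain ⟨p, hp⟩ := h
  exact ⟨p.reverse, by simpa using hp⟩

lemma JoinedIn.trans (h : JoinedIn G U u v) (h' : JoinedIn G U v w) : JoinedIn G U u w := by
  obtain ⟨p, hp⟩ := h
  obtain ⟨q, hq⟩ := h'
  refine ⟨p.append q, fun x hx => ?_⟩
  rw [Walk.mem_support_append_iff] at hx
  exact hx.elim (hp x) (hq x)

lemma JoinedIn.mono (h : JoinedIn G U u v) (hUW : U ⊆ W) : JoinedIn G W u v := by
  obtain ⟨p, hp⟩ := h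
  exact ⟨p, fun x hx => hUW (hp x hx)⟩

lemma JoinedIn.of_adj (h : G.Adj u v) (hu : u ∈ U) (hv : v ∈ U) : JoinedIn G U u v := by
  refine ⟨Walk.cons h Walk.nil, fun x hx => ?_⟩
  simp at hx
  rcases hx with rfl | rfl <;> assumption

lemma JoinedIn.left_mem (h : JoinedIn G U u v) : u ∈ U := by
  obtain ⟨p, hp⟩ := h
  exact hp _ p.start_mem_support

lemma JoinedIn.right_mem (h : JoinedIn G U u v) : v ∈ U := by
  obtain ⟨p, hp⟩ := h
  exact hp _ p.end_mem_support

lemma JoinedIn.map_le {G' : SimpleGraph V} (h : JoinedIn G U u v) (hG : G ≤ G') :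
    JoinedIn G' U u v := by
  obtain ⟨p, hp⟩ := h
  exact ⟨p.mapLe hG, by simpa using hp⟩

lemma JoinedIn.induction {P : V → Prop} (h : JoinedIn G U u v) (hu : P u)
    (hP : ∀ x y, G.Adj x y → x ∈ U → y ∈ U → P x → P y) : P v := by
  obtain ⟨p, hp⟩ := h
  induction p with
  | nil => exact hu
  | cons h p ih =>
    refine ih (hP _ _ h (hp _ (by simp)) (hp _ (by simp)) hu) fun w hw => hp w (by simp [hw])

lemma JoinedIn.exists_isPath (h : JoinedIn G U u v) :
    ∃ p : G.Walk u v, p.IsPath ∧ ∀ w ∈ p.support, w ∈ U := by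
  classical
  obtain ⟨p, hp⟩ := h
  exact ⟨p.bypass, p.bypass_isPath, fun w hw => hp w (p.support_bypass_subset_support hw)⟩

lemma JoinedIn.exists_adj (h : JoinedIn G U u v) (huv : v ≠ u) :
    ∃ w, G.Adj u w ∧ JoinedIn G (U \ {u}) w v := by
  obtain ⟨p, hp, hU⟩ := h.exists_isPath
  cases p with
  | nil => exact absurd rfl huv
  | cons h p =>
    rw [Walk.cons_isPath_iff] at hp
    refine ⟨_, h, p, fun w hw => ⟨hU w (by simp [hw]), ?_⟩⟩
    rintro rfl
    exact hp.2 hw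

lemma JoinedIn.exists_subgraph (h : JoinedIn G U u v) :
    ∃ H : G.Subgraph, H.Connected ∧ u ∈ H.verts ∧ v ∈ H.verts ∧ H.verts ⊆ U := by
  obtain ⟨p, hp⟩ := h
  refine ⟨p.toSubgraph, p.toSubgraph_connected, p.start_mem_verts_toSubgraph,
    p.end_mem_verts_toSubgraph, fun w hw => hp w ?_⟩
  simpa using hw

/-- There are `k` pairwise disjoint vertex sets, each joining `A` to `B`. -/
def Linked (G : SimpleGraph V) (A B : Finset V) (k : ℕ) : Prop :=
  ∃ F : Fin k → Set V, (∀ i j, i ≠ j → Disjoint (F i) (F j)) ∧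
    ∀ i, ∃ a ∈ A, ∃ b ∈ B, JoinedIn G (F i) a b

lemma linked_of_finset {A B : Finset V} (X : Finset V) (F : V → Set V)
    (hF : ∀ i ∈ X, ∀ j ∈ X, i ≠ j → Disjoint (F i) (F j))
    (hj : ∀ i ∈ X, ∃ a ∈ A, ∃ b ∈ B, JoinedIn G (F i) a b) : Linked G A B X.card := by
  refine ⟨fun i => F (X.equivFin.symm i), fun i j hij => hF _ (by simp) _ (by simp) ?_,
    fun i => hj _ (by simp)⟩
  intro h
  exact hij (X.equivFin.symm.injective (Subtype.ext h))

/-- A linkage onto a set `B` of the right size, indexed by `B`. -/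
lemma Linked.exists_paths {A B : Finset V} (h : Linked G A B B.card) :
    ∃ (s : V → V) (p : ∀ b, G.Walk (s b) b), (∀ b ∈ B, s b ∈ A) ∧ (∀ b, (p b).IsPath) ∧
      ∀ b ∈ B, ∀ c ∈ B, ∀ x, x ∈ (p b).support → x ∈ (p c).support → b = c := by
  classical
  obtain ⟨F, hF, hj⟩ := h
  choose a ha b hb hab using hj
  have hinj : Function.Injective (fun i => (⟨b i, hb i⟩ : B)) := by
    intro i j hij
    by_contra hne
    have h1 := (hab i).right_mem
    have h2 := (hab j).right_mem
    simp only [Subtype.mk.injEq] at hij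
    rw [← hij] at h2
    exact Set.disjoint_left.1 (hF i j hne) h1 h2
  have hbij : Function.Bijective (fun i => (⟨b i, hb i⟩ : B)) :=
    (Fintype.bijective_iff_injective_and_card _).2 ⟨hinj, by simp⟩
  have key : ∀ c : V, ∃ (s : V) (p : G.Walk s c), p.IsPath ∧
      (c ∈ B → s ∈ A ∧ ∃ i, b i = c ∧ ∀ x ∈ p.support, x ∈ F i) := by
    intro c
    by_cases hc : c ∈ B
    · obtain ⟨i, hi⟩ := hbij.2 ⟨c, hc⟩
      simp only [Subtype.mk.injEq] at hi
      obtain ⟨p, hp, hpF⟩ := (hab i).exists_isPath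
      subst hi
      exact ⟨a i, p, hp, fun _ => ⟨ha i, i, rfl, hpF⟩⟩
    · exact ⟨c, Walk.nil, by simp, fun h => absurd h hc⟩
  choose s p hp hB using key
  refine ⟨s, p, fun b hb => (hB b hb).1, hp, fun c hc d hd x hxc hxd => ?_⟩
  obtain ⟨-, i, rfl, hi⟩ := hB c hc
  obtain ⟨-, j, rfl, hj⟩ := hB d hd
  by_contra hne
  have : i ≠ j := by rintro rfl; exact hne rfl
  exact Set.disjoint_left.1 (hF i j this) (hi x hxc) (hj x hxd)

lemma joinedIn_or_of_edge {G' : SimpleGraph V} {x y : V}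
    (hadj : ∀ v w, G.Adj v w → G'.Adj v w ∨ (v = x ∧ w = y) ∨ (v = y ∧ w = x))
    (h : JoinedIn G U u v) :
    JoinedIn G' U u v ∨ (JoinedIn G' U u x ∧ JoinedIn G' U y v) ∨
      (JoinedIn G' U u y ∧ JoinedIn G' U x v) := by
  have hu := h.left_mem
  refine h.induction (P := fun v => JoinedIn G' U u v ∨ (JoinedIn G' U u x ∧ JoinedIn G' U y v) ∨
      (JoinedIn G' U u y ∧ JoinedIn G' U x v)) (Or.inl (JoinedIn.refl hu)) ?_
  intro v w hvw hv hw ih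
  rcases hadj v w hvw with h | ⟨rfl, rfl⟩ | ⟨rfl, rfl⟩
  · have h' := JoinedIn.of_adj h hv hw
    rcases ih with ih | ⟨ih, ih'⟩ | ⟨ih, ih'⟩
    · exact Or.inl (ih.trans h')
    · exact Or.inr (Or.inl ⟨ih, ih'.trans h'⟩)
    · exact Or.inr (Or.inr ⟨ih, ih'.trans h'⟩)
  · rcases ih with ih | ⟨ih, ih'⟩ | ⟨ih, ih'⟩
    · exact Or.inr (Or.inl ⟨ih, JoinedIn.refl hw⟩)
    · exact Or.inr (Or.inl ⟨ih, JoinedIn.refl hw⟩)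
    · exact Or.inl ih
  · rcases ih with ih | ⟨ih, ih'⟩ | ⟨ih, ih'⟩
    · exact Or.inr (Or.inr ⟨ih, JoinedIn.refl hw⟩)
    · exact Or.inl ih
    · exact Or.inr (Or.inr ⟨ih, JoinedIn.refl hw⟩)

lemma exists_joinedIn_insert [DecidableEq V] {G' : SimpleGraph V} {x y : V} {A B S C : Finset V}
    (hadj : ∀ v w, G.Adj v w → G'.Adj v w ∨ (v = x ∧ w = y) ∨ (v = y ∧ w = x))
    (hsep : ∀ a ∈ A, ∀ b ∈ B, ¬ JoinedIn G' (↑S)ᶜ a b)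
    (hy : ∃ b ∈ B, JoinedIn G' (↑S)ᶜ y b)
    (hG : ∃ a ∈ A, ∃ b ∈ B, JoinedIn G (↑C)ᶜ a b) :
    ∃ a ∈ A, ∃ w ∈ insert x S, JoinedIn G' (↑C)ᶜ a w := by
  by_contra! hcon
  obtain ⟨a, ha, b, hb, hab⟩ := hG
  have key : JoinedIn G' ((↑C)ᶜ ∩ (↑(insert x S))ᶜ) a b := by
    have haC := hab.left_mem
    have ha' : a ∉ insert x S := fun h => hcon a ha a h (JoinedIn.refl haC)
    refine hab.induction (P := fun b => JoinedIn G' ((↑C)ᶜ ∩ (↑(insert x S))ᶜ) a b)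
      (JoinedIn.refl ⟨haC, by simpa using ha'⟩) ?_
    intro v w hvw hv hw ih
    have hvx := ih.right_mem.2
    rcases hadj v w hvw with h | ⟨rfl, rfl⟩ | ⟨rfl, rfl⟩
    · by_cases hwx : w ∈ insert x S
      · exact absurd ((ih.mono Set.inter_subset_left).trans (JoinedIn.of_adj h hv hw))
          (hcon a ha w hwx)
      · exact ih.trans (JoinedIn.of_adj h ⟨hv, hvx⟩ ⟨hw, by simpa using hwx⟩)
    · simp at hvx
    · obtain ⟨b, hb, hyb⟩ := hy
      refine absurd ((ih.mono ?_).trans hyb) (hsep a ha b hb)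
      rintro z ⟨-, hz⟩
      simp at hz ⊢
      exact hz.2
  refine hsep a ha b hb (key.mono ?_)
  rintro z ⟨-, hz⟩
  simp at hz ⊢
  exact hz.2

/-- **Menger's theorem**: if no set of fewer than `k` vertices separates `A` from `B`, there are
`k` disjoint connections between `A` and `B`. -/
theorem menger [Finite V] (G : SimpleGraph V) (A B : Finset V) (k : ℕ)
    (h : ∀ C : Finset V, C.card < k → ∃ a ∈ A, ∃ b ∈ B, JoinedIn G (↑C)ᶜ a b) :
    Linked G A B k := by
  classical
  induction hm : G.edgeSet.ncard using Nat.strong_induction_on generalizing G A B with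
  | _ m ih =>
  by_cases hE : ∃ u v, G.Adj u v
  swap
  · push Not at hE
    have hk : k ≤ (A ∩ B).card := by
      by_contra! hlt
      obtain ⟨a, ha, b, hb, hab⟩ := h _ hlt
      have hba : b = a := hab.induction (P := fun b => b = a) rfl
        fun x y hxy => absurd hxy (hE x y)
      have := hab.left_mem
      subst hba
      simp_all
    obtain ⟨X, hX, rfl⟩ := Finset.exists_subset_card_eq hk
    refine linked_of_finset X (fun v => {v}) (fun i _ j _ hij => by simpa using hij)
      fun i hi => ⟨i, ?_, i, ?_, JoinedIn.refl rfl⟩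
    · exact (Finset.mem_inter.1 (hX hi)).1
    · exact (Finset.mem_inter.1 (hX hi)).2
  obtain ⟨u, v, huv⟩ := hE
  let G' := G.deleteEdges {s(u, v)}
  have hle : G' ≤ G := G.deleteEdges_le _
  have hlt : G'.edgeSet.ncard < m := by
    rw [← hm]
    refine Set.ncard_lt_ncard ?_ (Set.toFinite _)
    rw [edgeSet_deleteEdges]
    refine ⟨Set.sdiff_subset, fun hsub => ?_⟩
    have := hsub ((mem_edgeSet G).2 huv)
    simp at this
  have hadj : ∀ x y, G.Adj x y → G'.Adj x y ∨ (x = u ∧ y = v) ∨ (x = v ∧ y = u) := by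
    intro x y hxy
    by_cases he : s(x, y) = s(u, v)
    · right
      simpa using he
    · left
      exact (deleteEdges_adj).2 ⟨hxy, by simpa using he⟩
  by_cases h' : ∀ C : Finset V, C.card < k → ∃ a ∈ A, ∃ b ∈ B, JoinedIn G' (↑C)ᶜ a b
  · obtain ⟨F, hF, hj⟩ := ih _ hlt G' A B h' rfl
    refine ⟨F, hF, fun i => ?_⟩
    obtain ⟨a, ha, b, hb, hab⟩ := hj i
    exact ⟨a, ha, b, hb, hab.map_le hle⟩
  push Not at h'
  obtain ⟨S, hSk, hsep⟩ := h'
  obtain ⟨x, y, hxy, hadj', ⟨a₀, ha₀, hax⟩, hyb⟩ : ∃ x y, G.Adj x y ∧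
      (∀ z w, G.Adj z w → G'.Adj z w ∨ (z = x ∧ w = y) ∨ (z = y ∧ w = x)) ∧
      (∃ a ∈ A, JoinedIn G' (↑S)ᶜ a x) ∧ ∃ b ∈ B, JoinedIn G' (↑S)ᶜ y b := by
    obtain ⟨a, ha, b, hb, hab⟩ := h S hSk
    rcases joinedIn_or_of_edge hadj hab with h1 | ⟨h1, h2⟩ | ⟨h1, h2⟩
    · exact absurd h1 (hsep a ha b hb)
    · exact ⟨u, v, huv, hadj, ⟨a, ha, h1⟩, b, hb, h2⟩
    · refine ⟨v, u, huv.symm, fun z w hzw => ?_, ⟨a, ha, h1⟩, b, hb, h2⟩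
      rcases hadj z w hzw with h | h | h
      exacts [Or.inl h, Or.inr (Or.inr h), Or.inr (Or.inl h)]
  have hadj'' : ∀ z w, G.Adj z w → G'.Adj z w ∨ (z = y ∧ w = x) ∨ (z = x ∧ w = y) := by
    intro z w hzw
    rcases hadj' z w hzw with h | h | h
    exacts [Or.inl h, Or.inr (Or.inr h), Or.inr (Or.inl h)]
  have hsep' : ∀ b ∈ B, ∀ a ∈ A, ¬ JoinedIn G' (↑S)ᶜ b a := fun b hb a ha h =>
    hsep a ha b hb h.symm
  have h1 : ∀ C : Finset V, C.card < k → ∃ a ∈ A, ∃ w ∈ insert x S, JoinedIn G' (↑C)ᶜ a w :=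
    fun C hC => exists_joinedIn_insert hadj' hsep hyb (h C hC)
  have h2 : ∀ C : Finset V, C.card < k → ∃ b ∈ B, ∃ w ∈ insert y S, JoinedIn G' (↑C)ᶜ b w := by
    intro C hC
    refine exists_joinedIn_insert hadj'' hsep' ⟨a₀, ha₀, hax.symm⟩ ?_
    obtain ⟨a, ha, b, hb, hab⟩ := h C hC
    exact ⟨b, hb, a, ha, hab.symm⟩
  have hcx : k ≤ (insert x S).card := by
    by_contra! hlt
    obtain ⟨a, -, w, hw, haw⟩ := h1 _ hlt
    exact haw.right_mem (by simpa using hw)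
  have hcy : k ≤ (insert y S).card := by
    by_contra! hlt
    obtain ⟨a, -, w, hw, haw⟩ := h2 _ hlt
    exact haw.right_mem (by simpa using hw)
  have hxS : x ∉ S := fun hx => by rw [Finset.insert_eq_of_mem hx] at hcx; omega
  have hyS : y ∉ S := fun hx => by rw [Finset.insert_eq_of_mem hx] at hcy; omega
  have hcx' : (insert x S).card = k := by
    rw [Finset.card_insert_of_notMem hxS] at hcx ⊢; omega
  have hcy' : (insert y S).card = k := by
    rw [Finset.card_insert_of_notMem hyS] at hcy ⊢; omega
  have L1 := ih _ hlt G' A (insert x S) h1 rfl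
  have L2 := ih _ hlt G' B (insert y S) h2 rfl
  rw [← hcx'] at L1
  rw [← hcy'] at L2
  obtain ⟨s, p, hsA, hpP, hpD⟩ := L1.exists_paths
  obtain ⟨t, q, htB, hqP, hqD⟩ := L2.exists_paths
  -- a path of the first family meets one of the second only in `S`
  have hmeet : ∀ a ∈ insert x S, ∀ b ∈ insert y S, ∀ z, z ∈ (p a).support → z ∈ (q b).support →
      a = b := by
    intro a ha b hb z hza hzb
    by_contra hab
    refine hsep (s a) (hsA a ha) (t b) (htB b hb) ?_
    have hza' : ∀ r ∈ ((p a).takeUntil z hza).support, r ∉ S := by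
      intro r hr hrS
      have hra : a = r := hpD a ha r (by simp [hrS]) r
        ((p a).support_takeUntil_subset_support hza hr) (by simp)
      subst hra
      have hz : z = a := by
        by_contra hne
        exact Walk.endpoint_notMem_support_takeUntil (hpP a) hza (fun h => hne h.symm) hr
      subst hz
      exact hab (hqD z (by simp [hrS]) b hb z (by simp) hzb)
    have hzb' : ∀ r ∈ ((q b).takeUntil z hzb).support, r ∉ S := by
      intro r hr hrS
      have hra : b = r := hqD b hb r (by simp [hrS]) r
        ((q b).support_takeUntil_subset_support hzb hr) (by simp)
      subst hra
      have hz : z = b := by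
        by_contra hne
        exact Walk.endpoint_notMem_support_takeUntil (hqP b) hzb (fun h => hne h.symm) hr
      subst hz
      exact hab (hpD z (by simp [hrS]) a ha z (by simp) hza).symm
    exact JoinedIn.trans ⟨_, hza'⟩ (JoinedIn.symm ⟨_, hzb'⟩)
  let φ : V → V := fun w => if w = x then y else w
  have hφ : ∀ w ∈ insert x S, φ w ∈ insert y S := by
    intro w hw
    by_cases hwx : w = x
    · simp [φ, hwx]
    · simp [φ, hwx] at hw ⊢
      exact Or.inr hw
  have hφ' : ∀ w ∈ insert x S, ∀ w' ∈ insert x S, w = φ w' ∨ φ w = φ w' → w = w' := by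
    intro w hw w' hw' h
    have : x ≠ y := hxy.ne
    simp only [Finset.mem_insert] at hw hw'
    simp only [φ] at h
    split_ifs at h <;> grind
  rw [← hcx']
  refine linked_of_finset (insert x S) (fun w => {r | r ∈ (p w).support ∨ r ∈ (q (φ w)).support})
    ?_ ?_
  · intro i hi j hj hij
    rw [Set.disjoint_left]
    rintro r (hr | hr) (hr' | hr')
    · exact hij (hpD i hi j hj r hr hr')
    · exact hij (hφ' i hi j hj (Or.inl (hmeet i hi _ (hφ j hj) r hr hr')))
    · exact hij (hφ' j hj i hi (Or.inl (hmeet j hj _ (hφ i hi) r hr' hr))).symm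
    · exact hij (hφ' i hi j hj (Or.inr (hqD _ (hφ i hi) _ (hφ j hj) r hr hr')))
  · intro w hw
    refine ⟨s w, hsA w hw, t (φ w), htB _ (hφ w hw), ?_⟩
    have e1 : JoinedIn G {r | r ∈ (p w).support ∨ r ∈ (q (φ w)).support} (s w) w :=
      JoinedIn.map_le ⟨p w, fun r hr => Or.inl hr⟩ hle
    have e2 : JoinedIn G {r | r ∈ (p w).support ∨ r ∈ (q (φ w)).support} (φ w) (t (φ w)) :=
      (JoinedIn.map_le ⟨q (φ w), fun r hr => Or.inr hr⟩ hle).symm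
    by_cases hwx : w = x
    · have e3 : φ w = y := by simp [φ, hwx]
      refine e1.trans (JoinedIn.trans (JoinedIn.of_adj ?_ e1.right_mem e2.left_mem) e2)
      rw [e3, hwx]
      exact hxy
    · have e3 : φ w = w := by simp [φ, hwx]
      refine e1.trans ?_
      rw [e3] at e2 ⊢
      exact e2

/-- The **fan lemma**: if no set of fewer than `|T \ {z}|` vertices separates `z` from `T` in `U`,
then `z` can be connected to the vertices of `T` within `U` by subgraphs meeting only in `z`. -/
theorem exists_fan [Finite V] [DecidableEq V] (G : SimpleGraph V) (U : Set V) (z : V) (hz : z ∈ U)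
    (T : Finset V)
    (h : ∀ C : Finset V, z ∉ C → C.card < (T.erase z).card →
      ∃ t ∈ T, t ≠ z ∧ JoinedIn G (U \ ↑C) z t) :
    ∃ R : V → G.Subgraph, (∀ t ∈ T, (R t).Connected ∧ z ∈ (R t).verts ∧ t ∈ (R t).verts ∧
      (R t).verts ⊆ U) ∧ ∀ t ∈ T, ∀ t' ∈ T, t ≠ t' → (R t).verts ∩ (R t').verts ⊆ {z} := by
  classical
  have := Fintype.ofFinite V
  let G' : SimpleGraph V :=
    { Adj := fun u v => G.Adj u v ∧ (u ∈ U ∧ u ≠ z) ∧ (v ∈ U ∧ v ≠ z)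
      symm := ⟨fun u v h => ⟨h.1.symm, h.2.2, h.2.1⟩⟩
      loopless := ⟨fun u h => h.1.ne rfl⟩ }
  have hG' : ∀ (X : Set V) a b, JoinedIn G ((U ∩ X) \ {z}) a b → JoinedIn G' X a b := by
    intro X a b hab
    refine hab.induction (P := fun b => JoinedIn G' X a b) (JoinedIn.refl hab.left_mem.1.2) ?_
    intro u v huv hu hv ih
    refine ih.trans (JoinedIn.of_adj ⟨huv, ⟨hu.1.1, hu.2⟩, hv.1.1, hv.2⟩ hu.1.2 hv.1.2)
  let A : Finset V := Finset.univ.filter fun a => G.Adj z a ∧ a ∈ U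
  have hL : Linked G' A (T.erase z) (T.erase z).card := by
    refine menger G' A (T.erase z) _ fun C hC => ?_
    obtain ⟨t, ht, htz, hzt⟩ := h (C.erase z) (by simp)
      ((Finset.card_le_card (Finset.erase_subset _ _)).trans_lt hC)
    obtain ⟨a, ha, hat⟩ := hzt.exists_adj htz
    refine ⟨a, by simp [A, ha, hat.left_mem.1.1], t, by simp [ht, htz], hG' _ _ _ (hat.mono ?_)⟩
    rintro w ⟨⟨hwU, hwC⟩, hwz⟩
    refine ⟨⟨hwU, fun hw => hwC ?_⟩, hwz⟩
    simp only [Set.mem_singleton_iff] at hwz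
    simpa [hwz] using hw
  obtain ⟨s, p, hs, -, hd⟩ := hL.exists_paths
  have key : ∀ t, ∃ R : G.Subgraph, t ∈ T → R.Connected ∧ z ∈ R.verts ∧ t ∈ R.verts ∧
      R.verts ⊆ U ∧ ∀ w ∈ R.verts, w ≠ z → t ≠ z ∧ w ∈ (p t).support := by
    intro t
    by_cases ht : t ∈ T
    swap
    · exact ⟨⊥, fun h => absurd h ht⟩
    by_cases htz : t = z
    · subst htz
      refine ⟨G.singletonSubgraph t, fun _ => ⟨Subgraph.singletonSubgraph_connected, by simp,
        by simp, by simpa using hz, ?_⟩⟩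
      intro w hw hwt
      simp at hw
      exact absurd hw hwt
    · have hsA := hs t (by simp [ht, htz])
      simp only [A, Finset.mem_filter, Finset.mem_univ, true_and] at hsA
      have hle : G' ≤ G := fun u v h => h.1
      have hsup : ∀ w ∈ (p t).support, w ∈ U := by
        have hj : JoinedIn G' {w | w ∈ (p t).support} t (s t) := (JoinedIn.symm ⟨p t, fun _ h => h⟩)
        intro w hw
        refine JoinedIn.induction (P := fun w => w ∈ U) (u := s t) (U := Set.univ) (G := G')
          ⟨(p t).takeUntil w hw, by simp⟩ hsA.2 ?_
        intro x y hxy _ _ _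
        exact hxy.2.2.1
      refine ⟨(Walk.cons hsA.1 ((p t).mapLe hle)).toSubgraph, fun _ =>
        ⟨Walk.toSubgraph_connected _, by simp, by simp, ?_, ?_⟩⟩
      · intro w hw
        rw [Walk.mem_verts_toSubgraph, Walk.support_cons, List.mem_cons] at hw
        rcases hw with rfl | hw
        · exact hz
        · exact hsup w (by simpa using hw)
      · intro w hw hwz
        rw [Walk.mem_verts_toSubgraph, Walk.support_cons, List.mem_cons] at hw
        exact ⟨htz, by simpa using hw.resolve_left hwz⟩
  choose R hR using key
  refine ⟨R, fun t ht => ⟨(hR t ht).1, (hR t ht).2.1, (hR t ht).2.2.1, (hR t ht).2.2.2.1⟩, ?_⟩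
  rintro t ht t' ht' htt w ⟨hw, hw'⟩
  by_contra hwz
  simp only [Set.mem_singleton_iff] at hwz
  obtain ⟨h1, h2⟩ := (hR t ht).2.2.2.2 w hw hwz
  obtain ⟨h3, h4⟩ := (hR t' ht').2.2.2.2 w hw' hwz
  exact htt (hd t (by simp [ht, h1]) t' (by simp [ht', h3]) w h2 h4)

end Menger

section Graph

variable {α : Type*} [Fintype α] [DecidableEq α]

/-- The Cayley graph of `Perm α` on the transpositions moving `a` or `b`. -/
def swapGraph (a b : α) : SimpleGraph (Perm α) where
  Adj σ τ := ∃ i, (i ≠ a ∧ τ = σ * swap a i) ∨ (i ≠ b ∧ τ = σ * swap b i)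
  symm := ⟨by
    rintro σ τ ⟨i, ⟨h, rfl⟩ | ⟨h, rfl⟩⟩
    · exact ⟨i, Or.inl ⟨h, by simp [mul_assoc]⟩⟩
    · exact ⟨i, Or.inr ⟨h, by simp [mul_assoc]⟩⟩⟩
  loopless := ⟨by
    rintro σ ⟨i, ⟨h, h'⟩ | ⟨h, h'⟩⟩
    · exact h (swap_eq_one_iff.1 (left_eq_mul.1 h')).symm
    · exact h (swap_eq_one_iff.1 (left_eq_mul.1 h')).symm⟩

variable {a b c : α}

lemma adj_mul_swap_left (σ : Perm α) {i : α} (h : i ≠ a) :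
    (swapGraph a b).Adj σ (σ * swap a i) := ⟨i, Or.inl ⟨h, rfl⟩⟩

lemma adj_mul_swap_right (σ : Perm α) {i : α} (h : i ≠ b) :
    (swapGraph a b).Adj σ (σ * swap b i) := ⟨i, Or.inr ⟨h, rfl⟩⟩

lemma mul_swap_eq (σ : Perm α) (p q : α) : σ * swap p q = swap (σ p) (σ q) * σ := by
  rw [mul_swap_eq_swap_mul]

lemma adj_swap_mul (v : Perm α) {l : α} (hc : l ≠ v c) (h : v a = l ∨ v b = l) :
    (swapGraph a b).Adj v (swap (v c) l * v) := by
  rcases h with rfl | rfl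
  · rw [← mul_swap_eq, swap_comm]
    exact adj_mul_swap_left v fun h => hc (by rw [h])
  · rw [← mul_swap_eq, swap_comm]
    exact adj_mul_swap_right v fun h => hc (by rw [h])

variable {A : Finset α}

lemma mem_image_iff {σ τ : Perm α} (h : ∀ p, p ∉ A → τ p = σ p) (p : α) :
    τ p ∈ A.image σ ↔ p ∈ A := by
  constructor
  · intro hp
    by_contra hpA
    rw [h p hpA, Finset.mem_image] at hp
    obtain ⟨q, hq, hqp⟩ := hp
    exact hpA (σ.injective hqp ▸ hq)
  · intro hp
    rw [Finset.mem_image]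
    refine ⟨σ.symm (τ p), ?_, by simp⟩
    by_contra hq
    have := h _ hq
    rw [apply_symm_apply, τ.apply_eq_iff_eq] at this
    rw [this] at hq
    exact hq hp

lemma exists_arrangement {σ : Perm α} {l l' : α} (hca : c ≠ a) (hc : c ∈ A) (ha : a ∈ A)
    (hl : l ∈ A.image σ) (hl' : l' ∈ A.image σ) (hne : l ≠ l') :
    ∃ ρ : Perm α, (∀ p, p ∉ A → ρ p = σ p) ∧ ρ c = l ∧ ρ a = l' := by
  obtain ⟨p, hp, rfl⟩ := Finset.mem_image.1 hl
  obtain ⟨q, hq, rfl⟩ := Finset.mem_image.1 hl'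
  have hpq : p ≠ q := fun h => hne (by rw [h])
  refine ⟨σ * swap c p * swap a (swap c p q), fun r hr => ?_, ?_, ?_⟩
  · have : swap c p q ∈ A := by
      rw [swap_apply_def]; split_ifs <;> assumption
    have h1 : swap a (swap c p q) r = r :=
      swap_apply_of_ne_of_ne (fun h => hr (h ▸ ha)) (fun h => hr (h ▸ this))
    have h2 : swap c p r = r :=
      swap_apply_of_ne_of_ne (fun h => hr (h ▸ hc)) (fun h => hr (h ▸ hp))
    rw [Perm.mul_apply, Perm.mul_apply, h1, h2]
  · rw [Perm.mul_apply, Perm.mul_apply, swap_apply_of_ne_of_ne hca, swap_apply_left]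
    intro h
    rw [swap_apply_def] at h
    split_ifs at h <;> grind
  · simp

/-- Two copies are joined by at least `2 (|A| - 2)` disjoint edges. -/
lemma exists_matching {σ : Perm α} {l l' : α} (hab : a ≠ b) (hca : c ≠ a) (hcb : c ≠ b)
    (hc : c ∈ A) (ha : a ∈ A) (hb : b ∈ A)
    (hl : l ∈ A.image σ) (hl' : l' ∈ A.image σ) (hne : l ≠ l') :
    ∃ N : Finset (Perm α), N.card = 2 * (A.card - 2) ∧
      ∀ u ∈ N, (∀ p, p ∉ A → u p = σ p) ∧ u c = l ∧ (u a = l' ∨ u b = l') := by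
  obtain ⟨ρ, hρ, hρc, hρa⟩ := exists_arrangement hca hc ha hl hl' hne
  obtain ⟨ρ', hρ', hρc', hρb⟩ := exists_arrangement hcb hc hb hl hl' hne
  refine ⟨((A.erase a).erase c).image (fun s => ρ * swap b s) ∪
    ((A.erase b).erase c).image (fun s => ρ' * swap a s), ?_, ?_⟩
  · have hinj : ∀ (τ : Perm α) (x : α), Function.Injective fun s => τ * swap x s := by
      intro τ x s t hst
      have := congrArg (fun π : Perm α => π x) (mul_left_cancel hst)
      simpa using this
    rw [Finset.card_union_of_disjoint, Finset.card_image_of_injective _ (hinj _ _),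
      Finset.card_image_of_injective _ (hinj _ _)]
    · rw [Finset.card_erase_of_mem (by grind), Finset.card_erase_of_mem (by grind),
        Finset.card_erase_of_mem (by grind), Finset.card_erase_of_mem (by grind)]
      omega
    · rw [Finset.disjoint_left]
      intro u hu hu'
      obtain ⟨s, hs, rfl⟩ := Finset.mem_image.1 hu
      obtain ⟨t, ht, h⟩ := Finset.mem_image.1 hu'
      have h1 : (ρ * swap b s) a = l' := by
        rw [Perm.mul_apply, swap_apply_of_ne_of_ne hab (by grind), hρa]
      have h2 : (ρ * swap b s) b = l' := by
        rw [← h, Perm.mul_apply, swap_apply_of_ne_of_ne hab.symm (by grind), hρb]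
      exact hab ((ρ * swap b s).injective (h1.trans h2.symm))
  · intro u hu
    rw [Finset.mem_union, Finset.mem_image, Finset.mem_image] at hu
    rcases hu with ⟨s, hs, rfl⟩ | ⟨s, hs, rfl⟩
    · refine ⟨fun p hp => ?_, ?_, Or.inl ?_⟩
      · rw [Perm.mul_apply, swap_apply_of_ne_of_ne (by grind) (by grind), hρ p hp]
      · rw [Perm.mul_apply, swap_apply_of_ne_of_ne hcb (by grind), hρc]
      · rw [Perm.mul_apply, swap_apply_of_ne_of_ne hab (by grind), hρa]
    · refine ⟨fun p hp => ?_, ?_, Or.inr ?_⟩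
      · rw [Perm.mul_apply, swap_apply_of_ne_of_ne (by grind) (by grind), hρ' p hp]
      · rw [Perm.mul_apply, swap_apply_of_ne_of_ne hca (by grind), hρc']
      · rw [Perm.mul_apply, swap_apply_of_ne_of_ne hab.symm (by grind), hρb]

lemma swap_mul_mem {σ u : Perm α} {l l' : α} (hu : ∀ p, p ∉ A → u p = σ p)
    (hl : l ∈ A.image σ) (hl' : l' ∈ A.image σ) :
    ∀ p, p ∉ A → (swap l l' * u) p = σ p := by
  intro p hp
  have := (mem_image_iff hu p).not.2 hp
  rw [Perm.mul_apply, swap_apply_of_ne_of_ne, hu p hp] <;> rintro rfl <;> contradiction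

/-- An edge between two copies, avoiding a small set `C`. -/
lemma exists_edge {σ : Perm α} {l l' : α} (hab : a ≠ b) (hca : c ≠ a) (hcb : c ≠ b)
    (hc : c ∈ A) (ha : a ∈ A) (hb : b ∈ A)
    (hl : l ∈ A.image σ) (hl' : l' ∈ A.image σ) (hne : l ≠ l') (C : Finset (Perm α))
    (hC : (C.filter fun u => u c = l).card + (C.filter fun u => u c = l').card
      < 2 * (A.card - 2)) :
    ∃ u v : Perm α, (swapGraph a b).Adj u v ∧ (∀ p, p ∉ A → u p = σ p) ∧
      (∀ p, p ∉ A → v p = σ p) ∧ u c = l ∧ v c = l' ∧ u ∉ C ∧ v ∉ C := by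
  obtain ⟨N, hN, hN'⟩ := exists_matching hab hca hcb hc ha hb hl hl' hne
  by_contra! hcon
  have key : ∀ u ∈ N, u ∈ C ∨ swap l l' * u ∈ C := by
    intro u hu
    obtain ⟨h1, h2, h3⟩ := hN' u hu
    by_contra! h4
    refine h4.2 (hcon u (swap l l' * u) ?_ h1 (swap_mul_mem h1 hl hl') h2 (by simp [h2]) h4.1)
    have := adj_swap_mul (a := a) (b := b) (c := c) u (l := l') (by rw [h2]; exact hne.symm) h3
    rwa [h2] at this
  have : N.card ≤ ((C.filter fun u => u c = l) ∪ (C.filter fun u => u c = l')).card := by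
    refine Finset.card_le_card_of_injOn (fun u => if u ∈ C then u else swap l l' * u) ?_ ?_
    · intro u hu
      have h2 := (hN' u hu).2.1
      have := key u hu
      by_cases h : u ∈ C
      · simp [h, h2]
      · simp [h, h2, this.resolve_left h]
    · intro u hu v hv huv
      have h2 := (hN' u hu).2.1
      have h2' := (hN' v hv).2.1
      have h5 : ∀ w : Perm α, w c = l → (swap l l' * w) c = l' := fun w hw => by simp [hw]
      simp only at huv
      split_ifs at huv
      · exact huv
      · exact absurd (h2.symm.trans ((congrArg (fun π : Perm α => π c) huv).trans (h5 v h2'))) hne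
      · exact absurd (h2'.symm.trans ((congrArg (fun π : Perm α => π c) huv.symm).trans (h5 u h2)))
          hne
      · exact mul_left_cancel huv
  have := this.trans (Finset.card_union_le _ _)
  omega

end Graph

section Connectivity

variable {α : Type*} [Fintype α] [DecidableEq α] {a b c : α} {A : Finset α}

/-- The perms agreeing with `σ` off `A` induce a subgraph of connectivity at least `2|A| - 3`. -/
def BlockConn (a b : α) (A : Finset α) : Prop :=
  ∀ (C : Finset (Perm α)) (σ τ : Perm α), (∀ p, p ∉ A → τ p = σ p) → σ ∉ C → τ ∉ C →
    C.card + 3 < 2 * A.card →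
    JoinedIn (swapGraph a b) ({ρ | ∀ p, p ∉ A → ρ p = σ p} \ ↑C) σ τ

lemma BlockConn.joinedIn (hA : BlockConn a b A) {C : Finset (Perm α)} {σ τ : Perm α}
    (h : ∀ p, p ∉ A → τ p = σ p) (hσ : σ ∉ C) (hτ : τ ∉ C) (C' : Finset (Perm α))
    (hC' : ∀ ρ ∈ C, (∀ p, p ∉ A → ρ p = σ p) → ρ ∈ C') (hC : C'.card + 3 < 2 * A.card) :
    JoinedIn (swapGraph a b) ({ρ | ∀ p, p ∉ A → ρ p = σ p} \ ↑C) σ τ := by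
  have := hA (C ∩ C') σ τ h (by simp [hσ]) (by simp [hτ])
    ((Nat.add_le_add_right (Finset.card_le_card Finset.inter_subset_right) 3).trans_lt hC)
  refine this.mono ?_
  rintro ρ ⟨h1, h2⟩
  refine ⟨h1, fun h3 => h2 ?_⟩
  simp only [Finset.coe_inter, Set.mem_inter_iff]
  exact ⟨h3, hC' ρ h3 h1⟩

/-- Deleting at most `2|A| - 4` vertices from a block leaves all but at most one of the remaining
vertices of the union of the copies satisfying `P` in one component, if at most one copy is
missing. -/
lemma exists_exceptional (hab : a ≠ b) (hca : c ≠ a) (hcb : c ≠ b)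
    (hc : c ∈ A) (ha : a ∈ A) (hb : b ∈ A) (hA : 4 ≤ A.card) (hK : BlockConn a b (A.erase c))
    (P : α → Prop) (hP : ∀ l l', ¬ P l → ¬ P l' → l = l') (σ : Perm α) (C : Finset (Perm α))
    (hC : C.card + 4 ≤ 2 * A.card) :
    ∃ e, ∀ u v : Perm α, (∀ p, p ∉ A → u p = σ p) → (∀ p, p ∉ A → v p = σ p) → P (u c) → P (v c) →
      u ∉ C → v ∉ C → u ≠ e → v ≠ e →
      JoinedIn (swapGraph a b) ({ρ | (∀ p, p ∉ A → ρ p = σ p) ∧ P (ρ c)} \ ↑C) u v := by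
  classical
  set Γ : Set (Perm α) := {ρ | (∀ p, p ∉ A → ρ p = σ p) ∧ P (ρ c)} \ ↑C with hΓ
  let k : α → ℕ := fun l => (C.filter fun u => u c = l).card
  have hAc : (A.erase c).card = A.card - 1 := Finset.card_erase_of_mem hc
  have hk2 : ∀ l l', l ≠ l' → k l + k l' ≤ C.card := by
    intro l l' hne
    rw [← Finset.card_union_of_disjoint]
    · exact Finset.card_le_card (by grind)
    · rw [Finset.disjoint_left]; grind
  have hk3 : ∀ l l' l'', l ≠ l' → l ≠ l'' → l' ≠ l'' → k l + k l' + k l'' ≤ C.card := by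
    intro l l' l'' h1 h2 h3
    rw [← Finset.card_union_of_disjoint, ← Finset.card_union_of_disjoint]
    · exact Finset.card_le_card (by grind)
    · rw [Finset.disjoint_left]; grind
    · rw [Finset.disjoint_left]; grind
  -- good copies are connected
  have hgood : ∀ u v : Perm α, (∀ p, p ∉ A → u p = σ p) → (∀ p, p ∉ A → v p = σ p) → P (u c) →
      u c = v c → u ∉ C → v ∉ C → k (u c) + 5 < 2 * A.card →
      JoinedIn (swapGraph a b) Γ u v := by
    intro u v hu hv hPu huv huC hvC hk
    refine (hK.joinedIn (C := C) (σ := u) (τ := v) ?_ huC hvC (C.filter fun w => w c = u c) ?_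
      ?_).mono ?_
    · intro p hp
      by_cases hpc : p = c
      · rw [hpc, huv]
      · rw [hu p (by grind), hv p (by grind)]
    · intro ρ hρ h
      simp [hρ, h c]
    · rw [hAc]; simp only [k] at hk; omega
    · rintro ρ ⟨h1, h2⟩
      refine ⟨⟨fun p hp => ?_, ?_⟩, h2⟩
      · rw [h1 p (by grind), hu p hp]
      · rwa [h1 c (by simp)]
  -- an edge between two copies
  have hedge : ∀ u v : Perm α, (∀ p, p ∉ A → u p = σ p) → (∀ p, p ∉ A → v p = σ p) → P (u c) →
      P (v c) → u c ≠ v c → u ∉ C → v ∉ C → k (u c) + 5 < 2 * A.card → k (v c) + 5 < 2 * A.card →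
      k (u c) + k (v c) < 2 * (A.card - 2) → JoinedIn (swapGraph a b) Γ u v := by
    intro u v hu hv hPu hPv hne huC hvC hku hkv hk
    obtain ⟨s, t, hst, hs, ht, hsc, htc, hsC, htC⟩ := exists_edge hab hca hcb hc ha hb
      ((mem_image_iff hu c).2 hc) ((mem_image_iff hv c).2 hc) hne C hk
    refine (hgood u s hu hs hPu hsc.symm huC hsC hku).trans (JoinedIn.trans
      (JoinedIn.of_adj hst ⟨⟨hs, by rwa [hsc]⟩, hsC⟩ ⟨⟨ht, by rwa [htc]⟩, htC⟩)
      (hgood t v ht hv (by rwa [htc]) htc htC hvC (by rwa [htc])))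
  have hgg : ∀ u v : Perm α, (∀ p, p ∉ A → u p = σ p) → (∀ p, p ∉ A → v p = σ p) → P (u c) →
      P (v c) → u ∉ C → v ∉ C → k (u c) + 5 < 2 * A.card → k (v c) + 5 < 2 * A.card →
      JoinedIn (swapGraph a b) Γ u v := by
    intro u v hu hv hPu hPv huC hvC hku hkv
    by_cases hne : u c = v c
    · exact hgood u v hu hv hPu hne huC hvC hku
    by_cases hk : k (u c) + k (v c) < 2 * (A.card - 2)
    · exact hedge u v hu hv hPu hPv hne huC hvC hku hkv hk
    obtain ⟨l, hl, hlu, hlv, hPl⟩ : ∃ l ∈ A.image σ, l ≠ u c ∧ l ≠ v c ∧ P l := by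
      by_contra! hcon
      have hcard : (A.image σ).card = A.card := Finset.card_image_of_injective _ σ.injective
      have : (((A.image σ).erase (u c)).erase (v c)).card ≤ 1 := by
        rw [Finset.card_le_one]
        intro l hl l' hl'
        exact hP l l' (hcon l (by grind) (by grind) (by grind))
          (hcon l' (by grind) (by grind) (by grind))
      have h1 := Finset.pred_card_le_card_erase (s := A.image σ) (a := u c)
      have h2 := Finset.pred_card_le_card_erase (s := (A.image σ).erase (u c)) (a := v c)
      omega
    obtain ⟨w, hw, hwc, -⟩ := exists_arrangement (σ := σ) hca hc ha hl
      ((mem_image_iff hu c).2 hc) hlu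
    have h3 := hk3 _ _ l hne hlu.symm hlv.symm
    have hwC : w ∉ C := by
      intro hwC
      have : 0 < k l := Finset.card_pos.2 ⟨w, by simp [hwC, hwc]⟩
      omega
    subst hwc
    exact (hedge u w hu hw hPu hPl hlu.symm huC hwC hku (by omega) (by omega)).trans
      (hedge w v hw hv hPl hPv hlv hwC hvC (by omega) hkv (by omega))
  by_cases hall : ∀ l, P l → k l + 5 < 2 * A.card
  · exact ⟨1, fun u v hu hv hPu hPv huC hvC _ _ =>
      hgg u v hu hv hPu hPv huC hvC (hall _ hPu) (hall _ hPv)⟩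
  push Not at hall
  obtain ⟨j, hPj, hj⟩ := hall
  have hother : ∀ l, l ≠ j → k l ≤ 1 := by
    intro l hl
    have := hk2 l j hl
    omega
  -- vertices of the bad copy without a neighbour in a good copy
  let B : Perm α → Prop := fun v => (∀ p, p ∉ A → v p = σ p) ∧ v c = j ∧
    ∃ l, l ≠ j ∧ swap j l * v ∈ C
  have hB : ∀ v, (∀ p, p ∉ A → v p = σ p) → P (v c) → v ∉ C → ¬ B v → ∃ w,
      JoinedIn (swapGraph a b) Γ v w ∧ w ∉ C ∧ (∀ p, p ∉ A → w p = σ p) ∧ P (w c) ∧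
      k (w c) + 5 < 2 * A.card := by
    intro v hv hPv hvC hvB
    by_cases hvj : v c = j
    · obtain ⟨l, hl, hPl⟩ : ∃ l, (v a = l ∨ v b = l) ∧ P l := by
        by_contra! hcon
        exact hab (v.injective (hP _ _ (hcon (v a) (by simp)) (hcon (v b) (by simp))))
      have hlc : l ≠ v c := by
        rintro rfl
        rcases hl with h | h
        · exact hca (v.injective h.symm)
        · exact hcb (v.injective h.symm)
      have hmem : l ∈ A.image σ := by
        rcases hl with rfl | rfl
        · exact (mem_image_iff hv a).2 ha
        · exact (mem_image_iff hv b).2 hb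
      have hadj := adj_swap_mul (a := a) (b := b) v hlc hl
      have hw : ∀ p, p ∉ A → (swap (v c) l * v) p = σ p :=
        swap_mul_mem hv ((mem_image_iff hv c).2 hc) hmem
      have hwC : swap (v c) l * v ∉ C := fun h => hvB ⟨hv, hvj, l, hvj ▸ hlc, hvj ▸ h⟩
      have hwc : (swap (v c) l * v) c = l := by simp
      refine ⟨_, JoinedIn.of_adj hadj ⟨⟨hv, hPv⟩, hvC⟩ ⟨⟨hw, ?_⟩, hwC⟩, hwC, hw, ?_, ?_⟩
      · rwa [hwc]
      · rwa [hwc]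
      · rw [hwc]
        have := hother l (hvj ▸ hlc)
        omega
    · have := hother (v c) hvj
      exact ⟨v, JoinedIn.refl ⟨⟨hv, hPv⟩, hvC⟩, hvC, hv, hPv, by omega⟩
  have hB1 : ∀ v v', B v → B v' → v = v' := by
    rintro v v' ⟨hv, hvc, l, hl, hlC⟩ ⟨hv', hvc', l', hl', hlC'⟩
    have hcl : (swap j l * v) c = l := by simp [hvc]
    have hcl' : (swap j l' * v') c = l' := by simp [hvc']
    by_contra hne
    have : 1 < (C.filter fun u => u c ≠ j).card := by
      rw [Finset.one_lt_card]
      refine ⟨_, Finset.mem_filter.2 ⟨hlC, by rwa [hcl]⟩, _,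
        Finset.mem_filter.2 ⟨hlC', by rwa [hcl']⟩, fun h => ?_⟩
      have : l = l' := by rw [← hcl, ← hcl', h]
      rw [this] at h
      exact hne (mul_left_cancel h)
    have h2 := Finset.card_filter_add_card_filter_not (s := C) (fun u : Perm α => u c = j)
    simp only [k] at hj
    simp only [ne_eq] at this
    omega
  obtain ⟨e, he⟩ : ∃ e, ∀ v, B v → v = e := by
    by_cases h : ∃ e, B e
    · exact ⟨h.choose, fun v hv => hB1 _ _ hv h.choose_spec⟩
    · exact ⟨1, fun v hv => absurd ⟨v, hv⟩ h⟩
  refine ⟨e, fun u v hu hv hPu hPv huC hvC hue hve => ?_⟩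
  obtain ⟨u', h1, h2, h3, h4, h5⟩ := hB u hu hPu huC fun h => hue (he u h)
  obtain ⟨v', h1', h2', h3', h4', h5'⟩ := hB v hv hPv hvC fun h => hve (he v h)
  exact h1.trans ((hgg u' v' h3 h3' h4 h4' h2 h2' h5 h5').trans h1'.symm)

lemma mul_swap_injective (τ : Perm α) (x : α) : Function.Injective fun s => τ * swap x s := by
  intro s t hst
  have := congrArg (fun π : Perm α => π x) (mul_left_cancel hst)
  simpa using this

/-- The neighbours of `σ` obtained by moving symbols within `A`. -/
def nbrs (a b : α) (A : Finset α) (σ : Perm α) : Finset (Perm α) :=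
  (A.erase a).image (fun s => σ * swap a s) ∪ ((A.erase a).erase b).image (fun s => σ * swap b s)

lemma card_nbrs (hab : a ≠ b) (ha : a ∈ A) (hb : b ∈ A) (σ : Perm α) :
    (nbrs a b A σ).card = 2 * A.card - 3 := by
  rw [nbrs, Finset.card_union_of_disjoint,
    Finset.card_image_of_injective _ (mul_swap_injective _ _), Finset.card_image_of_injective _ (mul_swap_injective _ _),
    Finset.card_erase_of_mem (a := b) (by grind), Finset.card_erase_of_mem ha]
  · have : 1 < A.card := Finset.one_lt_card.2 ⟨a, ha, b, hb, hab⟩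
    omega
  · rw [Finset.disjoint_left]
    intro u hu hu'
    obtain ⟨s, hs, rfl⟩ := Finset.mem_image.1 hu
    obtain ⟨t, ht, h⟩ := Finset.mem_image.1 hu'
    have := congrArg (fun π : Perm α => π a) (mul_left_cancel h)
    rw [swap_apply_left, swap_apply_of_ne_of_ne hab (by grind)] at this
    grind

lemma mem_nbrs_iff (hab : a ≠ b) (ha : a ∈ A) (hb : b ∈ A) {σ τ : Perm α} :
    τ ∈ nbrs a b A σ ↔ (swapGraph a b).Adj σ τ ∧ ∀ p, p ∉ A → τ p = σ p := by
  constructor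
  · intro h
    simp only [nbrs, Finset.mem_union, Finset.mem_image] at h
    rcases h with ⟨s, hs, rfl⟩ | ⟨s, hs, rfl⟩
    · refine ⟨adj_mul_swap_left _ (by grind), fun p hp => ?_⟩
      rw [Perm.mul_apply, swap_apply_of_ne_of_ne (by grind) (by grind)]
    · refine ⟨adj_mul_swap_right _ (by grind), fun p hp => ?_⟩
      rw [Perm.mul_apply, swap_apply_of_ne_of_ne (by grind) (by grind)]
  · rintro ⟨⟨s, ⟨hs, rfl⟩ | ⟨hs, rfl⟩⟩, h⟩
    · have : s ∈ A := by
        by_contra hsA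
        have := h s hsA
        simp only [Perm.mul_apply, swap_apply_right, EmbeddingLike.apply_eq_iff_eq] at this
        exact hs this.symm
      simp only [nbrs, Finset.mem_union, Finset.mem_image]
      exact Or.inl ⟨s, by grind, rfl⟩
    · have : s ∈ A := by
        by_contra hsA
        have := h s hsA
        simp only [Perm.mul_apply, swap_apply_right, EmbeddingLike.apply_eq_iff_eq] at this
        exact hs this.symm
      simp only [nbrs, Finset.mem_union, Finset.mem_image]
      by_cases hsa : s = a
      · exact Or.inl ⟨b, by grind, by rw [hsa, swap_comm]⟩
      · exact Or.inr ⟨s, by grind, rfl⟩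

lemma exists_nbr_notMem (hab : a ≠ b) (ha : a ∈ A) (hb : b ∈ A) (σ : Perm α)
    (C : Finset (Perm α)) (hC : C.card + 3 < 2 * A.card) :
    ∃ τ ∉ C, (swapGraph a b).Adj σ τ ∧ ∀ p, p ∉ A → τ p = σ p := by
  obtain ⟨τ, hτ, hτC⟩ := Finset.exists_mem_notMem_of_card_lt_card (s := C) (t := nbrs a b A σ)
    (by rw [card_nbrs hab ha hb]; omega)
  exact ⟨τ, hτC, (mem_nbrs_iff hab ha hb).1 hτ⟩

lemma blockConn_of_card_eq_three (hab : a ≠ b) (ha : a ∈ A) (hb : b ∈ A) (hA : A.card = 3) :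
    BlockConn a b A := by
  intro C σ τ h hσ hτ hC
  obtain ⟨c, hc⟩ : ∃ c, (A.erase a).erase b = {c} := by
    rw [← Finset.card_eq_one, Finset.card_erase_of_mem (by grind), Finset.card_erase_of_mem ha, hA]
  have hcA : c ∈ (A.erase a).erase b := by simp [hc]
  have hca : c ≠ a := by grind
  have hcb : c ≠ b := by grind
  have hA' : ∀ p, p ∈ A ↔ p = a ∨ p = b ∨ p = c := by
    intro p
    have : p ∈ (A.erase a).erase b ↔ p = c := by simp [hc]
    grind
  have key : ∀ u v : Perm α, (∀ p, p ∉ A → v p = u p) → (v a = u a ∨ v b = u b ∨ v c = u c) →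
      v = u ∨ (swapGraph a b).Adj u v := by
    intro u v huv hagree
    have hva := mem_image_iff huv a
    have hvb := mem_image_iff huv b
    have hvc := mem_image_iff huv c
    simp only [Finset.mem_image, hA'] at hva hvb hvc
    simp only [hA'] at huv
    have hv := v.injective
    have hva' : v a = u a ∨ v a = u b ∨ v a = u c := by grind
    have hvb' : v b = u a ∨ v b = u b ∨ v b = u c := by grind
    have hvc' : v c = u a ∨ v c = u b ∨ v c = u c := by grind
    have n1 : v a ≠ v b := hv.ne hab
    have n2 : v a ≠ v c := hv.ne hca.symm
    have n3 : v b ≠ v c := hv.ne hcb.symm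
    clear hva hvb hvc hv
    by_cases huv' : v = u
    · exact Or.inl huv'
    right
    have hne : ¬ (v a = u a ∧ v b = u b ∧ v c = u c) := by
      rintro ⟨h1, h2, h3⟩
      refine huv' (Equiv.ext fun p => ?_)
      by_cases hp : p = a ∨ p = b ∨ p = c
      · rcases hp with rfl | rfl | rfl <;> assumption
      · exact huv p hp
    have hswap : ∀ p q, (p = a ∧ q = b ∨ p = a ∧ q = c ∨ p = b ∧ q = c) → v p = u q → v q = u p →
        v = u * swap p q := by
      intro p q hpq h1 h2
      ext r
      rw [Perm.mul_apply, swap_apply_def]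
      split_ifs with hr1 hr2
      · rw [hr1, h1]
      · rw [hr2, h2]
      · by_cases hr : r = a ∨ r = b ∨ r = c
        · grind
        · exact huv r hr
    by_cases h1 : v a = u b ∧ v b = u a
    · rw [hswap a b (by simp) h1.1 h1.2]
      exact adj_mul_swap_left _ hab.symm
    by_cases h2 : v a = u c ∧ v c = u a
    · rw [hswap a c (by simp) h2.1 h2.2]
      exact adj_mul_swap_left _ hca
    by_cases h3 : v b = u c ∧ v c = u b
    · rw [hswap b c (by simp) h3.1 h3.2]
      exact adj_mul_swap_right _ hcb
    grind
  obtain ⟨ρ, hρC, hρ, hρA⟩ := exists_nbr_notMem hab ha hb σ C (by omega)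
  by_cases h1 : τ a = σ a ∨ τ b = σ b ∨ τ c = σ c
  · rcases key σ τ h h1 with rfl | h2
    · exact JoinedIn.refl ⟨fun _ _ => rfl, hσ⟩
    · exact JoinedIn.of_adj h2 ⟨fun _ _ => rfl, hσ⟩ ⟨h, hτ⟩
  have h2 : τ a = ρ a ∨ τ b = ρ b ∨ τ c = ρ c := by
    have hρ' := (mem_nbrs_iff hab ha hb).2 ⟨hρ, hρA⟩
    have hτa := mem_image_iff h a
    have hτb := mem_image_iff h b
    have hτc := mem_image_iff h c
    simp only [Finset.mem_image, hA'] at hτa hτb hτc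
    have n1 : τ a ≠ τ b := τ.injective.ne hab
    have n2 : τ a ≠ τ c := τ.injective.ne hca.symm
    have n3 : τ b ≠ τ c := τ.injective.ne hcb.symm
    rw [nbrs, hc] at hρ'
    simp only [Finset.mem_union, Finset.mem_image, Finset.mem_erase, hA', Finset.mem_singleton]
      at hρ'
    rcases hρ' with ⟨s, ⟨hs, rfl | rfl | rfl⟩, rfl⟩ | ⟨s, rfl, rfl⟩
    · exact absurd rfl hs
    all_goals
      simp only [Perm.mul_apply, swap_apply_left, swap_apply_right]
      grind
  have hj : JoinedIn (swapGraph a b) ({ρ | ∀ p, p ∉ A → ρ p = σ p} \ ↑C) σ ρ :=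
    JoinedIn.of_adj hρ ⟨fun _ _ => rfl, hσ⟩ ⟨hρA, hρC⟩
  rcases key ρ τ (fun p hp => (h p hp).trans (hρA p hp).symm) h2 with rfl | h3
  · exact hj
  · exact hj.trans (JoinedIn.of_adj h3 ⟨hρA, hρC⟩ ⟨h, hτ⟩)

theorem blockConn (hab : a ≠ b) : ∀ (A : Finset α), a ∈ A → b ∈ A → 3 ≤ A.card →
    BlockConn a b A := by
  intro A
  induction A using Finset.strongInduction with
  | H A ih =>
  intro ha hb hA
  obtain hA3 | hA3 := hA.eq_or_lt
  · exact blockConn_of_card_eq_three hab ha hb hA3.symm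
  obtain ⟨c, hc, hcab⟩ := Finset.exists_mem_notMem_of_card_lt_card (s := {a, b}) (t := A)
    (Finset.card_le_two.trans_lt hA)
  have hca : c ≠ a := by grind
  have hcb : c ≠ b := by grind
  have hK : BlockConn a b (A.erase c) := by
    refine ih _ (Finset.erase_ssubset hc) (by grind) (by grind) ?_
    rw [Finset.card_erase_of_mem hc]
    omega
  intro C σ τ h hσ hτ hC
  obtain ⟨e, he⟩ := exists_exceptional hab hca hcb hc ha hb hA3 hK (fun _ => True)
    (by simp) σ C (by omega)
  have key : ∀ u, (∀ p, p ∉ A → u p = σ p) → u ∉ C → ∃ v, (∀ p, p ∉ A → v p = σ p) ∧ v ∉ C ∧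
      v ≠ e ∧ JoinedIn (swapGraph a b) ({ρ | ∀ p, p ∉ A → ρ p = σ p} \ ↑C) u v := by
    intro u hu huC
    by_cases hue : u = e
    · obtain ⟨v, hvC, huv, hv⟩ := exists_nbr_notMem hab ha hb u C (by omega)
      have hv' : ∀ p, p ∉ A → v p = σ p := fun p hp => (hv p hp).trans (hu p hp)
      exact ⟨v, hv', hvC, fun h => huv.ne (hue.trans h.symm),
        JoinedIn.of_adj huv ⟨hu, huC⟩ ⟨hv', hvC⟩⟩
    · exact ⟨u, hu, huC, hue, JoinedIn.refl ⟨hu, huC⟩⟩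
  obtain ⟨u, hu, huC, hue, hju⟩ := key σ (fun _ _ => rfl) hσ
  obtain ⟨v, hv, hvC, hve, hjv⟩ := key τ h hτ
  refine hju.trans (((he u v hu hv trivial trivial huC hvC hue hve).mono ?_).trans hjv.symm)
  simp

end Connectivity

section Packing

variable {V : Type*} {G : SimpleGraph V}

lemma exists_spanning_tree (H : G.Subgraph) (hH : H.Connected) :
    ∃ K : G.Subgraph, K.coe.IsTree ∧ K.verts = H.verts ∧ ∀ u v, K.Adj u v → H.Adj u v := by
  obtain ⟨T, hT, hTt⟩ := hH.coe.exists_isTree_le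
  let K : G.Subgraph :=
    { verts := H.verts
      Adj := fun u v => ∃ (hu : u ∈ H.verts) (hv : v ∈ H.verts), T.Adj ⟨u, hu⟩ ⟨v, hv⟩
      adj_sub := fun ⟨_, _, h⟩ => H.adj_sub (hT h)
      edge_vert := fun ⟨hu, _, _⟩ => hu
      symm := ⟨fun _ _ ⟨hu, hv, h⟩ => ⟨hv, hu, h.symm⟩⟩ }
  have hK : K.coe = T := by
    ext u v
    simp only [K, Subgraph.coe_adj]
    exact ⟨fun ⟨_, _, h⟩ => h, fun h => ⟨u.2, v.2, h⟩⟩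
  exact ⟨K, hK ▸ hTt, rfl, fun u v ⟨_, _, h⟩ => hT h⟩

/-- Connected subgraphs meeting only in `S`, no two of which share an edge inside `S`, yield
internally disjoint trees connecting `S`. -/
lemma connectsSet_of_subgraphs {ι : Type*} [Fintype ι] {S : Set V} (H : ι → G.Subgraph)
    (hconn : ∀ i, (H i).Connected) (hS : ∀ i, S ⊆ (H i).verts)
    (hd : ∀ i j, i ≠ j → (H i).verts ∩ (H j).verts ⊆ S)
    (he : ∀ i j, i ≠ j → ∀ u ∈ S, ∀ v ∈ S, (H i).Adj u v → ¬ (H j).Adj u v) :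
    ConnectsSet G S (Fintype.card ι) := by
  choose K hK hKv hKa using fun i => exists_spanning_tree (H i) (hconn i)
  let e := Fintype.equivFin ι
  have hv : ∀ i j, i ≠ j → (K i).verts ∩ (K j).verts = S := by
    intro i j hij
    rw [hKv, hKv]
    exact (hd i j hij).antisymm (Set.subset_inter (hS i) (hS j))
  refine ⟨fun i => K (e.symm i), fun i => hK _, fun i => hKv (e.symm i) ▸ hS _,
    fun i j hij => hv _ _ (e.symm.injective.ne hij), fun i j hij => ?_⟩
  have hij' := e.symm.injective.ne hij
  rw [Set.disjoint_left]
  intro s hs hs'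
  induction s using Sym2.ind with | _ u v
  rw [Subgraph.mem_edgeSet] at hs hs'
  refine he _ _ hij' u ?_ v ?_ (hKa _ _ _ hs) (hKa _ _ _ hs')
  · exact hv _ _ hij' ▸ ⟨hs.fst_mem, hs'.fst_mem⟩
  · exact hv _ _ hij' ▸ ⟨hs.snd_mem, hs'.snd_mem⟩

/-- Two connected subgraphs linked by an edge. -/
lemma exists_join {H K : G.Subgraph} (hH : H.Connected) (hK : K.Connected) {u v : V}
    (hu : u ∈ H.verts) (hv : v ∈ K.verts) (huv : G.Adj u v) (Q : V → V → Prop)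
    (hHQ : ∀ p q, H.Adj p q → Q p q) (hKQ : ∀ p q, K.Adj p q → Q p q) (h1 : Q u v) (h2 : Q v u) :
    ∃ L : G.Subgraph, L.Connected ∧ L.verts = H.verts ∪ K.verts ∧ ∀ p q, L.Adj p q → Q p q := by
  have c1 : (H ⊔ G.subgraphOfAdj huv).Connected :=
    Subgraph.connected_sup hH.preconnected (Subgraph.subgraphOfAdj_connected huv).preconnected
      ⟨u, hu, by simp⟩
  refine ⟨H ⊔ G.subgraphOfAdj huv ⊔ K,
    Subgraph.connected_sup c1.preconnected hK.preconnected ⟨v, by simp, hv⟩, ?_, ?_⟩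
  · ext w
    simp only [Subgraph.verts_sup, subgraphOfAdj_verts, Set.mem_union, Set.mem_insert_iff,
      Set.mem_singleton_iff]
    constructor
    · rintro ((h | rfl | rfl) | h) <;> tauto
    · tauto
  · intro p q h
    simp only [Subgraph.sup_adj, subgraphOfAdj_adj, Sym2.eq_iff] at h
    rcases h with (h | ⟨rfl, rfl⟩ | ⟨rfl, rfl⟩) | h
    · exact hHQ _ _ h
    · exact h1
    · exact h2
    · exact hKQ _ _ h

/-- Two connected subgraphs sharing a vertex. -/
lemma exists_glue {H K : G.Subgraph} (hH : H.Connected) (hK : K.Connected) {u : V}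
    (hu : u ∈ H.verts) (hv : u ∈ K.verts) (Q : V → V → Prop)
    (hHQ : ∀ p q, H.Adj p q → Q p q) (hKQ : ∀ p q, K.Adj p q → Q p q) :
    ∃ L : G.Subgraph, L.Connected ∧ L.verts = H.verts ∪ K.verts ∧ ∀ p q, L.Adj p q → Q p q := by
  refine ⟨H ⊔ K, Subgraph.connected_sup hH.preconnected hK.preconnected ⟨u, hu, hv⟩, by simp, ?_⟩
  intro p q h
  exact h.elim (hHQ _ _) (hKQ _ _)

lemma exists_attach {H : G.Subgraph} (hH : H.Connected) {u v : V}
    (hu : u ∈ H.verts) (huv : G.Adj u v) (Q : V → V → Prop)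
    (hHQ : ∀ p q, H.Adj p q → Q p q) (h1 : Q u v) (h2 : Q v u) :
    ∃ L : G.Subgraph, L.Connected ∧ L.verts = insert v H.verts ∧ ∀ p q, L.Adj p q → Q p q := by
  obtain ⟨L, h, h', h''⟩ := exists_join hH (Subgraph.singletonSubgraph_connected (v := v)) hu
    (by simp) huv Q hHQ (by simp) h1 h2
  exact ⟨L, h, by rw [h']; simp, h''⟩

lemma connectsSet_of_two_one {U : Set V} {x y z : V} (hx : x ∈ U) (hy : y ∈ U) (hz : z ∉ U)
    (T : Finset V) (X O : V → G.Subgraph) (hX : ∀ t ∈ T, (X t).Connected)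
    (hxX : ∀ t ∈ T, x ∈ (X t).verts) (hyX : ∀ t ∈ T, y ∈ (X t).verts)
    (hXU : ∀ t ∈ T, (X t).verts ⊆ U)
    (hXd : ∀ t ∈ T, ∀ t' ∈ T, t ≠ t' → (X t).verts ∩ (X t').verts ⊆ {x, y})
    (hXa : ∀ t ∈ T, t ≠ x → ∀ p q, (X t).Adj p q →
      ¬ (p ∈ ({x, y, z} : Set V) ∧ q ∈ ({x, y, z} : Set V)))
    (hO : ∀ t ∈ T, (O t).Connected) (hzO : ∀ t ∈ T, z ∈ (O t).verts)
    (hOU : ∀ t ∈ T, Disjoint (O t).verts U)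
    (hOd : ∀ t ∈ T, ∀ t' ∈ T, t ≠ t' → (O t).verts ∩ (O t').verts ⊆ {z})
    (hXO : ∀ t ∈ T, ∃ r ∈ (X t).verts, ∃ o ∈ (O t).verts, G.Adj r o ∧
      ¬ (r ∈ ({x, y, z} : Set V) ∧ o ∈ ({x, y, z} : Set V)))
    (Y : G.Subgraph) (hY : Y.Connected) (hxY : x ∈ Y.verts) (hyY : y ∈ Y.verts)
    (hzY : z ∈ Y.verts) (hYU : Y.verts ∩ U ⊆ {x, y})
    (hYO : ∀ t ∈ T, Y.verts ∩ (O t).verts ⊆ {z})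
    (hYa : ∀ p q, Y.Adj p q → p ∈ ({x, y, z} : Set V) → q ∈ ({x, y, z} : Set V) →
      p = z ∨ q = z) :
    ConnectsSet G {x, y, z} (T.card + 1) := by
  have hH : ∀ t : {t // t ∈ T}, ∃ L : G.Subgraph, L.Connected ∧
      L.verts = (X t).verts ∪ (O t).verts ∧
      ∀ p q, L.Adj p q → p ∈ ({x, y, z} : Set V) → q ∈ ({x, y, z} : Set V) →
        t.1 = x ∧ p ≠ z ∧ q ≠ z := by
    rintro ⟨t, ht⟩
    obtain ⟨r, hr, o, ho, hro, hS⟩ := hXO t ht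
    refine exists_join (hX t ht) (hO t ht) hr ho hro
      (fun p q => p ∈ ({x, y, z} : Set V) → q ∈ ({x, y, z} : Set V) → t = x ∧ p ≠ z ∧ q ≠ z)
      ?_ ?_ ?_ ?_
    · intro p q hpq hp hq
      refine ⟨by_contra fun h => hXa t ht h p q hpq ⟨hp, hq⟩, ?_, ?_⟩
      · rintro rfl
        exact hz (hXU t ht hpq.fst_mem)
      · rintro rfl
        exact hz (hXU t ht hpq.snd_mem)
    · intro p q hpq hp hq
      have key : ∀ w ∈ (O t).verts, w ∈ ({x, y, z} : Set V) → w = z := by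
        rintro w hw (rfl | rfl | rfl)
        · exact absurd hx (Set.disjoint_left.1 (hOU t ht) hw)
        · exact absurd hy (Set.disjoint_left.1 (hOU t ht) hw)
        · rfl
      exact absurd ((key p hpq.fst_mem hp).trans (key q hpq.snd_mem hq).symm) hpq.ne
    · exact fun h h' => absurd ⟨h, h'⟩ hS
    · exact fun h h' => absurd ⟨h', h⟩ hS
  choose H hHc hHv hHa using hH
  have h := connectsSet_of_subgraphs (ι := Option {t // t ∈ T}) (S := {x, y, z})
    (fun i => i.elim Y H) ?_ ?_ ?_ ?_
  · simpa using h
  · rintro (_ | t)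
    · exact hY
    · exact hHc t
  · rintro (_ | t) w (rfl | rfl | rfl)
    · exact hxY
    · exact hyY
    · exact hzY
    · simpa [hHv] using Or.inl (hxX t t.2)
    · simpa [hHv] using Or.inl (hyX t t.2)
    · simpa [hHv] using Or.inr (hzO t t.2)
  · have h1 : ∀ t : {t // t ∈ T}, Y.verts ∩ (H t).verts ⊆ {x, y, z} := by
      rintro t w ⟨hw, hw'⟩
      rw [hHv] at hw'
      rcases hw' with hw' | hw'
      · have := hYU ⟨hw, hXU t t.2 hw'⟩
        simp at this ⊢
        tauto
      · have := hYO t t.2 ⟨hw, hw'⟩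
        simp at this ⊢
        tauto
    rintro (_ | t) (_ | t') htt
    · exact absurd rfl htt
    · exact h1 t'
    · exact (Set.inter_comm _ _).trans_subset (h1 t)
    · have htt' : t.1 ≠ t'.1 := fun h => htt (by rw [Subtype.ext h])
      rintro w ⟨hw, hw'⟩
      simp only [Option.elim_some, hHv] at hw hw'
      rcases hw with hw | hw <;> rcases hw' with hw' | hw'
      · have := hXd t t.2 t' t'.2 htt' ⟨hw, hw'⟩
        simp at this ⊢
        tauto
      · exact absurd (hXU t t.2 hw) (Set.disjoint_left.1 (hOU t' t'.2) hw')
      · exact absurd (hXU t' t'.2 hw') (Set.disjoint_left.1 (hOU t t.2) hw)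
      · have := hOd t t.2 t' t'.2 htt' ⟨hw, hw'⟩
        simp at this ⊢
        tauto
  · rintro (_ | t) (_ | t') htt p hp q hq h1 h2
    · exact htt rfl
    · have := hYa p q h1 hp hq
      have := hHa t' p q h2 hp hq
      tauto
    · have := hYa p q h2 hp hq
      have := hHa t p q h1 hp hq
      tauto
    · have h3 := (hHa t p q h1 hp hq).1
      have h4 := (hHa t' p q h2 hp hq).1
      exact htt (by rw [Subtype.ext (h3.trans h4.symm)])

end Packing

section Copies

variable {α : Type*} [Fintype α] [DecidableEq α] {a b c : α}

lemma copy_joinedIn (hab : a ≠ b) (hca : c ≠ a) (hcb : c ≠ b) (hn : 4 ≤ Fintype.card α)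
    {C : Finset (Perm α)} {σ τ : Perm α} (h : τ c = σ c) (hσ : σ ∉ C) (hτ : τ ∉ C)
    (C' : Finset (Perm α)) (hC' : ∀ ρ ∈ C, ρ c = σ c → ρ ∈ C')
    (hcard : C'.card + 5 < 2 * Fintype.card α) :
    JoinedIn (swapGraph a b) ({ρ | ρ c = σ c} \ ↑C) σ τ := by
  have hAc : (Finset.univ.erase c).card = Fintype.card α - 1 := by
    rw [Finset.card_erase_of_mem (Finset.mem_univ c), Finset.card_univ]
  have hK := blockConn (a := a) (b := b) hab (Finset.univ.erase c) (by simp [hca.symm])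
    (by simp [hcb.symm]) (by omega)
  have := hK.joinedIn (C := C) (σ := σ) (τ := τ) (by simpa using h) hσ hτ C'
    (fun ρ hρ h => hC' ρ hρ (h c (by simp))) (by omega)
  simpa using this

/-- A fan inside a copy, avoiding a set `E`. -/
lemma exists_fan_copy (hab : a ≠ b) (hca : c ≠ a) (hcb : c ≠ b) (hn : 4 ≤ Fintype.card α)
    (x : Perm α) (E T : Finset (Perm α)) (hxE : x ∉ E) (hT : ∀ t ∈ T, t c = x c ∧ t ∉ E)
    (hcard : (T.erase x).card + E.card + 5 ≤ 2 * Fintype.card α) :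
    ∃ R : Perm α → (swapGraph a b).Subgraph, (∀ t ∈ T, (R t).Connected ∧ x ∈ (R t).verts ∧
      t ∈ (R t).verts ∧ (R t).verts ⊆ {ρ | ρ c = x c} \ ↑E) ∧
      ∀ t ∈ T, ∀ t' ∈ T, t ≠ t' → (R t).verts ∩ (R t').verts ⊆ {x} := by
  refine exists_fan (swapGraph a b) ({ρ | ρ c = x c} \ ↑E) x ⟨rfl, hxE⟩ T fun C hxC hC => ?_
  obtain ⟨t, ht, htC⟩ := Finset.exists_mem_notMem_of_card_lt_card hC
  rw [Finset.mem_erase] at ht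
  obtain ⟨htc, htE⟩ := hT t ht.2
  refine ⟨t, ht.2, ht.1, (copy_joinedIn (C := E ∪ C) hab hca hcb hn htc (by simp [hxE, hxC])
    (by simp [htC, htE]) (E ∪ C) (fun _ h _ => h) ?_).mono ?_⟩
  · have := Finset.card_union_le E C
    omega
  · rintro ρ ⟨h1, h2⟩
    simp only [Finset.coe_union, Set.mem_union, not_or] at h2
    exact ⟨⟨h1, h2.1⟩, h2.2⟩

lemma Adj.eq_swap_mul {u v : Perm α} (h : (swapGraph a b).Adj u v) (hc : v c ≠ u c)
    (hca : c ≠ a) (hcb : c ≠ b) :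
    v = swap (u c) (v c) * u ∧ (u a = v c ∨ u b = v c) := by
  obtain ⟨i, ⟨hi, rfl⟩ | ⟨hi, rfl⟩⟩ := h
  · obtain rfl : i = c := by
      by_contra hic
      rw [Perm.mul_apply, swap_apply_of_ne_of_ne hca (Ne.symm hic)] at hc
      exact hc rfl
    rw [mul_swap_eq]
    simp [swap_comm]
  · obtain rfl : i = c := by
      by_contra hic
      rw [Perm.mul_apply, swap_apply_of_ne_of_ne hcb (Ne.symm hic)] at hc
      exact hc rfl
    rw [mul_swap_eq]
    simp [swap_comm]

/-- A vertex has at most one neighbour in each other copy. -/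
lemma Adj.unique {u v w : Perm α} (hv : (swapGraph a b).Adj u v) (hw : (swapGraph a b).Adj u w)
    (hc : v c ≠ u c) (hvw : v c = w c) (hca : c ≠ a) (hcb : c ≠ b) : v = w := by
  rw [(Adj.eq_swap_mul hv hc hca hcb).1, (Adj.eq_swap_mul hw (hvw ▸ hc) hca hcb).1, hvw]

/-- A fan outside a copy, towards vertices adjacent to that copy. -/
lemma exists_fan_outer (hab : a ≠ b) (hca : c ≠ a) (hcb : c ≠ b) (hn : 4 ≤ Fintype.card α)
    (i : α) (z : Perm α) (hz : z c ≠ i) (T : Finset (Perm α)) (hzT : z ∉ T)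
    (hT : ∀ t ∈ T, t c ≠ i ∧ (t a = i ∨ t b = i))
    (hcard : T.card + 4 ≤ 2 * Fintype.card α ∨
      (z a ≠ i ∧ z b ≠ i ∧ T.card + 3 ≤ 2 * Fintype.card α)) :
    ∃ R : Perm α → (swapGraph a b).Subgraph, (∀ t ∈ T, (R t).Connected ∧ z ∈ (R t).verts ∧
      t ∈ (R t).verts ∧ (R t).verts ⊆ {ρ | ρ c ≠ i}) ∧
      ∀ t ∈ T, ∀ t' ∈ T, t ≠ t' → (R t).verts ∩ (R t').verts ⊆ {z} := by
  refine exists_fan (swapGraph a b) _ z hz T fun C hzC hC => ?_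
  rw [Finset.erase_eq_of_notMem hzT] at hC
  have hAc : (Finset.univ.erase c).card = Fintype.card α - 1 := by
    rw [Finset.card_erase_of_mem (Finset.mem_univ c), Finset.card_univ]
  have hK := blockConn (a := a) (b := b) hab (Finset.univ.erase c) (by simp [hca.symm])
    (by simp [hcb.symm]) (by omega)
  obtain ⟨e, he⟩ := exists_exceptional (a := a) (b := b) (A := Finset.univ) hab hca hcb (by simp)
    (by simp) (by simp) (by simpa using hn) hK (fun l => l ≠ i) (by simp) 1 C
    (by rw [Finset.card_univ]; omega)
  simp only [Finset.mem_univ, not_true_eq_false, false_implies, implies_true, forall_const,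
    true_and] at he
  -- a neighbour of `z` in the outer part
  obtain ⟨q, hqC, hzq, hqi⟩ : ∃ q ∉ C, (swapGraph a b).Adj z q ∧ q c ≠ i := by
    by_cases hzi : z a ≠ i ∧ z b ≠ i
    · obtain ⟨q, hqC, hq, -⟩ := exists_nbr_notMem (a := a) (b := b) (A := Finset.univ) hab
        (by simp) (by simp) z C (by rw [Finset.card_univ]; omega)
      refine ⟨q, hqC, hq, fun hqi => ?_⟩
      have := (Adj.eq_swap_mul hq (hqi.trans_ne hz.symm) hca hcb).2
      rw [hqi] at this
      tauto
    · obtain ⟨q, hqC, hq, -⟩ := exists_nbr_notMem (a := a) (b := b) (A := Finset.univ) hab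
        (by simp) (by simp) z (insert (swap (z c) i * z) C) (by
          have := Finset.card_insert_le (swap (z c) i * z) C
          rw [Finset.card_univ]
          rcases hcard with h | h
          · omega
          · tauto)
      rw [Finset.mem_insert, not_or] at hqC
      refine ⟨q, hqC.2, hq, fun hqi => ?_⟩
      have := (Adj.eq_swap_mul hq (hqi.trans_ne hz.symm) hca hcb).1
      rw [hqi] at this
      exact hqC.1 this
  have hzj : ∀ v, v ∉ C → v c ≠ i → v ≠ e →
      JoinedIn (swapGraph a b) ({ρ | ρ c ≠ i} \ ↑C) z v := by
    intro v hv hvi hve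
    by_cases hze : z = e
    · refine (JoinedIn.of_adj (U := {ρ : Perm α | ρ c ≠ i} \ ↑C) hzq ⟨hz, hzC⟩
        ⟨hqi, hqC⟩).trans (he q v hqi hvi hqC hv ?_ hve)
      rintro rfl
      exact hzq.ne hze
    · exact he z v hz hvi hzC hv hze hve
  obtain ⟨t, ht, htC⟩ := Finset.exists_mem_notMem_of_card_lt_card hC
  have htz : t ≠ z := fun h => hzT (h ▸ ht)
  by_cases hte : t ≠ e
  · exact ⟨t, ht, htz, hzj t htC (hT t ht).1 hte⟩
  push Not at hte
  subst hte
  by_cases hCT : ∃ t' ∈ T, t' ∉ C ∧ t' ≠ t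
  · obtain ⟨t', ht', ht'C, hne⟩ := hCT
    exact ⟨t', ht', fun h => hzT (h ▸ ht'), hzj t' ht'C (hT t' ht').1 hne⟩
  push Not at hCT
  have hCeq : C = T.erase t := by
    refine (Finset.eq_of_subset_of_card_le ?_ ?_).symm
    · intro s hs
      rw [Finset.mem_erase] at hs
      exact by_contra fun h => hs.1 (hCT s hs.2 h)
    · rw [Finset.card_erase_of_mem ht]
      omega
  obtain ⟨s, -, hs⟩ := Finset.exists_mem_notMem_of_card_lt_card (s := {a, b, c})
    (t := Finset.univ) (by rw [Finset.card_univ]; exact Finset.card_le_three.trans_lt hn)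
  simp only [Finset.mem_insert, Finset.mem_singleton, not_or] at hs
  obtain ⟨hti, htab⟩ := hT t ht
  obtain ⟨r, htr, hrc, hra, hrb⟩ :
      ∃ r, (swapGraph a b).Adj t r ∧ r c = t c ∧ r a ≠ i ∧ r b ≠ i := by
    rcases htab with h | h
    · refine ⟨_, adj_mul_swap_left t hs.1, ?_, ?_, ?_⟩
      · rw [Perm.mul_apply, swap_apply_of_ne_of_ne hca (Ne.symm hs.2.2)]
      · rw [Perm.mul_apply, swap_apply_left, ← h]
        exact t.injective.ne hs.1
      · rw [Perm.mul_apply, swap_apply_of_ne_of_ne hab.symm (Ne.symm hs.2.1), ← h]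
        exact t.injective.ne hab.symm
    · refine ⟨_, adj_mul_swap_right t hs.2.1, ?_, ?_, ?_⟩
      · rw [Perm.mul_apply, swap_apply_of_ne_of_ne hcb (Ne.symm hs.2.2)]
      · rw [Perm.mul_apply, swap_apply_of_ne_of_ne hab (Ne.symm hs.1), ← h]
        exact t.injective.ne hab
      · rw [Perm.mul_apply, swap_apply_left, ← h]
        exact t.injective.ne hs.2.1
  have hrC : r ∉ C := by
    rw [hCeq, Finset.mem_erase]
    rintro ⟨-, hr⟩
    have := (hT r hr).2
    tauto
  refine ⟨t, ht, htz, (hzj r hrC (hrc ▸ hti) htr.ne').trans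
    (JoinedIn.of_adj htr.symm ⟨hrc.trans_ne hti, hrC⟩ ⟨hti, htC⟩)⟩

end Copies

section TwoOne

variable {α : Type*} [Fintype α] [DecidableEq α] {a b c : α}

/-- The neighbours of `y` in its own copy. -/
abbrev copyNbrs (a b c : α) (y : Perm α) : Finset (Perm α) := nbrs a b (Finset.univ.erase c) y

lemma mem_copyNbrs (hab : a ≠ b) (hca : c ≠ a) (hcb : c ≠ b) {y t : Perm α} :
    t ∈ copyNbrs a b c y ↔ (swapGraph a b).Adj y t ∧ t c = y c := by
  rw [mem_nbrs_iff hab (by simp [hca.symm]) (by simp [hcb.symm])]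
  simp

lemma card_copyNbrs (hab : a ≠ b) (hca : c ≠ a) (hcb : c ≠ b) (y : Perm α) :
    (copyNbrs a b c y).card = 2 * Fintype.card α - 5 := by
  rw [card_nbrs hab (by simp [hca.symm]) (by simp [hcb.symm]),
    Finset.card_erase_of_mem (Finset.mem_univ c), Finset.card_univ]
  omega

lemma exists_fan_copyNbrs (hab : a ≠ b) (hca : c ≠ a) (hcb : c ≠ b) (hn : 4 ≤ Fintype.card α)
    {x y : Perm α} (hxy : x ≠ y) (hc : x c = y c) :
    ∃ R : Perm α → (swapGraph a b).Subgraph, (∀ t ∈ copyNbrs a b c y, (R t).Connected ∧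
      x ∈ (R t).verts ∧ t ∈ (R t).verts ∧ (R t).verts ⊆ {ρ | ρ c = x c} \ {y}) ∧
      ∀ t ∈ copyNbrs a b c y, ∀ t' ∈ copyNbrs a b c y, t ≠ t' →
        (R t).verts ∩ (R t').verts ⊆ {x} := by
  have hcard := card_copyNbrs (α := α) hab hca hcb y
  by_cases hx : x ∈ copyNbrs a b c y
  · have := exists_fan_copy hab hca hcb hn x {y} (copyNbrs a b c y) (by simpa using hxy) ?_ ?_
    · simpa using this
    · intro t ht
      rw [mem_copyNbrs hab hca hcb] at ht
      exact ⟨ht.2.trans hc.symm, by simpa using ht.1.ne'⟩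
    · rw [Finset.card_erase_of_mem hx, hcard, Finset.card_singleton]
      omega
  · refine exists_fan (swapGraph a b) ({ρ | ρ c = x c} \ {y}) x ⟨rfl, hxy⟩ _ fun C hxC hC => ?_
    rw [Finset.erase_eq_of_notMem hx, hcard] at hC
    have h1 := copy_joinedIn (C := C.erase y) hab hca hcb hn hc.symm (by simp [hxC]) (by simp)
      (C.erase y) (fun _ h _ => h) (by
        have := Finset.card_le_card (Finset.erase_subset y C)
        omega)
    obtain ⟨t, ht, htx⟩ := h1.symm.exists_adj hxy
    have htm := htx.left_mem
    refine ⟨t, (mem_copyNbrs hab hca hcb).2 ⟨ht, htm.1.1.trans hc⟩, ?_, htx.symm.mono ?_⟩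
    · rintro rfl
      exact hx ((mem_copyNbrs hab hca hcb).2 ⟨ht, hc⟩)
    · rintro ρ ⟨⟨h1, h2⟩, h3⟩
      refine ⟨⟨h1, h3⟩, fun h => h2 ?_⟩
      simpa using ⟨h, h3⟩

/-- The common first stage: internally disjoint subgraphs from `x` to `y` inside their copy. -/
lemma exists_links (hab : a ≠ b) (hca : c ≠ a) (hcb : c ≠ b)
    {x y z : Perm α} (hz : z c ≠ x c)
    (R : Perm α → (swapGraph a b).Subgraph)
    (hR : ∀ t ∈ copyNbrs a b c y, (R t).Connected ∧
      x ∈ (R t).verts ∧ t ∈ (R t).verts ∧ (R t).verts ⊆ {ρ | ρ c = x c} \ {y})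
    (hd : ∀ t ∈ copyNbrs a b c y, ∀ t' ∈ copyNbrs a b c y, t ≠ t' →
        (R t).verts ∩ (R t').verts ⊆ {x}) :
    ∃ X : Perm α → (swapGraph a b).Subgraph, ∀ t ∈ copyNbrs a b c y, (X t).Connected ∧
      (X t).verts = insert y (R t).verts ∧ (t ≠ x → ∀ p q, (X t).Adj p q →
      ¬ (p ∈ ({x, y, z} : Set (Perm α)) ∧ q ∈ ({x, y, z} : Set (Perm α)))) := by
  have key : ∀ t, ∃ L : (swapGraph a b).Subgraph, t ∈ copyNbrs a b c y → L.Connected ∧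
      L.verts = insert y (R t).verts ∧ (t ≠ x → ∀ p q, L.Adj p q →
      ¬ (p ∈ ({x, y, z} : Set (Perm α)) ∧ q ∈ ({x, y, z} : Set (Perm α)))) := by
    intro t
    by_cases ht : t ∈ copyNbrs a b c y
    swap
    · exact ⟨⊥, fun h => absurd h ht⟩
    have ht' := (mem_copyNbrs hab hca hcb).1 ht
    obtain ⟨h1, h2, h3, h4⟩ := hR t ht
    have hS : ∀ w ∈ (R t).verts, w ∈ ({x, y, z} : Set (Perm α)) → w = x := by
      rintro w hw (rfl | rfl | rfl)
      · rfl
      · exact absurd rfl (h4 hw).2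
      · exact absurd (h4 hw).1 hz
    have hQ : ∀ p q, (R t).Adj p q →
        t ≠ x → ¬ (p ∈ ({x, y, z} : Set (Perm α)) ∧ q ∈ ({x, y, z} : Set (Perm α))) := by
      rintro p q hpq - ⟨hp, hq⟩
      exact hpq.ne ((hS p hpq.fst_mem hp).trans (hS q hpq.snd_mem hq).symm)
    obtain ⟨L, hL, hLv, hLa⟩ := exists_attach h1 h3 ht'.1.symm
      (fun p q => t ≠ x → ¬ (p ∈ ({x, y, z} : Set (Perm α)) ∧ q ∈ ({x, y, z} : Set (Perm α))))
      hQ (fun htx h => htx (hS t h3 h.1)) (fun htx h => htx (hS t h3 h.2))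
    exact ⟨L, fun _ => ⟨hL, hLv, fun htx p q hpq => hLa p q hpq htx⟩⟩
  choose X hX using key
  exact ⟨X, fun t ht => hX t ht⟩

end TwoOne

section TwoOne

variable {V : Type*} {G : SimpleGraph V}

/-- Variant of `connectsSet_of_two_one` in which the last subgraph is attached to `x` and `y` by
two edges. -/
lemma connectsSet_of_two_one_of_adj {U : Set V} {x y z : V} (hx : x ∈ U) (hy : y ∈ U) (hz : z ∉ U)
    (T : Finset V) (X O : V → G.Subgraph) (hX : ∀ t ∈ T, (X t).Connected ∧ x ∈ (X t).verts ∧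
      y ∈ (X t).verts ∧ (X t).verts ⊆ U)
    (hXd : ∀ t ∈ T, ∀ t' ∈ T, t ≠ t' → (X t).verts ∩ (X t').verts ⊆ {x, y})
    (hXa : ∀ t ∈ T, t ≠ x → ∀ p q, (X t).Adj p q →
      ¬ (p ∈ ({x, y, z} : Set V) ∧ q ∈ ({x, y, z} : Set V)))
    (hO : ∀ t ∈ T, (O t).Connected ∧ z ∈ (O t).verts ∧ Disjoint (O t).verts U)
    (hOd : ∀ t ∈ T, ∀ t' ∈ T, t ≠ t' → (O t).verts ∩ (O t').verts ⊆ {z})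
    (hXO : ∀ t ∈ T, ∃ r ∈ (X t).verts, ∃ o ∈ (O t).verts, G.Adj r o ∧
      ¬ (r ∈ ({x, y, z} : Set V) ∧ o ∈ ({x, y, z} : Set V)))
    (Y : G.Subgraph) (hY : Y.Connected) (hzY : z ∈ Y.verts) (hYU : Disjoint Y.verts U)
    (hxY : ∃ o ∈ Y.verts, G.Adj o x) (hyY : ∃ o ∈ Y.verts, G.Adj o y)
    (hYO : ∀ t ∈ T, Y.verts ∩ (O t).verts ⊆ {z}) :
    ConnectsSet G {x, y, z} (T.card + 1) := by
  obtain ⟨o, ho, hox⟩ := hxY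
  obtain ⟨o', ho', hoy⟩ := hyY
  have key : ∀ w ∈ Y.verts, w ∈ ({x, y, z} : Set V) → w = z := by
    rintro w hw (rfl | rfl | rfl)
    · exact absurd hx (Set.disjoint_left.1 hYU hw)
    · exact absurd hy (Set.disjoint_left.1 hYU hw)
    · rfl
  let Q : V → V → Prop := fun p q => p ∈ ({x, y, z} : Set V) → q ∈ ({x, y, z} : Set V) →
    p = z ∨ q = z
  obtain ⟨Y1, hY1, hY1v, hY1a⟩ := exists_attach hY ho hox Q
    (fun p q h hp _ => Or.inl (key p h.fst_mem hp)) (fun h _ => Or.inl (key _ ho h))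
    (fun _ h => Or.inr (key _ ho h))
  obtain ⟨Y2, hY2, hY2v, hY2a⟩ := exists_attach hY1 (by rw [hY1v]; exact Or.inr ho') hoy Q hY1a
    (fun h _ => Or.inl (key _ ho' h)) (fun _ h => Or.inr (key _ ho' h))
  have hv : ∀ w, w ∈ Y2.verts ↔ w = y ∨ w = x ∨ w ∈ Y.verts := by
    intro w
    rw [hY2v, hY1v]
    rfl
  refine connectsSet_of_two_one hx hy hz T X O (fun t ht => (hX t ht).1) (fun t ht => (hX t ht).2.1)
    (fun t ht => (hX t ht).2.2.1) (fun t ht => (hX t ht).2.2.2) hXd hXa (fun t ht => (hO t ht).1)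
    (fun t ht => (hO t ht).2.1) (fun t ht => (hO t ht).2.2) hOd hXO Y2 hY2 ?_ ?_ ?_ ?_ ?_ hY2a
  · simp [hv]
  · simp [hv]
  · simp [hv, hzY]
  · rintro w ⟨hw, hwU⟩
    rcases (hv w).1 hw with rfl | rfl | hw
    · simp
    · simp
    · exact absurd hwU (Set.disjoint_left.1 hYU hw)
  · rintro t ht w ⟨hw, hwO⟩
    rcases (hv w).1 hw with rfl | rfl | hw
    · exact absurd hy (Set.disjoint_left.1 (hO t ht).2.2 hwO)
    · exact absurd hx (Set.disjoint_left.1 (hO t ht).2.2 hwO)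
    · exact hYO t ht ⟨hw, hwO⟩

/-- The initial segment of a walk up to its first vertex in `W`. -/
lemma JoinedIn.exists_first_hit {U W : Set V} {u v : V} (h : JoinedIn G U u v) (hv : v ∈ W) :
    ∃ w ∈ W, ∃ H : G.Subgraph, H.Connected ∧ u ∈ H.verts ∧ w ∈ H.verts ∧ H.verts ⊆ U ∧
      H.verts ∩ W ⊆ {w} := by
  obtain ⟨p, hp⟩ := h
  have single : ∀ u, u ∈ U → u ∈ W → ∃ w ∈ W, ∃ H : G.Subgraph, H.Connected ∧ u ∈ H.verts ∧
      w ∈ H.verts ∧ H.verts ⊆ U ∧ H.verts ∩ W ⊆ {w} := fun u huU huW =>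
    ⟨u, huW, G.singletonSubgraph u, Subgraph.singletonSubgraph_connected, by simp, by simp,
      by simpa using huU, by simp⟩
  induction p with
  | nil => exact single _ (hp _ (by simp)) hv
  | @cons u v' _ h p ih =>
    by_cases hu : u ∈ W
    · exact single _ (hp _ (by simp)) hu
    obtain ⟨w, hw, H, hH, h1, h2, h3, h4⟩ := ih hv fun w hw => hp w (by simp [hw])
    obtain ⟨L, hL, hLv, -⟩ := exists_attach hH h1 h.symm (fun _ _ => True) (by simp) trivial trivial
    refine ⟨w, hw, L, hL, by simp [hLv], by simp [hLv, h2], ?_, ?_⟩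
    · rw [hLv]
      exact Set.insert_subset (hp _ (by simp)) h3
    · rw [hLv]
      rintro r ⟨rfl | hr, hrW⟩
      · exact absurd hrW hu
      · exact h4 ⟨hr, hrW⟩

variable {α : Type*} [Fintype α] [DecidableEq α] {a b c : α}

/-- Exits from the subgraphs linking `x` and `y`, ending outside the copy of `y`. -/
lemma exists_exits (hab : a ≠ b) (hca : c ≠ a) (hcb : c ≠ b) {x y : Perm α} (hxy : x ≠ y)
    (hc : x c = y c) :
    ∃ e r : Perm α → Perm α, (∀ t ∈ copyNbrs a b c y, (swapGraph a b).Adj (r t) (e t) ∧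
      (r t = t ∨ r t = y) ∧ r t ≠ x ∧ r t c = y c ∧
      e t c ≠ y c ∧ (e t a = y c ∨ e t b = y c) ∧ e t ≠ y * swap a c ∧ e t ≠ x * swap a c) ∧
      ∀ t ∈ copyNbrs a b c y, ∀ t' ∈ copyNbrs a b c y, e t = e t' → t = t' := by
  let e : Perm α → Perm α := fun t => if t = x then y * swap b c else t * swap a c
  let r : Perm α → Perm α := fun t => if t = x then y else t
  have hec : ∀ t ∈ copyNbrs a b c y, e t c ≠ y c := by
    intro t ht
    rw [mem_copyNbrs hab hca hcb] at ht
    by_cases htx : t = x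
    · simpa [e, htx] using hcb.symm
    · simp only [e, htx, if_false, Perm.mul_apply, swap_apply_right, ← ht.2]
      exact t.injective.ne hca.symm
  have hadj : ∀ t ∈ copyNbrs a b c y, (swapGraph a b).Adj (r t) (e t) := by
    intro t ht
    by_cases htx : t = x
    · simpa [e, r, htx] using adj_mul_swap_right y hcb
    · simpa [e, r, htx] using adj_mul_swap_left t hca
  have hrc : ∀ t ∈ copyNbrs a b c y, r t c = y c := by
    intro t ht
    rw [mem_copyNbrs hab hca hcb] at ht
    by_cases htx : t = x
    · simp [r, htx]
    · simp [r, htx, ht.2]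
  have hrx : ∀ t ∈ copyNbrs a b c y, r t ≠ x := by
    intro t ht
    by_cases htx : t = x
    · simpa [r, htx] using hxy.symm
    · simp [r, htx]
  have hty : ∀ t ∈ copyNbrs a b c y, t ≠ y := by
    intro t ht
    rw [mem_copyNbrs hab hca hcb] at ht
    exact ht.1.ne'
  refine ⟨e, r, fun t ht => ⟨hadj t ht, ?_, hrx t ht, hrc t ht, hec t ht, ?_, ?_, ?_⟩, ?_⟩
  · by_cases htx : t = x
    · simp [r, htx]
    · simp [r, htx]
  · rw [mem_copyNbrs hab hca hcb] at ht
    by_cases htx : t = x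
    · simp [e, htx]
    · simp [e, htx, ht.2]
  · intro h
    have h1 : r t = y := by
      refine Adj.unique (hadj t ht).symm ?_ ((hrc t ht).trans_ne (hec t ht).symm) (hrc t ht) hca hcb
      rw [h]
      exact (adj_mul_swap_left y hca).symm
    by_cases htx : t = x
    · simp only [e, htx, if_true] at h
      have := congrArg (fun π : Perm α => π a) (mul_left_cancel h)
      simp [swap_apply_of_ne_of_ne hab hca.symm] at this
      exact hca this.symm
    · simp only [r, htx, if_false] at h1
      exact hty t ht h1
  · intro h
    refine hrx t ht (Adj.unique (hadj t ht).symm ?_ ((hrc t ht).trans_ne (hec t ht).symm)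
      ((hrc t ht).trans hc.symm) hca hcb)
    rw [h]
    exact (adj_mul_swap_left x hca).symm
  · intro t ht t' ht' h
    have h1 : r t = r t' := by
      refine Adj.unique (hadj t ht).symm ?_ ((hrc t ht).trans_ne (hec t ht).symm)
        ((hrc t ht).trans (hrc t' ht').symm) hca hcb
      rw [h]
      exact (hadj t' ht').symm
    by_cases htx : t = x <;> by_cases htx' : t' = x
    · rw [htx, htx']
    · simp only [r, htx, htx', if_true, if_false] at h1
      exact absurd h1.symm (hty t' ht')
    · simp only [r, htx, htx', if_true, if_false] at h1
      exact absurd h1 (hty t ht)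
    · simpa only [r, htx, htx', if_false] using h1

end TwoOne

section CaseTwoOne

variable {α : Type*} [Fintype α] [DecidableEq α] {a b c : α}

lemma mul_swap_apply_copy (x : Perm α) (hca : c ≠ a) :
    (x * swap a c) c ≠ x c ∧ (x * swap a c) a = x c := by
  simp [hca.symm]

/-- The subgraphs linking `x` and `y` inside their common copy. -/
lemma exists_copy_links (hab : a ≠ b) (hca : c ≠ a) (hcb : c ≠ b) (hn : 4 ≤ Fintype.card α)
    {x y z : Perm α} (hxy : x ≠ y) (hc : x c = y c) (hz : z c ≠ x c) :
    ∃ X : Perm α → (swapGraph a b).Subgraph,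
      (∀ t ∈ copyNbrs a b c y, (X t).Connected ∧ x ∈ (X t).verts ∧ y ∈ (X t).verts ∧
        (X t).verts ⊆ {ρ | ρ c = x c}) ∧
      (∀ t ∈ copyNbrs a b c y, t ∈ (X t).verts) ∧
      (∀ t ∈ copyNbrs a b c y, ∀ t' ∈ copyNbrs a b c y, t ≠ t' →
        (X t).verts ∩ (X t').verts ⊆ {x, y}) ∧
      ∀ t ∈ copyNbrs a b c y, t ≠ x → ∀ p q, (X t).Adj p q →
        ¬ (p ∈ ({x, y, z} : Set (Perm α)) ∧ q ∈ ({x, y, z} : Set (Perm α))) := by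
  obtain ⟨R, hR, hRd⟩ := exists_fan_copyNbrs hab hca hcb hn hxy hc
  obtain ⟨X, hX⟩ := exists_links hab hca hcb hz R hR hRd
  refine ⟨X, fun t ht => ⟨(hX t ht).1, ?_, ?_, ?_⟩, fun t ht => ?_, ?_, fun t ht => (hX t ht).2.2⟩
  · rw [(hX t ht).2.1]
    exact Or.inr (hR t ht).2.1
  · rw [(hX t ht).2.1]
    exact Or.inl rfl
  · rw [(hX t ht).2.1]
    exact Set.insert_subset hc.symm fun p hp => ((hR t ht).2.2.2 hp).1
  · rw [(hX t ht).2.1]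
    exact Or.inr (hR t ht).2.2.1
  · intro t ht t' ht' hne p ⟨hp, hp'⟩
    rw [(hX t ht).2.1] at hp
    rw [(hX t' ht').2.1] at hp'
    rcases hp with rfl | hp
    · simp
    rcases hp' with rfl | hp'
    · simp
    exact Or.inl (hRd t ht t' ht' hne ⟨hp, hp'⟩)

/-- Two vertices in a common copy, the third one without a neighbour in that copy. -/
lemma connectsSet_of_far (hab : a ≠ b) (hca : c ≠ a) (hcb : c ≠ b) (hn : 4 ≤ Fintype.card α)
    {x y z : Perm α} (hxy : x ≠ y) (hc : x c = y c) (hz : z c ≠ x c)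
    (hza : z a ≠ x c) (hzb : z b ≠ x c) :
    ConnectsSet (swapGraph a b) {x, y, z} (2 * Fintype.card α - 4) := by
  obtain ⟨X, hX, htX, hXd, hXa⟩ := exists_copy_links hab hca hcb hn hxy hc hz
  obtain ⟨e, r, he, hei⟩ := exists_exits hab hca hcb hxy hc
  have hcard := card_copyNbrs hab hca hcb y
  set T := copyNbrs a b c y with hTdef
  have hfx := mul_swap_apply_copy x hca (a := a)
  have hfy := mul_swap_apply_copy y hca (a := a)
  set fx := x * swap a c with hfxdef
  set fy := y * swap a c with hfydef
  have hfne : fx ≠ fy := fun h => hxy (mul_right_cancel h)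
  have hT : ∀ t ∈ T.image e ∪ {fx, fy}, t c ≠ x c ∧ (t a = x c ∨ t b = x c) := by
    intro t ht
    simp only [Finset.mem_union, Finset.mem_image, Finset.mem_insert, Finset.mem_singleton] at ht
    rw [hc]
    rcases ht with ⟨t, ht, rfl⟩ | rfl | rfl
    · exact ⟨(he t ht).2.2.2.2.1, (he t ht).2.2.2.2.2.1⟩
    · rw [← hc]
      exact ⟨hfx.1, Or.inl hfx.2⟩
    · exact ⟨hfy.1, Or.inl hfy.2⟩
  have hzT : z ∉ T.image e ∪ {fx, fy} := fun h => (hT z h).2.elim hza hzb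
  have hTc : (T.image e ∪ {fx, fy}).card + 3 ≤ 2 * Fintype.card α := by
    have h1 := Finset.card_union_le (T.image e) {fx, fy}
    have h2 := Finset.card_image_le (s := T) (f := e)
    have h3 := Finset.card_le_two (a := fx) (b := fy)
    omega
  obtain ⟨F, hF, hFd⟩ := exists_fan_outer hab hca hcb hn (x c) z hz _ hzT hT
    (Or.inr ⟨hza, hzb, hTc⟩)
  have heT : ∀ t ∈ T, e t ∈ T.image e ∪ {fx, fy} := fun t ht =>
    Finset.mem_union_left _ (Finset.mem_image_of_mem e ht)
  have hxT : fx ∈ T.image e ∪ {fx, fy} := by simp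
  have hyT : fy ∈ T.image e ∪ {fx, fy} := by simp
  obtain ⟨Y, hY, hYv, -⟩ := exists_glue (hF _ hxT).1 (hF _ hyT).1 (hF _ hxT).2.1 (hF _ hyT).2.1
    (fun _ _ => True) (by simp) (by simp)
  have key := connectsSet_of_two_one_of_adj (G := swapGraph a b) (U := {ρ | ρ c = x c}) (x := x)
    (y := y) (z := z) rfl hc.symm hz T X (fun t => F (e t)) hX hXd hXa
    (fun t ht => ⟨(hF _ (heT t ht)).1, (hF _ (heT t ht)).2.1, Set.disjoint_left.2 fun p hp =>
      (hF _ (heT t ht)).2.2.2 hp⟩)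
    (fun t ht t' ht' hne => hFd _ (heT t ht) _ (heT t' ht') fun h => hne (hei t ht t' ht' h))
    ?_ Y hY ?_ ?_ ?_ ?_ ?_
  · rwa [show 2 * Fintype.card α - 4 = T.card + 1 by omega]
  · intro t ht
    obtain ⟨h1, h2, h3, h4, h5, -⟩ := he t ht
    refine ⟨r t, ?_, e t, (hF _ (heT t ht)).2.2.1, h1, ?_⟩
    · rcases h2 with h2 | h2
      · rw [h2]
        exact htX t ht
      · rw [h2]
        exact (hX t ht).2.2.1
    · rintro ⟨-, h | h | h⟩
      · exact h5 (h ▸ hc)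
      · exact h5 (h ▸ rfl)
      · exact hzT (h ▸ heT t ht)
  · rw [hYv]
    exact Or.inl (hF _ hxT).2.1
  · rw [hYv]
    exact Set.disjoint_left.2 fun p hp => hp.elim (fun hp => (hF _ hxT).2.2.2 hp)
      fun hp => (hF _ hyT).2.2.2 hp
  · exact ⟨fx, by rw [hYv]; exact Or.inl (hF _ hxT).2.2.1, (adj_mul_swap_left x hca).symm⟩
  · exact ⟨fy, by rw [hYv]; exact Or.inr (hF _ hyT).2.2.1, (adj_mul_swap_left y hca).symm⟩
  · rintro t ht p ⟨hp, hp'⟩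
    rw [hYv] at hp
    rcases hp with hp | hp
    · exact hFd _ hxT _ (heT t ht) (he t ht).2.2.2.2.2.2.2.symm ⟨hp, hp'⟩
    · exact hFd _ hyT _ (heT t ht) (he t ht).2.2.2.2.2.2.1.symm ⟨hp, hp'⟩

/-- Two vertices in a common copy, one of them adjacent to the third vertex. -/
lemma connectsSet_of_adj (hab : a ≠ b) (hca : c ≠ a) (hcb : c ≠ b) (hn : 4 ≤ Fintype.card α)
    {x y z : Perm α} (hxy : x ≠ y) (hc : x c = y c) (hz : z c ≠ x c)
    (hzx : (swapGraph a b).Adj z x) :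
    ConnectsSet (swapGraph a b) {x, y, z} (2 * Fintype.card α - 4) := by
  obtain ⟨X, hX, htX, hXd, hXa⟩ := exists_copy_links hab hca hcb hn hxy hc hz
  obtain ⟨e, r, he, hei⟩ := exists_exits hab hca hcb hxy hc
  have hcard := card_copyNbrs hab hca hcb y
  set T := copyNbrs a b c y with hTdef
  have hfy := mul_swap_apply_copy y hca (a := a)
  set fy := y * swap a c with hfydef
  have hT : ∀ t ∈ insert fy (T.image e), t c ≠ x c ∧ (t a = x c ∨ t b = x c) := by
    intro t ht
    simp only [Finset.mem_image, Finset.mem_insert] at ht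
    rw [hc]
    rcases ht with rfl | ⟨t, ht, rfl⟩
    · exact ⟨hfy.1, Or.inl hfy.2⟩
    · exact ⟨(he t ht).2.2.2.2.1, (he t ht).2.2.2.2.2.1⟩
  have hzT : z ∉ insert fy (T.image e) := by
    intro h
    simp only [Finset.mem_image, Finset.mem_insert] at h
    rcases h with rfl | ⟨t, ht, rfl⟩
    · exact hxy (Adj.unique hzx (adj_mul_swap_left y hca).symm hz.symm hc hca hcb)
    · obtain ⟨h1, h2, h3, h4, -⟩ := he t ht
      exact h3 (Adj.unique h1.symm hzx (h4.trans_ne (hc ▸ hz.symm)) (h4.trans hc.symm) hca hcb)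
  have hTc : (insert fy (T.image e)).card + 4 ≤ 2 * Fintype.card α := by
    have h1 := Finset.card_insert_le fy (T.image e)
    have h2 := Finset.card_image_le (s := T) (f := e)
    omega
  obtain ⟨F, hF, hFd⟩ := exists_fan_outer hab hca hcb hn (x c) z hz _ hzT hT (Or.inl hTc)
  have heT : ∀ t ∈ T, e t ∈ insert fy (T.image e) := fun t ht =>
    Finset.mem_insert_of_mem (Finset.mem_image_of_mem e ht)
  have hyT : fy ∈ insert fy (T.image e) := Finset.mem_insert_self _ _
  have key := connectsSet_of_two_one_of_adj (G := swapGraph a b) (U := {ρ | ρ c = x c}) (x := x)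
    (y := y) (z := z) rfl hc.symm hz T X (fun t => F (e t)) hX hXd hXa
    (fun t ht => ⟨(hF _ (heT t ht)).1, (hF _ (heT t ht)).2.1, Set.disjoint_left.2 fun p hp =>
      (hF _ (heT t ht)).2.2.2 hp⟩)
    (fun t ht t' ht' hne => hFd _ (heT t ht) _ (heT t' ht') fun h => hne (hei t ht t' ht' h))
    ?_ (F fy) (hF _ hyT).1 (hF _ hyT).2.1 ?_ ⟨z, (hF _ hyT).2.1, hzx⟩
    ⟨fy, (hF _ hyT).2.2.1, (adj_mul_swap_left y hca).symm⟩ ?_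
  · rwa [show 2 * Fintype.card α - 4 = T.card + 1 by omega]
  · intro t ht
    obtain ⟨h1, h2, h3, h4, h5, -⟩ := he t ht
    refine ⟨r t, ?_, e t, (hF _ (heT t ht)).2.2.1, h1, ?_⟩
    · rcases h2 with h2 | h2
      · rw [h2]
        exact htX t ht
      · rw [h2]
        exact (hX t ht).2.2.1
    · rintro ⟨-, h | h | h⟩
      · exact h5 (h ▸ hc)
      · exact h5 (h ▸ rfl)
      · exact hzT (h ▸ heT t ht)
  · exact Set.disjoint_left.2 fun p hp => (hF _ hyT).2.2.2 hp
  · intro t ht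
    exact hFd _ hyT _ (heT t ht) (he t ht).2.2.2.2.2.2.1.symm

/-- Two vertices in a common copy, the third one adjacent to some other vertex of the copy. -/
lemma connectsSet_of_near (hab : a ≠ b) (hca : c ≠ a) (hcb : c ≠ b) (hn : 4 ≤ Fintype.card α)
    {x y z z' : Perm α} (hxy : x ≠ y) (hc : x c = y c) (hz : z c ≠ x c)
    (hzz : (swapGraph a b).Adj z z') (hz' : z' c = x c) (hzx : z' ≠ x) (hzy : z' ≠ y) :
    ConnectsSet (swapGraph a b) {x, y, z} (2 * Fintype.card α - 4) := by
  obtain ⟨X, hX, htX, hXd, hXa⟩ := exists_copy_links hab hca hcb hn hxy hc hz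
  obtain ⟨e, r, he, hei⟩ := exists_exits hab hca hcb hxy hc
  have hcard := card_copyNbrs hab hca hcb y
  have hmem := fun t => mem_copyNbrs hab hca hcb (y := y) (t := t)
  set T := copyNbrs a b c y with hTdef
  have hfx := mul_swap_apply_copy x hca (a := a)
  have hfy := mul_swap_apply_copy y hca (a := a)
  set fx := x * swap a c with hfxdef
  set fy := y * swap a c with hfydef
  have htU : ∀ t ∈ T, t ≠ x → t ∈ ({ρ | ρ c = x c} \ {x, y} : Set (Perm α)) := by
    intro t ht htx
    refine ⟨((hmem t).1 ht).2.trans hc.symm, ?_⟩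
    rintro (rfl | rfl)
    · exact htx rfl
    · exact ((hmem t).1 ht).1.ne rfl
  obtain ⟨t₁, ht₁⟩ : (T.erase x).Nonempty := by
    rw [← Finset.card_pos]
    have := Finset.pred_card_le_card_erase (s := T) (a := x)
    omega
  rw [Finset.mem_erase] at ht₁
  have hjoin : JoinedIn (swapGraph a b) ({ρ | ρ c = x c} \ {x, y}) z' t₁ := by
    have h := copy_joinedIn hab hca hcb hn (C := {x, y}) (σ := z') (τ := t₁)
      (((htU t₁ ht₁.2 ht₁.1).1 : t₁ c = x c).trans hz'.symm) (by simp [hzx, hzy])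
      (by simpa using (htU t₁ ht₁.2 ht₁.1).2) {x, y} (fun ρ h _ => h)
      (by have := Finset.card_le_two (a := x) (b := y); omega)
    rw [hz'] at h
    simpa using h
  obtain ⟨w, ⟨⟨t₀, ht₀, hw⟩, hwxy⟩, H, hH, hzH, hwH, hHU, hHW⟩ := hjoin.exists_first_hit
    (W := {w | ∃ t ∈ T, w ∈ (X t).verts} \ {x, y})
    ⟨⟨t₁, ht₁.2, htX t₁ ht₁.2⟩, (htU t₁ ht₁.2 ht₁.1).2⟩
  -- the subgraph through `t₀` is enlarged so that it reaches the neighbour of `z`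
  have hHX : ∀ t ∈ T, t ≠ t₀ → ∀ p ∈ H.verts, p ∉ (X t).verts := by
    intro t ht hne p hp hpX
    have hpw : p = w := hHW ⟨hp, ⟨⟨t, ht, hpX⟩, (hHU hp).2⟩⟩
    subst hpw
    exact hwxy (hXd t ht t₀ ht₀ hne ⟨hpX, hw⟩)
  let Q : Perm α → Perm α → Prop := fun p q => t₀ ≠ x →
    ¬ (p ∈ ({x, y, z} : Set (Perm α)) ∧ q ∈ ({x, y, z} : Set (Perm α)))
  obtain ⟨L, hL, hLv, hLa⟩ := exists_glue (hX t₀ ht₀).1 hH hw hwH Q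
    (fun p q h hne => hXa t₀ ht₀ hne p q h) (by
      rintro p q h - ⟨hp | hp | hp, -⟩
      · exact (hHU h.fst_mem).2 (Or.inl hp)
      · exact (hHU h.fst_mem).2 (Or.inr hp)
      · subst hp
        exact hz (hHU h.fst_mem).1)
  have hT : ∀ t ∈ (T.erase t₀).image e ∪ {fx, fy}, t c ≠ x c ∧ (t a = x c ∨ t b = x c) := by
    intro t ht
    simp only [Finset.mem_union, Finset.mem_image, Finset.mem_insert, Finset.mem_singleton,
      Finset.mem_erase] at ht
    rw [hc]
    rcases ht with ⟨t, ⟨-, ht⟩, rfl⟩ | rfl | rfl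
    · exact ⟨(he t ht).2.2.2.2.1, (he t ht).2.2.2.2.2.1⟩
    · rw [← hc]
      exact ⟨hfx.1, Or.inl hfx.2⟩
    · exact ⟨hfy.1, Or.inl hfy.2⟩
  have hzT : z ∉ (T.erase t₀).image e ∪ {fx, fy} := by
    intro h
    simp only [Finset.mem_union, Finset.mem_image, Finset.mem_insert, Finset.mem_singleton,
      Finset.mem_erase] at h
    rcases h with ⟨t, ⟨hne, ht⟩, rfl⟩ | rfl | rfl
    · obtain ⟨h1, h2, h3, h4, -⟩ := he t ht
      have h5 : r t = z' := Adj.unique h1.symm hzz (h4.trans_ne (hc ▸ hz.symm))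
        (h4.trans (hc.symm.trans hz'.symm)) hca hcb
      rcases h2 with h2 | h2
      · exact hHX t ht hne z' hzH (h5 ▸ h2.symm ▸ htX t ht)
      · exact hzy (h5 ▸ h2)
    · exact hzx (Adj.unique hzz (adj_mul_swap_left x hca).symm (hz' ▸ hz.symm) hz' hca hcb)
    · exact hzy (Adj.unique hzz (adj_mul_swap_left y hca).symm (hz' ▸ hz.symm) (hz'.trans hc)
        hca hcb)
  have hTc : ((T.erase t₀).image e ∪ {fx, fy}).card + 4 ≤ 2 * Fintype.card α := by
    have h1 := Finset.card_union_le ((T.erase t₀).image e) {fx, fy}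
    have h2 := Finset.card_image_le (s := T.erase t₀) (f := e)
    have h3 := Finset.card_le_two (a := fx) (b := fy)
    have h4 := Finset.card_erase_of_mem ht₀
    omega
  obtain ⟨F, hF, hFd⟩ := exists_fan_outer hab hca hcb hn (x c) z hz _ hzT hT (Or.inl hTc)
  have heT : ∀ t ∈ T, t ≠ t₀ → e t ∈ (T.erase t₀).image e ∪ {fx, fy} := fun t ht hne =>
    Finset.mem_union_left _ (Finset.mem_image_of_mem e (Finset.mem_erase.2 ⟨hne, ht⟩))
  have hxT : fx ∈ (T.erase t₀).image e ∪ {fx, fy} := by simp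
  have hyT : fy ∈ (T.erase t₀).image e ∪ {fx, fy} := by simp
  obtain ⟨Y, hY, hYv, -⟩ := exists_glue (hF _ hxT).1 (hF _ hyT).1 (hF _ hxT).2.1 (hF _ hyT).2.1
    (fun _ _ => True) (by simp) (by simp)
  let X' : Perm α → (swapGraph a b).Subgraph := fun t => if t = t₀ then L else X t
  let O : Perm α → (swapGraph a b).Subgraph := fun t =>
    if t = t₀ then (swapGraph a b).singletonSubgraph z else F (e t)
  have hX'₀ : X' t₀ = L := if_pos rfl
  have hX'₁ : ∀ t, t ≠ t₀ → X' t = X t := fun t h => if_neg h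
  have hO₀ : O t₀ = (swapGraph a b).singletonSubgraph z := if_pos rfl
  have hO₁ : ∀ t, t ≠ t₀ → O t = F (e t) := fun t h => if_neg h
  have key := connectsSet_of_two_one_of_adj (G := swapGraph a b) (U := {ρ | ρ c = x c}) (x := x)
    (y := y) (z := z) rfl hc.symm hz T X' O ?_ ?_ ?_ ?_ ?_ ?_ Y hY ?_ ?_ ?_ ?_ ?_
  · rwa [show 2 * Fintype.card α - 4 = T.card + 1 by omega]
  · intro t ht
    by_cases hne : t = t₀
    · subst hne
      rw [hX'₀, hLv]
      exact ⟨hL, Or.inl (hX t ht).2.1, Or.inl (hX t ht).2.2.1,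
        Set.union_subset (hX t ht).2.2.2 fun p hp => (hHU hp).1⟩
    · rw [hX'₁ t hne]
      exact hX t ht
  · intro t ht t' ht' hne
    by_cases h : t = t₀
    · subst h
      rw [hX'₀, hX'₁ t' hne.symm, hLv]
      rintro p ⟨hp | hp, hp'⟩
      · exact hXd t ht t' ht' hne ⟨hp, hp'⟩
      · exact absurd hp' (hHX t' ht' hne.symm p hp)
    by_cases h' : t' = t₀
    · subst h'
      rw [hX'₀, hX'₁ t hne, hLv]
      rintro p ⟨hp', hp | hp⟩
      · exact hXd t ht t' ht' hne ⟨hp', hp⟩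
      · exact absurd hp' (hHX t ht hne p hp)
    · rw [hX'₁ t h, hX'₁ t' h']
      exact hXd t ht t' ht' hne
  · intro t ht htx p q
    by_cases h : t = t₀
    · subst h
      rw [hX'₀]
      exact fun hpq => hLa p q hpq htx
    · rw [hX'₁ t h]
      exact hXa t ht htx p q
  · intro t ht
    by_cases h : t = t₀
    · subst h
      rw [hO₀]
      exact ⟨Subgraph.singletonSubgraph_connected, by simp, by simpa using hz⟩
    · rw [hO₁ t h]
      have := hF _ (heT t ht h)
      exact ⟨this.1, this.2.1, Set.disjoint_left.2 fun p hp => this.2.2.2 hp⟩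
  · intro t ht t' ht' hne
    by_cases h : t = t₀
    · subst h
      rw [hO₀]
      exact Set.inter_subset_left
    by_cases h' : t' = t₀
    · subst h'
      rw [hO₀]
      exact Set.inter_subset_right
    · rw [hO₁ t h, hO₁ t' h']
      exact hFd _ (heT t ht h) _ (heT t' ht' h') fun h => hne (hei t ht t' ht' h)
  · intro t ht
    by_cases h : t = t₀
    · subst h
      rw [hO₀, hX'₀, hLv]
      refine ⟨z', Or.inr hzH, z, by simp, hzz.symm, ?_⟩
      rintro ⟨h | h | h, -⟩
      · exact hzx h
      · exact hzy h
      · exact hz (h ▸ hz')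
    · rw [hO₁ t h, hX'₁ t h]
      obtain ⟨h1, h2, h3, h4, h5, -⟩ := he t ht
      refine ⟨r t, ?_, e t, (hF _ (heT t ht h)).2.2.1, h1, ?_⟩
      · rcases h2 with h2 | h2
        · rw [h2]
          exact htX t ht
        · rw [h2]
          exact (hX t ht).2.2.1
      · rintro ⟨-, h' | h' | h'⟩
        · exact h5 (h' ▸ hc)
        · exact h5 (h' ▸ rfl)
        · exact hzT (h' ▸ heT t ht h)
  · rw [hYv]
    exact Or.inl (hF _ hxT).2.1
  · rw [hYv]
    exact Set.disjoint_left.2 fun p hp => hp.elim (fun hp => (hF _ hxT).2.2.2 hp)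
      fun hp => (hF _ hyT).2.2.2 hp
  · exact ⟨fx, by rw [hYv]; exact Or.inl (hF _ hxT).2.2.1, (adj_mul_swap_left x hca).symm⟩
  · exact ⟨fy, by rw [hYv]; exact Or.inr (hF _ hyT).2.2.1, (adj_mul_swap_left y hca).symm⟩
  · intro t ht p ⟨hp, hp'⟩
    by_cases h : t = t₀
    · subst h
      rw [hO₀] at hp'
      exact hp'
    rw [hO₁ t h] at hp'
    rw [hYv] at hp
    rcases hp with hp | hp
    · exact hFd _ hxT _ (heT t ht h) (he t ht).2.2.2.2.2.2.2.symm ⟨hp, hp'⟩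
    · exact hFd _ hyT _ (heT t ht h) (he t ht).2.2.2.2.2.2.1.symm ⟨hp, hp'⟩

/-- Two vertices in a common copy and the third one in another copy. -/
lemma connectsSet_of_two_copies (hab : a ≠ b) (hca : c ≠ a) (hcb : c ≠ b)
    (hn : 4 ≤ Fintype.card α) {x y z : Perm α} (hxy : x ≠ y) (hc : x c = y c) (hz : z c ≠ x c) :
    ConnectsSet (swapGraph a b) {x, y, z} (2 * Fintype.card α - 4) := by
  by_cases hzab : z a = x c ∨ z b = x c
  · have hadj := adj_swap_mul z hz.symm hzab
    have hc' : (swap (z c) (x c) * z) c = x c := by simp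
    by_cases hzx : swap (z c) (x c) * z = x
    · exact connectsSet_of_adj hab hca hcb hn hxy hc hz (hzx ▸ hadj)
    by_cases hzy : swap (z c) (x c) * z = y
    · rw [Set.insert_comm]
      exact connectsSet_of_adj hab hca hcb hn hxy.symm hc.symm (hc ▸ hz) (hzy ▸ hadj)
    exact connectsSet_of_near hab hca hcb hn hxy hc hz hadj hc' hzx hzy
  · rw [not_or] at hzab
    exact connectsSet_of_far hab hca hcb hn hxy hc hz hzab.1 hzab.2

end CaseTwoOne

section CaseThree

variable {V : Type*} {G : SimpleGraph V}

/-- Three connected subgraphs joined to a central one by an edge each. -/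
lemma exists_join_three {M X Y Z : G.Subgraph} (hM : M.Connected) (hX : X.Connected)
    (hY : Y.Connected) (hZ : Z.Connected) {S : Set V} {x y z : V} (hMS : ∀ p ∈ M.verts, p ∉ S)
    (hXS : ∀ p ∈ X.verts, p ∈ S → p = x) (hYS : ∀ p ∈ Y.verts, p ∈ S → p = y)
    (hZS : ∀ p ∈ Z.verts, p ∈ S → p = z) (hMX : ∃ p ∈ X.verts, ∃ o ∈ M.verts, G.Adj p o)
    (hMY : ∃ p ∈ Y.verts, ∃ o ∈ M.verts, G.Adj p o)
    (hMZ : ∃ p ∈ Z.verts, ∃ o ∈ M.verts, G.Adj p o) :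
    ∃ L : G.Subgraph, L.Connected ∧ L.verts = M.verts ∪ X.verts ∪ Y.verts ∪ Z.verts ∧
      ∀ p q, L.Adj p q → ¬ (p ∈ S ∧ q ∈ S) := by
  obtain ⟨p₁, hp₁, o₁, ho₁, h₁⟩ := hMX
  obtain ⟨p₂, hp₂, o₂, ho₂, h₂⟩ := hMY
  obtain ⟨p₃, hp₃, o₃, ho₃, h₃⟩ := hMZ
  have key : ∀ {K : G.Subgraph} {w : V}, (∀ p ∈ K.verts, p ∈ S → p = w) → ∀ p q, K.Adj p q →
      ¬ (p ∈ S ∧ q ∈ S) := by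
    rintro K w hK p q h ⟨hp, hq⟩
    exact h.ne ((hK p h.fst_mem hp).trans (hK q h.snd_mem hq).symm)
  obtain ⟨L₁, hL₁, hv₁, ha₁⟩ := exists_join hM hX ho₁ hp₁ h₁.symm
    (fun p q => ¬ (p ∈ S ∧ q ∈ S)) (fun p q h hpq => hMS p h.fst_mem hpq.1) (key hXS)
    (fun h => hMS _ ho₁ h.1) (fun h => hMS _ ho₁ h.2)
  obtain ⟨L₂, hL₂, hv₂, ha₂⟩ := exists_join hL₁ hY (u := o₂) (by rw [hv₁]; exact Or.inl ho₂) hp₂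
    h₂.symm _ ha₁ (key hYS) (fun h => hMS _ ho₂ h.1) (fun h => hMS _ ho₂ h.2)
  obtain ⟨L₃, hL₃, hv₃, ha₃⟩ := exists_join hL₂ hZ (u := o₃)
    (by rw [hv₂, hv₁]; exact Or.inl (Or.inl ho₃)) hp₃ h₃.symm _ ha₂ (key hZS)
    (fun h => hMS _ ho₃ h.1) (fun h => hMS _ ho₃ h.2)
  exact ⟨L₃, hL₃, by rw [hv₃, hv₂, hv₁], ha₃⟩

variable {α : Type*} [Fintype α] [DecidableEq α] {a b c : α}

/-- The part inside one copy of a family of trees connecting vertices of three different copies. -/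
lemma exists_copy_pieces (hab : a ≠ b) (hca : c ≠ a) (hcb : c ≠ b) (hn : 4 ≤ Fintype.card α)
    (O : Set α) {x t u p : Perm α} (hxO : x c ∉ O) (htO : t c ∈ O) (huO : u c = t c)
    (W : Finset (Perm α)) (hW : ∀ w ∈ W, w c = x c ∧ w a ∉ O ∧ w b ∉ O)
    (hWc : W.card + 6 ≤ 2 * Fintype.card α) (hxW : x a ∉ O → x b ∉ O → x ∈ W)
    (htx : ¬ (swapGraph a b).Adj t x) (hux : ¬ (swapGraph a b).Adj u x) (hp : p c = x c)
    (hpa : (swapGraph a b).Adj p t ∨ (swapGraph a b).Adj p u) :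
    ∃ (R : Perm α → (swapGraph a b).Subgraph) (A P : (swapGraph a b).Subgraph) (o : Perm α),
      (∀ w ∈ W, (R w).Connected ∧ x ∈ (R w).verts ∧ w ∈ (R w).verts ∧
        (R w).verts ⊆ {ρ | ρ c = x c}) ∧
      (∀ w ∈ W, ∀ w' ∈ W, w ≠ w' → (R w).verts ∩ (R w').verts ⊆ {x}) ∧
      (A.Connected ∧ x ∈ A.verts ∧ p ∈ A.verts ∧ A.verts ⊆ {ρ | ρ c = x c}) ∧
      (∀ w ∈ W, (R w).verts ∩ A.verts ⊆ {x}) ∧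
      (P.Connected ∧ x ∈ P.verts ∧ (∃ q ∈ P.verts, (swapGraph a b).Adj q o) ∧
        P.verts ⊆ {ρ | ρ c = x c}) ∧
      (∀ w ∈ W, (R w).verts ∩ P.verts ⊆ {x}) ∧ A.verts ∩ P.verts ⊆ {x} ∧
      o c ∈ O ∧ o ≠ t ∧ o ≠ u := by
  have htx' : t c ≠ x c := fun h => hxO (h ▸ htO)
  have hspec : ∀ {q v : Perm α}, (swapGraph a b).Adj q v → q c = x c → v c ∈ O → q ∉ W := by
    intro q v hqv hq hv hqW
    have hne : v c ≠ q c := fun h => hxO (by rwa [h, hq] at hv)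
    obtain ⟨-, h | h⟩ := Adj.eq_swap_mul hqv hne hca hcb
    · exact (hW q hqW).2.1 (h ▸ hv)
    · exact (hW q hqW).2.2 (h ▸ hv)
  have hpW : p ∉ W := by
    rcases hpa with h | h
    · exact hspec h hp htO
    · exact hspec h hp (huO ▸ htO)
  by_cases hx : x ∈ W
  · have hcards : (({t, u} : Finset (Perm α)).filter fun v => v c = x c).card +
        (({t, u} : Finset (Perm α)).filter fun v => v c = t c).card <
        2 * ((Finset.univ : Finset α).card - 2) := by
      have h1 : ({t, u} : Finset (Perm α)).filter (fun v => v c = x c) = ∅ := by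
        rw [Finset.filter_eq_empty_iff]
        intro v hv
        rcases Finset.mem_insert.1 hv with rfl | hv
        · exact htx'
        · rw [Finset.mem_singleton.1 hv, huO]
          exact htx'
      have h2 := Finset.card_filter_le ({t, u} : Finset (Perm α)) fun v => v c = t c
      have h3 := Finset.card_le_two (a := t) (b := u)
      rw [h1, Finset.card_empty, Finset.card_univ]
      omega
    obtain ⟨e, v, hev, -, -, hec, hvc, -, hv⟩ := exists_edge (σ := 1) (l := x c) (l' := t c) hab
      hca hcb (Finset.mem_univ c) (Finset.mem_univ a) (Finset.mem_univ b) (by simp) (by simp)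
      htx'.symm {t, u} hcards
    simp only [Finset.mem_insert, Finset.mem_singleton, not_or] at hv
    have heW : e ∉ W := hspec hev hec (hvc ▸ htO)
    have hep : e ≠ p := by
      rintro rfl
      rcases hpa with h | h
      · exact hv.1 (Adj.unique hev h (by rwa [hvc, hec]) hvc hca hcb)
      · exact hv.2 (Adj.unique hev h (by rwa [hvc, hec]) (hvc.trans huO.symm) hca hcb)
    have hcard : ((W ∪ {p, e}).erase x).card + (∅ : Finset (Perm α)).card + 5 ≤
        2 * Fintype.card α := by
      have h1 := Finset.card_union_le W {p, e}
      have h2 := Finset.card_le_two (a := p) (b := e)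
      have h3 := Finset.card_erase_of_mem (Finset.mem_union_left {p, e} hx)
      rw [Finset.card_empty]
      omega
    obtain ⟨R, hR, hRd⟩ := exists_fan_copy hab hca hcb hn x ∅ (W ∪ {p, e}) (by simp) (by
      intro q hq
      simp only [Finset.mem_union, Finset.mem_insert, Finset.mem_singleton] at hq
      refine ⟨?_, by simp⟩
      rcases hq with hq | rfl | rfl
      · exact (hW q hq).1
      · exact hp
      · exact hec) hcard
    simp only [Finset.coe_empty, Set.sdiff_empty] at hR
    have hW' : ∀ w ∈ W, w ∈ W ∪ {p, e} := fun w hw => Finset.mem_union_left _ hw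
    have hp' : p ∈ W ∪ {p, e} := by simp
    have he' : e ∈ W ∪ {p, e} := by simp
    exact ⟨R, R p, R e, v, fun w hw => hR w (hW' w hw),
      fun w hw w' hw' h => hRd w (hW' w hw) w' (hW' w' hw') h, hR p hp',
      fun w hw => hRd w (hW' w hw) p hp' fun h => hpW (h ▸ hw),
      ⟨(hR e he').1, (hR e he').2.1, ⟨e, (hR e he').2.2.1, hev⟩, (hR e he').2.2.2⟩,
      fun w hw => hRd w (hW' w hw) e he' fun h => heW (h ▸ hw),
      hRd p hp' e he' hep.symm, hvc ▸ htO, hv⟩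
  · have hcard : ((insert p W).erase x).card + (∅ : Finset (Perm α)).card + 5 ≤
        2 * Fintype.card α := by
      have h1 := Finset.card_insert_le p W
      have h2 := Finset.card_erase_le (s := insert p W) (a := x)
      rw [Finset.card_empty]
      omega
    obtain ⟨R, hR, hRd⟩ := exists_fan_copy hab hca hcb hn x ∅ (insert p W) (by simp) (by
      intro q hq
      refine ⟨?_, by simp⟩
      rcases Finset.mem_insert.1 hq with rfl | hq
      · exact hp
      · exact (hW q hq).1) hcard
    simp only [Finset.coe_empty, Set.sdiff_empty] at hR
    have hW' : ∀ w ∈ W, w ∈ insert p W := fun w hw => Finset.mem_insert_of_mem hw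
    have hp' : p ∈ insert p W := Finset.mem_insert_self _ _
    obtain ⟨o, hxo, hoO⟩ : ∃ o, (swapGraph a b).Adj x o ∧ o c ∈ O := by
      have : x a ∈ O ∨ x b ∈ O := by
        by_contra! h
        exact hx (hxW h.1 h.2)
      rcases this with h | h
      · exact ⟨x * swap a c, adj_mul_swap_left x hca, by simpa using h⟩
      · exact ⟨x * swap b c, adj_mul_swap_right x hcb, by simpa using h⟩
    exact ⟨R, R p, (swapGraph a b).singletonSubgraph x, o, fun w hw => hR w (hW' w hw),
      fun w hw w' hw' h => hRd w (hW' w hw) w' (hW' w' hw') h, hR p hp',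
      fun w hw => hRd w (hW' w hw) p hp' fun h => hpW (h ▸ hw),
      ⟨Subgraph.singletonSubgraph_connected, by simp, ⟨x, by simp, hxo⟩, by simp⟩,
      fun w hw => Set.inter_subset_right, Set.inter_subset_right, hoO,
      fun h => htx (h ▸ hxo.symm), fun h => hux (h ▸ hxo.symm)⟩

/-- The vertices outside given copies stay connected when two of them are removed. -/
lemma joinedIn_outer (hab : a ≠ b) (hca : c ≠ a) (hcb : c ≠ b) (hn : 4 ≤ Fintype.card α)
    (O : Set α) {t u σ τ : Perm α} (hσ : σ c ∈ O) (hτ : τ c ∈ O)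
    (hσt : σ ≠ t) (hσu : σ ≠ u) (hτt : τ ≠ t) (hτu : τ ≠ u) :
    JoinedIn (swapGraph a b) {ρ | ρ c ∈ O ∧ ρ ≠ t ∧ ρ ≠ u} σ τ := by
  have hcopy : ∀ {σ τ : Perm α}, σ c ∈ O → τ c = σ c → σ ≠ t → σ ≠ u → τ ≠ t → τ ≠ u →
      JoinedIn (swapGraph a b) {ρ | ρ c ∈ O ∧ ρ ≠ t ∧ ρ ≠ u} σ τ := by
    intro σ τ hσ h h1 h2 h3 h4
    refine (copy_joinedIn hab hca hcb hn (C := {t, u}) h (by simp [h1, h2]) (by simp [h3, h4])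
      {t, u} (fun ρ h _ => h) (by have := Finset.card_le_two (a := t) (b := u); omega)).mono ?_
    rintro ρ ⟨hρ, hρ'⟩
    simp only [Finset.coe_insert, Finset.coe_singleton, Set.mem_insert_iff,
      Set.mem_singleton_iff, not_or] at hρ'
    rw [Set.mem_ofPred_eq] at hρ
    exact ⟨hρ ▸ hσ, hρ'⟩
  by_cases h : τ c = σ c
  · exact hcopy hσ h hσt hσu hτt hτu
  have hcards : (({t, u} : Finset (Perm α)).filter fun v => v c = σ c).card +
      (({t, u} : Finset (Perm α)).filter fun v => v c = τ c).card <
      2 * ((Finset.univ : Finset α).card - 2) := by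
    have h1 : Disjoint (({t, u} : Finset (Perm α)).filter fun v => v c = σ c)
        (({t, u} : Finset (Perm α)).filter fun v => v c = τ c) :=
      Finset.disjoint_filter.2 fun v _ h1 h2 => h (h2.symm.trans h1)
    have h2 := Finset.card_le_card (Finset.union_subset
      (Finset.filter_subset (fun v => v c = σ c) ({t, u} : Finset (Perm α)))
      (Finset.filter_subset (fun v => v c = τ c) ({t, u} : Finset (Perm α))))
    rw [Finset.card_union_of_disjoint h1] at h2
    have h3 := Finset.card_le_two (a := t) (b := u)
    rw [Finset.card_univ]
    omega
  obtain ⟨e, v, hev, -, -, hec, hvc, he, hv⟩ := exists_edge (σ := 1) (l := σ c) (l' := τ c) hab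
    hca hcb (Finset.mem_univ c) (Finset.mem_univ a) (Finset.mem_univ b) (by simp) (by simp)
    (Ne.symm h) {t, u} hcards
  simp only [Finset.mem_insert, Finset.mem_singleton, not_or] at he hv
  exact ((hcopy hσ hec hσt hσu he.1 he.2).trans (JoinedIn.of_adj hev ⟨hec ▸ hσ, he⟩
    ⟨hvc ▸ hτ, hv⟩)).trans (hcopy (hvc ▸ hτ) hvc.symm hv.1 hv.2 hτt hτu)

end CaseThree

section Pieces

variable {V : Type*} {G : SimpleGraph V}

/-- Trees assembled from pieces in three classes of a vertex colouring and outer pieces. -/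
lemma connectsSet_of_pieces {ι β : Type*} [Fintype ι] (H : ι → G.Subgraph)
    (hconn : ∀ i, (H i).Connected) {x y z : V} (f : V → β) (hxy : f x ≠ f y) (hxz : f x ≠ f z)
    (hyz : f y ≠ f z) (M X Y Z : ι → Set V)
    (hv : ∀ i, (H i).verts = M i ∪ X i ∪ Y i ∪ Z i)
    (hM : ∀ i, ∀ p ∈ M i, f p ≠ f x ∧ f p ≠ f y ∧ f p ≠ f z)
    (hX : ∀ i, x ∈ X i ∧ X i ⊆ {p | f p = f x}) (hY : ∀ i, y ∈ Y i ∧ Y i ⊆ {p | f p = f y})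
    (hZ : ∀ i, z ∈ Z i ∧ Z i ⊆ {p | f p = f z})
    (hMd : ∀ i j, i ≠ j → M i ∩ M j ⊆ ∅) (hXd : ∀ i j, i ≠ j → X i ∩ X j ⊆ {x})
    (hYd : ∀ i j, i ≠ j → Y i ∩ Y j ⊆ {y}) (hZd : ∀ i j, i ≠ j → Z i ∩ Z j ⊆ {z})
    (he : ∀ i j, i ≠ j → ∀ u ∈ ({x, y, z} : Set V), ∀ v ∈ ({x, y, z} : Set V), (H i).Adj u v →
      ¬ (H j).Adj u v) : ConnectsSet G {x, y, z} (Fintype.card ι) := by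
  refine connectsSet_of_subgraphs H hconn ?_ ?_ he
  · rintro i p (rfl | rfl | rfl) <;> rw [hv i]
    · exact Or.inl (Or.inl (Or.inr (hX i).1))
    · exact Or.inl (Or.inr (hY i).1)
    · exact Or.inr (hZ i).1
  · rintro i j hij p ⟨hp, hp'⟩
    rw [hv i] at hp
    rw [hv j] at hp'
    have hX' : ∀ i, p ∈ X i → f p = f x := fun i h => (hX i).2 h
    have hY' : ∀ i, p ∈ Y i → f p = f y := fun i h => (hY i).2 h
    have hZ' : ∀ i, p ∈ Z i → f p = f z := fun i h => (hZ i).2 h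
    have hM' := fun i => hM i p
    rcases hp with ((hp | hp) | hp) | hp <;> rcases hp' with ((hp' | hp') | hp') | hp' <;>
      first
      | exact absurd (hMd i j hij ⟨hp, hp'⟩) (Set.notMem_empty p)
      | exact Or.inl (hXd i j hij ⟨hp, hp'⟩)
      | exact Or.inr (Or.inl (hYd i j hij ⟨hp, hp'⟩))
      | exact Or.inr (Or.inr (hZd i j hij ⟨hp, hp'⟩))
      | grind

/-- The family indexed by `Option (Option ι)` with two given values and a given family. -/
def optionFamily {ι β : Type*} (a b : β) (f : ι → β) : Option (Option ι) → β
  | none => a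
  | some none => b
  | some (some i) => f i

lemma optionFamily_pairwise {ι β : Type*} {a b : Set β} {f : ι → Set β} {s : Set β}
    (hf : ∀ i j, i ≠ j → f i ∩ f j ⊆ s) (hfa : ∀ i, f i ∩ a ⊆ s) (hfb : ∀ i, f i ∩ b ⊆ s)
    (hba : b ∩ a ⊆ s) : ∀ i j, i ≠ j → optionFamily a b f i ∩ optionFamily a b f j ⊆ s := by
  rintro (_ | _ | i) (_ | _ | j) h <;> simp only [optionFamily]
  · exact absurd rfl h
  · rwa [Set.inter_comm]
  · rw [Set.inter_comm]
    exact hfa j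
  · exact hba
  · exact absurd rfl h
  · rw [Set.inter_comm]
    exact hfb j
  · exact hfa i
  · exact hfb i
  · exact hf i j fun h' => h (h' ▸ rfl)

lemma optionFamily_forall {ι β : Type*} {a b : β} {f : ι → β} {P : β → Prop} (ha : P a)
    (hb : P b) (hf : ∀ i, P (f i)) : ∀ i, P (optionFamily a b f i) := by
  rintro (_ | _ | i)
  · exact ha
  · exact hb
  · exact hf i

end Pieces

section Hubs

variable {α : Type*} [Fintype α] [DecidableEq α] {a b c : α}

lemma exists_perm_step (τ : Perm α) (p v : α) :
    ∃ τ' : Perm α, τ' p = v ∧ ∀ q, q ≠ p → τ q ≠ v → τ' q = τ q :=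
  ⟨swap (τ p) v * τ, by simp, fun q hq hv => by
    rw [Perm.mul_apply, swap_apply_of_ne_of_ne (τ.injective.ne hq) hv]⟩

/-- A permutation with four prescribed values. -/
lemma exists_perm_apply {p q r s p' q' r' s' : α} (hp : p ≠ q ∧ p ≠ r ∧ p ≠ s) (hq : q ≠ r ∧ q ≠ s)
    (hr : r ≠ s) (hp' : p' ≠ q' ∧ p' ≠ r' ∧ p' ≠ s') (hq' : q' ≠ r' ∧ q' ≠ s') (hr' : r' ≠ s') :
    ∃ τ : Perm α, τ p = p' ∧ τ q = q' ∧ τ r = r' ∧ τ s = s' := by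
  obtain ⟨τ₁, h₁, -⟩ := exists_perm_step 1 p p'
  obtain ⟨τ₂, h₂, k₂⟩ := exists_perm_step τ₁ q q'
  obtain ⟨τ₃, h₃, k₃⟩ := exists_perm_step τ₂ r r'
  obtain ⟨τ₄, h₄, k₄⟩ := exists_perm_step τ₃ s s'
  refine ⟨τ₄, ?_, ?_, ?_, h₄⟩ <;> grind

lemma exists_ne_three (hn : 4 ≤ Fintype.card α) (p q r : α) : ∃ s, s ≠ p ∧ s ≠ q ∧ s ≠ r := by
  by_contra! h
  have h1 : (Finset.univ : Finset α) ⊆ {p, q, r} := by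
    intro s _
    simp only [Finset.mem_insert, Finset.mem_singleton]
    have := h s
    tauto
  have h2 := Finset.card_le_card h1
  have h3 := Finset.card_le_three (a := p) (b := q) (c := r)
  rw [Finset.card_univ] at h2
  omega

/-- Enough vertices of a copy that are adjacent to two other given copies. -/
lemma exists_hubs (hab : a ≠ b) (hca : c ≠ a) (hcb : c ≠ b) (hn : 4 ≤ Fintype.card α) {i j k : α}
    (hij : i ≠ j) (hik : i ≠ k) (hjk : j ≠ k) (B : Finset (Perm α)) (hBc : B.card ≤ 3)
    (hB : ∀ w ∈ B, w c = i ∧ (w a = j ∧ w b = k ∨ w a = k ∧ w b = j)) :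
    ∃ W, B ⊆ W ∧ W.card = 2 * Fintype.card α - 6 ∧
      ∀ w ∈ W, w c = i ∧ (w a = j ∧ w b = k ∨ w a = k ∧ w b = j) := by
  let N : Finset (Perm α) := Finset.univ.filter fun w =>
    w c = i ∧ (w a = j ∧ w b = k ∨ w a = k ∧ w b = j)
  have hmem : ∀ w, w ∈ N ↔ w c = i ∧ (w a = j ∧ w b = k ∨ w a = k ∧ w b = j) := by simp [N]
  have hBN : B ⊆ N := fun w hw => (hmem w).2 (hB w hw)
  obtain ⟨s₀, hsa, hsb, hsc⟩ := exists_ne_three hn a b c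
  obtain ⟨m, hmi, hmj, hmk⟩ := exists_ne_three hn i j k
  obtain ⟨ρ, h1, h2, h3, -⟩ := exists_perm_apply (p := c) (q := a) (r := b) (s := s₀)
    ⟨hca, hcb, hsc.symm⟩ ⟨hab, hsa.symm⟩ hsb.symm ⟨hij, hik, hmi.symm⟩ ⟨hjk, hmj.symm⟩ hmk.symm
  let P : Finset α := Finset.univ \ {a, b, c}
  have hP : P.card = Fintype.card α - 3 := by
    rw [Finset.card_sdiff_of_subset (Finset.subset_univ _), Finset.card_univ,
      Finset.card_eq_three.2 ⟨a, b, c, hab, hca.symm, hcb.symm, rfl⟩]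
  have hmemP : ∀ s, s ∈ P ↔ s ≠ a ∧ s ≠ b ∧ s ≠ c := by simp [P]
  let N₁ : Finset (Perm α) := P.image fun s => ρ * swap s₀ s
  let N₂ : Finset (Perm α) := P.image fun s => ρ * swap a b * swap s₀ s
  have hN₁ : ∀ w ∈ N₁, w c = i ∧ w a = j ∧ w b = k := by
    intro w hw
    obtain ⟨s, hs, rfl⟩ := Finset.mem_image.1 hw
    rw [hmemP] at hs
    simp [swap_apply_of_ne_of_ne, *, hsa.symm, hsb.symm, hsc.symm, hs.1.symm, hs.2.1.symm,
      hs.2.2.symm]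
  have hN₂ : ∀ w ∈ N₂, w c = i ∧ w a = k ∧ w b = j := by
    intro w hw
    obtain ⟨s, hs, rfl⟩ := Finset.mem_image.1 hw
    rw [hmemP] at hs
    simp [swap_apply_of_ne_of_ne, *, hsa.symm, hsb.symm, hsc.symm, hs.1.symm, hs.2.1.symm,
      hs.2.2.symm]
  have hle : 2 * Fintype.card α - 6 ≤ N.card := by
    have h4 : N₁ ∪ N₂ ⊆ N := by
      intro w hw
      rw [hmem]
      rcases Finset.mem_union.1 hw with hw | hw
      · exact ⟨(hN₁ w hw).1, Or.inl (hN₁ w hw).2⟩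
      · exact ⟨(hN₂ w hw).1, Or.inr (hN₂ w hw).2⟩
    have h5 : Disjoint N₁ N₂ := Finset.disjoint_left.2 fun w hw hw' =>
      hjk ((hN₁ w hw).2.1.symm.trans (hN₂ w hw').2.1)
    have h6 := Finset.card_le_card h4
    rw [Finset.card_union_of_disjoint h5,
      Finset.card_image_of_injective _ (mul_swap_injective ρ s₀),
      Finset.card_image_of_injective _ (mul_swap_injective _ s₀), hP] at h6
    omega
  by_cases hn4 : Fintype.card α = 4
  · refine ⟨N, hBN, le_antisymm ?_ hle, fun w hw => (hmem w).1 hw⟩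
    have h7 : N.card ≤ ({j, k} : Finset α).card := by
      refine Finset.card_le_card_of_injOn (fun w => w a) ?_ ?_
      · intro w hw
        have hw : w ∈ N := hw
        rw [hmem] at hw
        have : w a = j ∨ w a = k := hw.2.imp And.left And.left
        simpa using this
      · intro w hw w' hw' h
        have hw : w ∈ N := hw
        have hw' : w' ∈ N := hw'
        have h : w a = w' a := h
        rw [hmem] at hw hw'
        have hb : w b = w' b := by grind
        have hc : w c = w' c := hw.1.trans hw'.1.symm
        have hall : ∀ p, p = a ∨ p = b ∨ p = c ∨ p = s₀ := by
          by_contra! hp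
          obtain ⟨p, hp1, hp2, hp3, hp4⟩ := hp
          have := Finset.card_le_univ ({a, b, c, s₀, p} : Finset α)
          rw [hn4, Finset.card_insert_of_notMem (by simp; grind),
            Finset.card_insert_of_notMem (by simp; grind),
            Finset.card_insert_of_notMem (by simp; grind),
            Finset.card_insert_of_notMem (by simp; grind), Finset.card_singleton] at this
          omega
        have hs : w s₀ = w' s₀ := by
          obtain ⟨q, hq⟩ := w'.surjective (w s₀)
          have hi := w.injective
          rcases hall q with rfl | rfl | rfl | rfl
          · exact absurd (hi (h.trans hq)) hsa.symm
          · exact absurd (hi (hb.trans hq)) hsb.symm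
          · exact absurd (hi (hc.trans hq)) hsc.symm
          · exact hq.symm
        ext p
        rcases hall p with rfl | rfl | rfl | rfl <;> assumption
    have h8 := Finset.card_le_two (a := j) (b := k)
    omega
  · obtain ⟨W, hBW, hWN, hW⟩ := Finset.exists_subsuperset_card_eq hBN
      (n := 2 * Fintype.card α - 6) (by omega) hle
    exact ⟨W, hBW, hW, fun w hw => (hmem w).1 (hWN hw)⟩

end Hubs

section HubTrees

variable {α : Type*} [Fintype α] [DecidableEq α] {a b c : α}

/-- Trees through a common neighbour of three copies. -/
lemma exists_hub_trees
    {x y z : Perm α} (hxy : x c ≠ y c) (hxz : x c ≠ z c) (hyz : y c ≠ z c) (W : Finset (Perm α))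
    (hW : ∀ w ∈ W, w c = x c ∧ (w a = y c ∧ w b = z c ∨ w a = z c ∧ w b = y c))
    (X Y Z : Perm α → (swapGraph a b).Subgraph)
    (hX : ∀ w ∈ W, (X w).Connected ∧ x ∈ (X w).verts ∧ w ∈ (X w).verts ∧
      (X w).verts ⊆ {ρ | ρ c = x c})
    (hY : ∀ w ∈ W, (Y w).Connected ∧ y ∈ (Y w).verts ∧ swap (x c) (y c) * w ∈ (Y w).verts ∧
      (Y w).verts ⊆ {ρ | ρ c = y c})
    (hZ : ∀ w ∈ W, (Z w).Connected ∧ z ∈ (Z w).verts ∧ swap (x c) (z c) * w ∈ (Z w).verts ∧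
      (Z w).verts ⊆ {ρ | ρ c = z c}) :
    ∃ H : Perm α → (swapGraph a b).Subgraph, ∀ w ∈ W, (H w).Connected ∧
      (H w).verts = (X w).verts ∪ (Y w).verts ∪ (Z w).verts ∧ (w ≠ x → ∀ p q, (H w).Adj p q →
        ¬ (p ∈ ({x, y, z} : Set (Perm α)) ∧ q ∈ ({x, y, z} : Set (Perm α)))) := by
  have : ∀ w, ∃ L : (swapGraph a b).Subgraph, w ∈ W → L.Connected ∧
      L.verts = (X w).verts ∪ (Y w).verts ∪ (Z w).verts ∧ ∀ p q, L.Adj p q → (w ≠ x →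
        ¬ (p ∈ ({x, y, z} : Set (Perm α)) ∧ q ∈ ({x, y, z} : Set (Perm α)))) := by
    intro w
    by_cases hw : w ∈ W
    swap
    · exact ⟨⊥, fun h => absurd h hw⟩
    obtain ⟨hc, hw'⟩ := hW w hw
    have h1 : (swapGraph a b).Adj w (swap (x c) (y c) * w) := by
      rw [← hc]
      exact adj_swap_mul w (by rw [hc]; exact hxy.symm) (hw'.imp And.left And.right)
    have h2 : (swapGraph a b).Adj w (swap (x c) (z c) * w) := by
      rw [← hc]
      exact adj_swap_mul w (by rw [hc]; exact hxz.symm) (hw'.symm.imp And.left And.right)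
    have hcls : ∀ p q : Perm α, p ∈ ({x, y, z} : Set (Perm α)) → q ∈ ({x, y, z} : Set (Perm α)) →
        p c = q c → p = q := by
      rintro p q (rfl | rfl | rfl) (rfl | rfl | rfl) h <;> first | rfl | exact absurd h ‹_› |
        exact absurd h.symm ‹_›
    have hwS : w ≠ x → w ∉ ({x, y, z} : Set (Perm α)) := by
      intro hne h
      exact hne (hcls w x h (by simp) hc)
    have hin : ∀ (K : (swapGraph a b).Subgraph) (l : α), K.verts ⊆ {ρ | ρ c = l} → ∀ p q,
        K.Adj p q → (w ≠ x →
          ¬ (p ∈ ({x, y, z} : Set (Perm α)) ∧ q ∈ ({x, y, z} : Set (Perm α)))) := by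
      rintro K l hK p q h - ⟨hp, hq⟩
      have h1 : p c = l := hK h.fst_mem
      have h2 : q c = l := hK h.snd_mem
      exact h.ne (hcls p q hp hq (h1.trans h2.symm))
    obtain ⟨L₁, hL₁, hv₁, ha₁⟩ := exists_join (hX w hw).1 (hY w hw).1 (hX w hw).2.2.1
      (hY w hw).2.2.1 h1 _ (hin _ _ (hX w hw).2.2.2) (hin _ _ (hY w hw).2.2.2)
      (fun hne h => hwS hne h.1) (fun hne h => hwS hne h.2)
    obtain ⟨L₂, hL₂, hv₂, ha₂⟩ := exists_join hL₁ (hZ w hw).1 (u := w)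
      (by rw [hv₁]; exact Or.inl (hX w hw).2.2.1) (hZ w hw).2.2.1 h2 _ ha₁
      (hin _ _ (hZ w hw).2.2.2) (fun hne h => hwS hne h.1) (fun hne h => hwS hne h.2)
    exact ⟨L₂, fun _ => ⟨hL₂, by rw [hv₂, hv₁], ha₂⟩⟩
  choose H hH using this
  exact ⟨H, fun w hw => ⟨(hH w hw).1, (hH w hw).2.1, fun hne p q h => (hH w hw).2.2 p q h hne⟩⟩

/-- The pieces inside the copy of `s`: subgraphs from `s` to the vertices in `W` and two further
ones, meeting only in `s`. -/
structure CopyPieces (c : α) {G : SimpleGraph (Perm α)} (s : Perm α) (W : Finset (Perm α))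
    (R : Perm α → G.Subgraph) (A P : G.Subgraph) : Prop where
  conn : ∀ w ∈ W, (R w).Connected ∧ s ∈ (R w).verts ∧ w ∈ (R w).verts ∧
    (R w).verts ⊆ {ρ | ρ c = s c}
  inter : ∀ w ∈ W, ∀ w' ∈ W, w ≠ w' → (R w).verts ∩ (R w').verts ⊆ {s}
  connA : A.Connected ∧ s ∈ A.verts ∧ A.verts ⊆ {ρ | ρ c = s c}
  interA : ∀ w ∈ W, (R w).verts ∩ A.verts ⊆ {s}
  connP : P.Connected ∧ s ∈ P.verts ∧ P.verts ⊆ {ρ | ρ c = s c}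
  interP : ∀ w ∈ W, (R w).verts ∩ P.verts ⊆ {s}
  interAP : A.verts ∩ P.verts ⊆ {s}

lemma CopyPieces.pairwise {G : SimpleGraph (Perm α)} {s : Perm α} {W W' : Finset (Perm α)}
    {R : Perm α → G.Subgraph} {A P : G.Subgraph} (h : CopyPieces c s W R A P) (f : W' → Perm α)
    (hf : Function.Injective f) (hfW : ∀ w, f w ∈ W) (i j : Option (Option W')) (hij : i ≠ j) :
    optionFamily P.verts A.verts (fun w : W' => (R (f w)).verts) i ∩
      optionFamily P.verts A.verts (fun w : W' => (R (f w)).verts) j ⊆ {s} :=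
  optionFamily_pairwise (fun w w' hw => h.inter _ (hfW w) _ (hfW w') (hf.ne hw))
    (fun w => h.interP _ (hfW w)) (fun w => h.interA _ (hfW w)) h.interAP i j hij

lemma CopyPieces.mem {G : SimpleGraph (Perm α)} {s : Perm α} {W W' : Finset (Perm α)}
    {R : Perm α → G.Subgraph} {A P : G.Subgraph} (h : CopyPieces c s W R A P) (f : W' → Perm α)
    (hfW : ∀ w, f w ∈ W) (i : Option (Option W')) :
    s ∈ optionFamily P.verts A.verts (fun w : W' => (R (f w)).verts) i ∧
      optionFamily P.verts A.verts (fun w : W' => (R (f w)).verts) i ⊆ {ρ | ρ c = s c} :=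
  optionFamily_forall (P := fun M : Set (Perm α) => s ∈ M ∧ M ⊆ {p | p c = s c})
    h.connP.2 h.connA.2 (fun w => ⟨(h.conn _ (hfW w)).2.1, (h.conn _ (hfW w)).2.2.2⟩) i

/-- Assembly of the trees for three vertices of three different copies. -/
lemma connectsSet_of_copyPieces {x y z : Perm α} (hxy : x c ≠ y c) (hxz : x c ≠ z c)
    (hyz : y c ≠ z c) (W : Finset (Perm α))
    (hW : ∀ w ∈ W, w c = x c ∧ (w a = y c ∧ w b = z c ∨ w a = z c ∧ w b = y c))
    {X Y Z : Perm α → (swapGraph a b).Subgraph} {A₁ A₂ A₃ P₁ P₂ P₃ : (swapGraph a b).Subgraph}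
    (hX : CopyPieces c x W X A₁ P₁)
    (hY : CopyPieces c y (W.image fun w => swap (x c) (y c) * w) Y A₂ P₂)
    (hZ : CopyPieces c z (W.image fun w => swap (x c) (z c) * w) Z A₃ P₃)
    {M N : (swapGraph a b).Subgraph} (hM : M.Connected) (hN : N.Connected)
    (hMv : ∀ p ∈ M.verts, p c ≠ x c ∧ p c ≠ y c ∧ p c ≠ z c)
    (hNv : ∀ p ∈ N.verts, p c ≠ x c ∧ p c ≠ y c ∧ p c ≠ z c)
    (hMN : ∀ p ∈ N.verts, p ∉ M.verts)
    (hM₁ : ∃ p ∈ P₁.verts, ∃ o ∈ M.verts, (swapGraph a b).Adj p o)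
    (hM₂ : ∃ p ∈ P₂.verts, ∃ o ∈ M.verts, (swapGraph a b).Adj p o)
    (hM₃ : ∃ p ∈ P₃.verts, ∃ o ∈ M.verts, (swapGraph a b).Adj p o)
    (hN₁ : ∃ p ∈ A₁.verts, ∃ o ∈ N.verts, (swapGraph a b).Adj p o)
    (hN₂ : ∃ p ∈ A₂.verts, ∃ o ∈ N.verts, (swapGraph a b).Adj p o)
    (hN₃ : ∃ p ∈ A₃.verts, ∃ o ∈ N.verts, (swapGraph a b).Adj p o) :
    ConnectsSet (swapGraph a b) {x, y, z} (W.card + 2) := by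
  have hi₂ : ∀ w ∈ W, swap (x c) (y c) * w ∈ W.image fun w => swap (x c) (y c) * w :=
    fun w hw => Finset.mem_image_of_mem _ hw
  have hi₃ : ∀ w ∈ W, swap (x c) (z c) * w ∈ W.image fun w => swap (x c) (z c) * w :=
    fun w hw => Finset.mem_image_of_mem _ hw
  have hinj : ∀ g : Perm α, Function.Injective fun w : W => g * w := fun g =>
    (mul_right_injective g).comp Subtype.val_injective
  obtain ⟨H, hH⟩ := exists_hub_trees hxy hxz hyz W hW X
    (fun w => Y (swap (x c) (y c) * w)) (fun w => Z (swap (x c) (z c) * w)) hX.conn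
    (fun w hw => hY.conn _ (hi₂ w hw)) (fun w hw => hZ.conn _ (hi₃ w hw))
  have honly : ∀ (K : (swapGraph a b).Subgraph) (s : Perm α),
      s ∈ ({x, y, z} : Set (Perm α)) → K.verts ⊆ {ρ | ρ c = s c} →
      ∀ p ∈ K.verts, p ∈ ({x, y, z} : Set (Perm α)) → p = s := by
    intro K s hs hK p hp hpS
    have h : p c = s c := hK hp
    rcases hs with rfl | rfl | rfl <;> rcases hpS with rfl | rfl | rfl <;>
      first | rfl | exact absurd h ‹_› | exact absurd h.symm ‹_›
  have hout : ∀ {K : (swapGraph a b).Subgraph},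
      (∀ p ∈ K.verts, p c ≠ x c ∧ p c ≠ y c ∧ p c ≠ z c) →
      ∀ p ∈ K.verts, p ∉ ({x, y, z} : Set (Perm α)) := by
    rintro K hK p hp (rfl | rfl | rfl)
    · exact (hK _ hp).1 rfl
    · exact (hK _ hp).2.1 rfl
    · exact (hK _ hp).2.2 rfl
  have hxS : x ∈ ({x, y, z} : Set (Perm α)) := by simp
  have hyS : y ∈ ({x, y, z} : Set (Perm α)) := by simp
  have hzS : z ∈ ({x, y, z} : Set (Perm α)) := by simp
  obtain ⟨D, hD, hDv, hDa⟩ := exists_join_three hN hX.connA.1 hY.connA.1 hZ.connA.1 (hout hNv)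
    (honly A₁ x hxS hX.connA.2.2) (honly A₂ y hyS hY.connA.2.2) (honly A₃ z hzS hZ.connA.2.2)
    hN₁ hN₂ hN₃
  obtain ⟨E, hE, hEv, hEa⟩ := exists_join_three hM hX.connP.1 hY.connP.1 hZ.connP.1 (hout hMv)
    (honly P₁ x hxS hX.connP.2.2) (honly P₂ y hyS hY.connP.2.2) (honly P₃ z hzS hZ.connP.2.2)
    hM₁ hM₂ hM₃
  have key := connectsSet_of_pieces (optionFamily E D fun w : W => H w)
    (optionFamily_forall hE hD fun w => (hH w w.2).1)
    (fun p => p c) hxy hxz hyz (optionFamily M.verts N.verts fun _ => ∅) _ _ _ ?_ ?_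
    (hX.mem (fun w : W => (w : Perm α)) fun w => w.2)
    (hY.mem (fun w : W => swap (x c) (y c) * w) fun w => hi₂ w w.2)
    (hZ.mem (fun w : W => swap (x c) (z c) * w) fun w => hi₃ w w.2) ?_
    (hX.pairwise (fun w : W => (w : Perm α)) Subtype.val_injective fun w => w.2)
    (hY.pairwise (fun w : W => swap (x c) (y c) * w) (hinj _) fun w => hi₂ w w.2)
    (hZ.pairwise (fun w : W => swap (x c) (z c) * w) (hinj _) fun w => hi₃ w w.2) ?_
  · rwa [Fintype.card_option, Fintype.card_option, Fintype.card_coe] at key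
  · rintro (_ | _ | w)
    · exact hEv
    · exact hDv
    · simpa [optionFamily] using (hH w w.2).2.1
  · exact optionFamily_forall
      (P := fun M : Set (Perm α) => ∀ p ∈ M, p c ≠ x c ∧ p c ≠ y c ∧ p c ≠ z c)
      hMv hNv fun _ p hp => absurd hp (Set.notMem_empty p)
  · exact optionFamily_pairwise (by simp) (by simp) (by simp) fun p hp => hMN p hp.1 hp.2
  · rintro (_ | _ | w) (_ | _ | w') hne p hp q hq h h'
    · exact hne rfl
    · exact hEa p q h ⟨hp, hq⟩
    · exact hEa p q h ⟨hp, hq⟩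
    · exact hEa p q h' ⟨hp, hq⟩
    · exact hne rfl
    · exact hDa p q h ⟨hp, hq⟩
    · exact hEa p q h' ⟨hp, hq⟩
    · exact hDa p q h' ⟨hp, hq⟩
    · by_cases hw : (w : Perm α) = x
      · have hw' : (w' : Perm α) ≠ x := fun hw' =>
          hne (congrArg (fun w => some (some w)) (Subtype.ext (hw.trans hw'.symm)))
        exact (hH w' w'.2).2.2 hw' p q h' ⟨hp, hq⟩
      · exact (hH w w.2).2.2 hw p q h ⟨hp, hq⟩

lemma swap_mul_hub (hab : a ≠ b) (hca : c ≠ a) (hcb : c ≠ b) {s : Perm α} {i k : α}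
    (hik : i ≠ k) (hk : k ≠ s c)
    (ha : s a = i ∨ s a = s c ∨ s a = k) (hb : s b = i ∨ s b = s c ∨ s b = k) :
    (swap i (s c) * s) c = i ∧ ((swap i (s c) * s) a = s c ∧ (swap i (s c) * s) b = k ∨
      (swap i (s c) * s) a = k ∧ (swap i (s c) * s) b = s c) := by
  have h1 : s a ≠ s c := s.injective.ne hca.symm
  have h2 : s b ≠ s c := s.injective.ne hcb.symm
  have h3 : s a ≠ s b := s.injective.ne hab
  have h4 := swap_apply_of_ne_of_ne hik.symm hk
  simp only [Perm.mul_apply, swap_apply_right, true_and]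
  rcases ha with ha | ha | ha
  · rcases hb with hb | hb | hb
    · exact absurd (ha.trans hb.symm) h3
    · exact absurd hb h2
    · rw [ha, hb, swap_apply_left, h4]
      exact Or.inl ⟨rfl, rfl⟩
  · exact absurd ha h1
  · rcases hb with hb | hb | hb
    · rw [ha, hb, swap_apply_left, h4]
      exact Or.inr ⟨rfl, rfl⟩
    · exact absurd hb h2
    · exact absurd (ha.trans hb.symm) h3

/-- Three vertices of three different copies, when some edge of another copy is adjacent to all
three copies but not to the three vertices. -/
lemma connectsSet_of_hub (hab : a ≠ b) (hca : c ≠ a) (hcb : c ≠ b) (hn : 4 ≤ Fintype.card α)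
    {x y z t u : Perm α} (hxy : x c ≠ y c) (hxz : x c ≠ z c) (hyz : y c ≠ z c)
    (htu : (swapGraph a b).Adj t u) (huc : u c = t c)
    (htc : t c ≠ x c ∧ t c ≠ y c ∧ t c ≠ z c)
    (hS : ∀ s ∈ ({x, y, z} : Set (Perm α)), ¬ (swapGraph a b).Adj t s ∧ ¬ (swapGraph a b).Adj u s ∧
      (t a = s c ∨ t b = s c ∨ u a = s c ∨ u b = s c)) :
    ConnectsSet (swapGraph a b) {x, y, z} (2 * Fintype.card α - 4) := by
  let O : Set α := {l | l ≠ x c ∧ l ≠ y c ∧ l ≠ z c}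
  have hO : ∀ l, l ∉ O → l = x c ∨ l = y c ∨ l = z c := by
    intro l hl
    by_contra! h
    exact hl h
  have hO' : ∀ s ∈ ({x, y, z} : Set (Perm α)), s c ∉ O := by
    rintro s (rfl | rfl | rfl) ⟨h1, h2, h3⟩
    · exact h1 rfl
    · exact h2 rfl
    · exact h3 rfl
  -- the hubs, among them those that have to be used
  obtain ⟨W, hBW, hWc, hW⟩ := exists_hubs hab hca hcb hn hxy hxz hyz
    (({x, swap (x c) (y c) * y, swap (x c) (z c) * z} : Finset (Perm α)).filter fun w =>
      w c = x c ∧ (w a = y c ∧ w b = z c ∨ w a = z c ∧ w b = y c))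
    ((Finset.card_filter_le _ _).trans Finset.card_le_three)
    (fun w hw => (Finset.mem_filter.1 hw).2)
  -- gates to the edge `tu`
  have hgate : ∀ s ∈ ({x, y, z} : Set (Perm α)), ∃ p, p c = s c ∧
      ((swapGraph a b).Adj p t ∨ (swapGraph a b).Adj p u) := by
    intro s hs
    have hne : s c ≠ t c := fun h => hO' s hs (h ▸ htc)
    by_cases h : t a = s c ∨ t b = s c
    · exact ⟨swap (t c) (s c) * t, by simp, Or.inl (adj_swap_mul t hne h).symm⟩
    · have h' : u a = s c ∨ u b = s c := by
        have := (hS s hs).2.2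
        tauto
      exact ⟨swap (u c) (s c) * u, by simp, Or.inr (adj_swap_mul u (huc ▸ hne) h').symm⟩
  have hpieces : ∀ s ∈ ({x, y, z} : Set (Perm α)), ∀ W' : Finset (Perm α),
      (∀ w ∈ W', w c = s c ∧ w a ∉ O ∧ w b ∉ O) → W'.card ≤ W.card →
      (s a ∉ O → s b ∉ O → s ∈ W') →
      ∃ (R : Perm α → (swapGraph a b).Subgraph) (A P : (swapGraph a b).Subgraph),
      CopyPieces c s W' R A P ∧
      (∃ q ∈ P.verts, ∃ o, (swapGraph a b).Adj q o ∧ o c ∈ O ∧ o ≠ t ∧ o ≠ u) ∧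
      ∃ p ∈ A.verts, ∃ o ∈ ((swapGraph a b).subgraphOfAdj htu).verts, (swapGraph a b).Adj p o := by
    intro s hs W' h1 h2 h3
    obtain ⟨p, hp, hpa⟩ := hgate s hs
    obtain ⟨R, A, P, o, hR, hRd, hA, hAd, hP, hPd, hAP, ho⟩ := exists_copy_pieces hab hca hcb hn O
      (hO' s hs) htc huc W' h1 (by omega) h3 (hS s hs).1 (hS s hs).2.1 hp hpa
    obtain ⟨q, hq, hqo⟩ := hP.2.2.1
    refine ⟨R, A, P, ⟨hR, hRd, ⟨hA.1, hA.2.1, hA.2.2.2⟩, hAd, ⟨hP.1, hP.2.1, hP.2.2.2⟩, hPd, hAP⟩,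
      ⟨q, hq, o, hqo, ho⟩, p, hA.2.2.1, ?_⟩
    rcases hpa with h | h
    · exact ⟨t, by simp, h⟩
    · exact ⟨u, by simp, h⟩
  have hxS : x ∈ ({x, y, z} : Set (Perm α)) := by simp
  have hyS : y ∈ ({x, y, z} : Set (Perm α)) := by simp
  have hzS : z ∈ ({x, y, z} : Set (Perm α)) := by simp
  have hOx : x c ∉ O := hO' x hxS
  have hOy : y c ∉ O := hO' y hyS
  have hOz : z c ∉ O := hO' z hzS
  have hW₁ : ∀ w ∈ W, w c = x c ∧ w a ∉ O ∧ w b ∉ O := by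
    intro w hw
    obtain ⟨h, ⟨h1, h2⟩ | ⟨h1, h2⟩⟩ := hW w hw <;> rw [h, h1, h2] <;> simp only [*] <;> simp
  have hW₂ : ∀ w ∈ W.image fun w => swap (x c) (y c) * w, w c = y c ∧ w a ∉ O ∧ w b ∉ O := by
    intro v hv
    obtain ⟨w, hw, rfl⟩ := Finset.mem_image.1 hv
    obtain ⟨h, ⟨h1, h2⟩ | ⟨h1, h2⟩⟩ := hW w hw <;>
      simp [h, h1, h2, swap_apply_of_ne_of_ne hxz.symm hyz.symm, hOx, hOz]
  have hW₃ : ∀ w ∈ W.image fun w => swap (x c) (z c) * w, w c = z c ∧ w a ∉ O ∧ w b ∉ O := by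
    intro v hv
    obtain ⟨w, hw, rfl⟩ := Finset.mem_image.1 hv
    obtain ⟨h, ⟨h1, h2⟩ | ⟨h1, h2⟩⟩ := hW w hw <;>
      simp [h, h1, h2, swap_apply_of_ne_of_ne hxy.symm hyz, hOx, hOy]
  obtain ⟨R₁, A₁, P₁, h₁, ⟨q₁, hq₁, o₁, hqo₁, ho₁⟩, hp₁⟩ := hpieces x hxS W hW₁ le_rfl (by
    intro h1 h2
    refine hBW (Finset.mem_filter.2 ⟨by simp, ?_⟩)
    have h3 := hO _ h1
    have h4 := hO _ h2
    have h5 : x a ≠ x c := x.injective.ne hca.symm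
    have h6 : x b ≠ x c := x.injective.ne hcb.symm
    have h7 : x a ≠ x b := x.injective.ne hab
    refine ⟨rfl, ?_⟩
    clear * - h3 h4 h5 h6 h7
    grind)
  obtain ⟨R₂, A₂, P₂, h₂, ⟨q₂, hq₂, o₂, hqo₂, ho₂⟩, hp₂⟩ := hpieces y hyS _ hW₂
    Finset.card_image_le (fun h1 h2 => Finset.mem_image.2 ⟨swap (x c) (y c) * y,
      hBW (Finset.mem_filter.2 ⟨by simp, swap_mul_hub hab hca hcb hxz hyz.symm (hO _ h1)
        (hO _ h2)⟩), by simp⟩)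
  obtain ⟨R₃, A₃, P₃, h₃, ⟨q₃, hq₃, o₃, hqo₃, ho₃⟩, hp₃⟩ := hpieces z hzS _ hW₃
    Finset.card_image_le (fun h1 h2 => Finset.mem_image.2 ⟨swap (x c) (z c) * z,
      hBW (Finset.mem_filter.2 ⟨by simp, (swap_mul_hub hab hca hcb hxy hyz
        ((hO _ h1).imp_right Or.symm) ((hO _ h2).imp_right Or.symm)).imp_right Or.symm⟩),
      by simp⟩)
  obtain ⟨J₂, hJ₂, h1J₂, h2J₂, hJ₂U⟩ := (joinedIn_outer hab hca hcb hn O ho₁.1 ho₂.1 ho₁.2.1 ho₁.2.2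
    ho₂.2.1 ho₂.2.2).exists_subgraph
  obtain ⟨J₃, hJ₃, h1J₃, h3J₃, hJ₃U⟩ := (joinedIn_outer hab hca hcb hn O ho₁.1 ho₃.1 ho₁.2.1 ho₁.2.2
    ho₃.2.1 ho₃.2.2).exists_subgraph
  obtain ⟨J, hJ, hJv, -⟩ := exists_glue hJ₂ hJ₃ h1J₂ h1J₃ (fun _ _ => True) (by simp) (by simp)
  have hJU : J.verts ⊆ {ρ | ρ c ∈ O ∧ ρ ≠ t ∧ ρ ≠ u} := hJv ▸ Set.union_subset hJ₂U hJ₃U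
  have htu' : ∀ p ∈ ((swapGraph a b).subgraphOfAdj htu).verts, p = t ∨ p = u := by simp
  rw [show 2 * Fintype.card α - 4 = W.card + 2 by omega]
  refine connectsSet_of_copyPieces hxy hxz hyz W hW h₁ h₂ h₃ hJ
    (Subgraph.subgraphOfAdj_connected htu) (fun p hp => (hJU hp).1) ?_ ?_
    ⟨q₁, hq₁, o₁, by rw [hJv]; exact Or.inl h1J₂, hqo₁⟩
    ⟨q₂, hq₂, o₂, by rw [hJv]; exact Or.inl h2J₂, hqo₂⟩
    ⟨q₃, hq₃, o₃, by rw [hJv]; exact Or.inr h3J₃, hqo₃⟩ hp₁ hp₂ hp₃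
  · intro p hp
    rcases htu' p hp with rfl | rfl
    · exact htc
    · rw [huc]
      exact htc
  · intro p hp hpJ
    rcases htu' p hp with rfl | rfl
    · exact (hJU hpJ).2.1 rfl
    · exact (hJU hpJ).2.2 rfl

end HubTrees

section HubExistence

variable {α : Type*} [Fintype α] [DecidableEq α] {a b c s : α}

/-- The values of a vertex at `a`, `b` and `s`. -/
def HasWord (a b s : α) (x : Perm α) (p q r : α) : Prop := x a = p ∧ x b = q ∧ x s = r

/-- A vertex obtained from one with the values `p`, `q`, `r`, `h` at `a`, `b`, `s`, `c` by moving
the value `x c` to `c`. -/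
def Reached (a b c s h : α) (x : Perm α) (p q r : α) : Prop :=
  x c = p ∧ HasWord a b s x h q r ∨ x c = q ∧ HasWord a b s x p h r

lemma reached_of_adj (hab : a ≠ b) (hca : c ≠ a) (hcb : c ≠ b) (hsa : s ≠ a) (hsb : s ≠ b)
    (hsc : s ≠ c) {v x : Perm α} (hvx : (swapGraph a b).Adj v x) (hc : x c ≠ v c) :
    Reached a b c s (v c) x (v a) (v b) (v s) := by
  obtain ⟨h1, h2⟩ := Adj.eq_swap_mul hvx hc hca hcb
  have h3 : ∀ t, x t = swap (v c) (x c) (v t) := fun t => by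
    conv_lhs => rw [h1]
    rfl
  have h4 := v.injective.ne hca
  have h5 := v.injective.ne hcb
  have h6 := v.injective.ne hab
  have h7 := v.injective.ne hsc
  have h8 := v.injective.ne hsa
  have h9 := v.injective.ne hsb
  rcases h2 with h2 | h2
  · exact Or.inl ⟨h2.symm, by rw [h3, h2, swap_apply_right],
      by rw [h3, ← h2, swap_apply_of_ne_of_ne h5.symm h6.symm],
      by rw [h3, ← h2, swap_apply_of_ne_of_ne h7 h8]⟩
  · exact Or.inr ⟨h2.symm, by rw [h3, ← h2, swap_apply_of_ne_of_ne h4.symm h6],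
      by rw [h3, h2, swap_apply_right],
      by rw [h3, ← h2, swap_apply_of_ne_of_ne h7 h9]⟩

/-- If no tree system exists, then every potential hub edge is adjacent to one of the vertices. -/
lemma exists_reached (hab : a ≠ b) (hca : c ≠ a) (hcb : c ≠ b) (hsa : s ≠ a) (hsb : s ≠ b)
    (hsc : s ≠ c) (hn : 4 ≤ Fintype.card α) {x y z : Perm α}
    (hxy : x c ≠ y c) (hxz : x c ≠ z c) (hyz : y c ≠ z c)
    (hnot : ¬ ConnectsSet (swapGraph a b) {x, y, z} (2 * Fintype.card α - 4))
    {h p q r : α} (hx : h ≠ x c) (hy : h ≠ y c) (hz : h ≠ z c)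
    (hd : (p ≠ q ∧ p ≠ r ∧ p ≠ h) ∧ (q ≠ r ∧ q ≠ h) ∧ r ≠ h)
    (hcov : ∀ w ∈ ({x, y, z} : Set (Perm α)), p = w c ∨ q = w c ∨ r = w c) :
    (∃ w ∈ ({x, y, z} : Set (Perm α)), Reached a b c s h w p q r ∨ Reached a b c s h w r q p) ∧
    ∃ w ∈ ({x, y, z} : Set (Perm α)), Reached a b c s h w p q r ∨ Reached a b c s h w p r q := by
  obtain ⟨v, rfl, rfl, rfl, rfl⟩ := exists_perm_apply (p := a) (q := b) (r := s) (s := c)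
    ⟨hab, hsa.symm, hca.symm⟩ ⟨hsb.symm, hcb.symm⟩ hsc hd.1 hd.2.1 hd.2.2
  have hw : ∀ w ∈ ({x, y, z} : Set (Perm α)), w c ≠ v c := by
    rintro w (rfl | rfl | rfl)
    exacts [hx.symm, hy.symm, hz.symm]
  constructor
  · by_contra! hno
    refine hnot (connectsSet_of_hub hab hca hcb hn hxy hxz hyz (adj_mul_swap_left v hsa)
      (by simp [swap_apply_of_ne_of_ne hca hsc.symm]) ⟨hx, hy, hz⟩ fun w hwS => ⟨?_, ?_, ?_⟩)
    · exact fun hadj => (hno w hwS).1 (reached_of_adj hab hca hcb hsa hsb hsc hadj (hw w hwS))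
    · intro hadj
      refine (hno w hwS).2 ?_
      have := reached_of_adj hab hca hcb hsa hsb hsc hadj
      simp only [Perm.mul_apply, swap_apply_left, swap_apply_right,
        swap_apply_of_ne_of_ne hca hsc.symm, swap_apply_of_ne_of_ne hab.symm hsb.symm] at this
      exact this (hw w hwS)
    · simpa [swap_apply_of_ne_of_ne hab.symm hsb.symm, or_left_comm, or_comm] using hcov w hwS
  · by_contra! hno
    refine hnot (connectsSet_of_hub hab hca hcb hn hxy hxz hyz (adj_mul_swap_right v hsb)
      (by simp [swap_apply_of_ne_of_ne hcb hsc.symm]) ⟨hx, hy, hz⟩ fun w hwS => ⟨?_, ?_, ?_⟩)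
    · exact fun hadj => (hno w hwS).1 (reached_of_adj hab hca hcb hsa hsb hsc hadj (hw w hwS))
    · intro hadj
      refine (hno w hwS).2 ?_
      have := reached_of_adj hab hca hcb hsa hsb hsc hadj
      simp only [Perm.mul_apply, swap_apply_left, swap_apply_right,
        swap_apply_of_ne_of_ne hcb hsc.symm, swap_apply_of_ne_of_ne hab hsa.symm] at this
      exact this (hw w hwS)
    · simpa [swap_apply_of_ne_of_ne hab hsa.symm, or_left_comm, or_comm] using hcov w hwS

/-- The configuration of three vertices without a hub edge. -/
def Exceptional (a b c s : α) (x y z : Perm α) : Prop :=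
  (x a = y a ∧ x a = z a ∧ x b = y c ∧ x s = z c ∧ y b = z c ∧ y s = x c ∧ z b = x c ∧ z s = y c) ∨
    (x a = y a ∧ x a = z a ∧ x b = z c ∧ x s = y c ∧ y b = x c ∧ y s = z c ∧ z b = y c ∧ z s = x c)

lemma exceptional_of_not_connectsSet (hab : a ≠ b) (hca : c ≠ a) (hcb : c ≠ b) (hsa : s ≠ a)
    (hsb : s ≠ b) (hsc : s ≠ c) (hn : 4 ≤ Fintype.card α) {x y z : Perm α}
    (hxy : x c ≠ y c) (hxz : x c ≠ z c) (hyz : y c ≠ z c)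
    (hnot : ¬ ConnectsSet (swapGraph a b) {x, y, z} (2 * Fintype.card α - 4)) :
    Exceptional a b c s x y z ∨ Exceptional b a c s x y z := by
  obtain ⟨h, hx, hy, hz⟩ := exists_ne_three hn (x c) (y c) (z c)
  have key : ∀ p q r : α, (p ≠ q ∧ p ≠ r ∧ p ≠ h) ∧ (q ≠ r ∧ q ≠ h) ∧ r ≠ h →
      (∀ w ∈ ({x, y, z} : Set (Perm α)), p = w c ∨ q = w c ∨ r = w c) → _ := fun p q r =>
    exists_reached (p := p) (q := q) (r := r) hab hca hcb hsa hsb hsc hn hxy hxz hyz hnot hx hy hz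
  have h0 := key (x c) (y c) (z c) (by simp [*, Ne.symm]) (by simp)
  have h2 := key (z c) (x c) (y c) (by simp [*, Ne.symm]) (by simp)
  have h4 := key (y c) (z c) (x c) (by simp [*, Ne.symm]) (by simp)
  simp only [Reached, HasWord, Set.mem_insert_iff, Set.mem_singleton_iff, exists_eq_or_imp,
    exists_eq_left, hxy, hxz, hyz, hxy.symm, hxz.symm, hyz.symm, false_and, true_and, or_false,
    false_or] at h0 h2 h4
  clear * - hxy hxz hyz hx hy hz h0 h2 h4
  unfold Exceptional
  generalize x c = i at *
  generalize y c = j at *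
  generalize z c = k at *
  obtain ⟨h0, h1⟩ := h0
  obtain ⟨h2, h3⟩ := h2
  obtain ⟨h4, h5⟩ := h4
  rcases h0 with ⟨hxa, hxb, hxs⟩ | (⟨hya, hyb, hys⟩ | ⟨hya, hyb, hys⟩) | ⟨hza, hzb, hzs⟩ <;>
    simp only [*, false_and, and_false, true_and, and_true, or_false, false_or, or_true,
      true_or] at * <;>
    grind

lemma Exceptional.apply_mem {x y z : Perm α} (h : Exceptional a b c s x y z) :
    (x b = y c ∨ x b = z c) ∧ (x s = y c ∨ x s = z c) := by
  unfold Exceptional at h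
  tauto

lemma connectsSet_of_three_copies (hab : a ≠ b) (hca : c ≠ a) (hcb : c ≠ b)
    (hn : 5 ≤ Fintype.card α) {x y z : Perm α}
    (hxy : x c ≠ y c) (hxz : x c ≠ z c) (hyz : y c ≠ z c) :
    ConnectsSet (swapGraph a b) {x, y, z} (2 * Fintype.card α - 4) := by
  by_contra hnot
  have h1 : ({a, b, c} : Finset α).card ≤ 3 := Finset.card_le_three
  obtain ⟨s, hs, t, ht, hst⟩ := Finset.one_lt_card.1
    (show 1 < (Finset.univ \ {a, b, c} : Finset α).card by
      have := Finset.le_card_sdiff ({a, b, c} : Finset α) Finset.univ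
      rw [Finset.card_univ] at this
      omega)
  simp only [Finset.mem_sdiff, Finset.mem_univ, true_and, Finset.mem_insert,
    Finset.mem_singleton, not_or] at hs ht
  have h2 : ∀ s, s ≠ a ∧ s ≠ b ∧ s ≠ c →
      Exceptional a b c s x y z ∨ Exceptional b a c s x y z := fun s hs =>
    exceptional_of_not_connectsSet hab hca hcb hs.1 hs.2.1 hs.2.2 (by omega) hxy hxz hyz hnot
  have h3 := (h2 s hs).imp Exceptional.apply_mem Exceptional.apply_mem
  have h4 := (h2 t ht).imp Exceptional.apply_mem Exceptional.apply_mem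
  have h5 := x.injective.ne hst
  have h6 := x.injective.ne hs.1
  have h7 := x.injective.ne hs.2.1
  have h8 := x.injective.ne ht.1
  have h9 := x.injective.ne ht.2.1
  clear * - h3 h4 h5 h6 h7 h8 h9
  grind

end HubExistence

section Explicit

variable {V W : Type*} {G : SimpleGraph V} {G' : SimpleGraph W}

/-- The edges in the list, from last to first, attach new vertices to a tree rooted in `r`. -/
def Grows (G : SimpleGraph V) (r : V) : List (V × V) → Prop
  | [] => True
  | e :: l => Grows G r l ∧ (e.1 = r ∨ e.1 ∈ l.map Prod.snd) ∧ G.Adj e.1 e.2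

instance decidablePredGrows [DecidableEq V] [DecidableRel G.Adj] (r : V) : DecidablePred (Grows G r)
  | [] => isTrue trivial
  | e :: l =>
    have : Decidable (Grows G r l) := decidablePredGrows r l
    inferInstanceAs (Decidable (Grows G r l ∧ (e.1 = r ∨ e.1 ∈ l.map Prod.snd) ∧ G.Adj e.1 e.2))

lemma Grows.exists_subgraph {f : V → W} (hf : Function.Injective f)
    (hG : ∀ u v, G.Adj u v → G'.Adj (f u) (f v)) (r : V) :
    ∀ l : List (V × V), Grows G r l → ∃ H : G'.Subgraph, H.Connected ∧
      (∀ p, p ∈ H.verts ↔ ∃ v, (v = r ∨ v ∈ l.map Prod.snd) ∧ f v = p) ∧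
      ∀ p q, H.Adj p q → ∃ u v, ((u, v) ∈ l ∨ (v, u) ∈ l) ∧ f u = p ∧ f v = q
  | [], _ => ⟨G'.singletonSubgraph (f r), Subgraph.singletonSubgraph_connected,
      by simp [eq_comm], by simp⟩
  | e :: l, ⟨hl, he, ha⟩ => by
    obtain ⟨H, hH, hv, hadj⟩ := Grows.exists_subgraph hf hG r l hl
    obtain ⟨L, hL, hLv, hLa⟩ := exists_attach hH ((hv (f e.1)).2 ⟨_, he, rfl⟩) (hG _ _ ha)
      (fun p q => ∃ u v, ((u, v) ∈ e :: l ∨ (v, u) ∈ e :: l) ∧ f u = p ∧ f v = q)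
      (fun p q h => by
        obtain ⟨u, v, h, h'⟩ := hadj p q h
        exact ⟨u, v, h.imp (List.mem_cons_of_mem _) (List.mem_cons_of_mem _), h'⟩)
      ⟨e.1, e.2, by simp, rfl, rfl⟩ ⟨e.2, e.1, by simp, rfl, rfl⟩
    refine ⟨L, hL, fun p => ?_, hLa⟩
    rw [hLv, Set.mem_insert_iff, hv]
    constructor
    · rintro (rfl | ⟨v, hv, rfl⟩)
      · exact ⟨e.2, by simp, rfl⟩
      · exact ⟨v, hv.imp_right (List.mem_cons_of_mem _), rfl⟩
    · rintro ⟨v, hv, rfl⟩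
      rcases hv with rfl | hv
      · exact Or.inr ⟨_, Or.inl rfl, rfl⟩
      · rcases List.mem_cons.1 hv with rfl | hv
        · exact Or.inl rfl
        · exact Or.inr ⟨v, Or.inr hv, rfl⟩

/-- Internally disjoint trees given by lists of edges. -/
lemma connectsSet_of_lists {f : V → W} (hf : Function.Injective f)
    (hG : ∀ u v, G.Adj u v → G'.Adj (f u) (f v)) (r : V) {ι : Type*} [Fintype ι] (S : List V)
    (L : ι → List (V × V)) (hL : ∀ i, Grows G r (L i))
    (hS : ∀ i, ∀ s ∈ S, s = r ∨ s ∈ (L i).map Prod.snd) (hr : r ∈ S)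
    (hd : ∀ i j, i ≠ j → ∀ e ∈ L i, e.2 ∈ (L j).map Prod.snd → e.2 ∈ S)
    (he : ∀ i j, i ≠ j → ∀ e ∈ L i, e.1 ∈ S → e.2 ∈ S → e ∉ L j ∧ e.swap ∉ L j) :
    ConnectsSet G' (f '' {v | v ∈ S}) (Fintype.card ι) := by
  choose H hH hv ha using fun i => Grows.exists_subgraph hf hG r (L i) (hL i)
  refine connectsSet_of_subgraphs H hH ?_ ?_ ?_
  · rintro i _ ⟨s, hs, rfl⟩
    exact (hv i _).2 ⟨s, hS i s hs, rfl⟩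
  · rintro i j hij p ⟨hp, hp'⟩
    obtain ⟨v, h, rfl⟩ := (hv i _).1 hp
    obtain ⟨w, h', hw⟩ := (hv j _).1 hp'
    obtain rfl := hf hw
    refine ⟨w, ?_, rfl⟩
    rcases h with rfl | h
    · exact hr
    · rcases h' with rfl | h'
      · exact hr
      · obtain ⟨e, he, rfl⟩ := List.mem_map.1 h
        exact hd i j hij e he h'
  · rintro i j hij _ ⟨p, hp, rfl⟩ _ ⟨q, hq, rfl⟩ h h'
    obtain ⟨u, v, k, hu, hv⟩ := ha i _ _ h
    obtain ⟨u', v', k', hu', hv'⟩ := ha j _ _ h'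
    rw [hf hu, hf hv] at k
    rw [hf hu', hf hv'] at k'
    rcases k with k | k
    · have := he i j hij _ k hp hq
      exact k'.elim this.1 this.2
    · have := he i j hij _ k hq hp
      exact k'.elim this.2 this.1

end Explicit

section Four

instance {α : Type*} [Fintype α] [DecidableEq α] (a b : α) : DecidableRel (swapGraph a b).Adj :=
  fun σ τ => inferInstanceAs
    (Decidable (∃ i, (i ≠ a ∧ τ = σ * swap a i) ∨ (i ≠ b ∧ τ = σ * swap b i)))

/-- Four trees for the exceptional triple in `Perm (Fin 4)`. -/
def fourTrees : Fin 4 → List (Perm (Fin 4) × Perm (Fin 4)) :=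
  ![[(List.formPerm [0, 1, 3, 2], List.formPerm [1, 3, 2]),
    (List.formPerm [0, 1, 2], List.formPerm [0, 1, 3, 2]),
    (List.formPerm [0, 3, 1, 2], List.formPerm [1, 2, 3]),
    (List.formPerm [0, 1, 2], List.formPerm [0, 3, 1, 2]),
    (swap 0 1, List.formPerm [0, 1, 2]),
    (1, swap 0 1)],
    [(List.formPerm [0, 3, 2, 1], List.formPerm [1, 3, 2]),
    (List.formPerm [0, 3, 2], List.formPerm [0, 3, 2, 1]),
    (swap 0 2, List.formPerm [0, 3, 2]),
    (swap 1 3, List.formPerm [1, 2, 3]),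
    (swap 0 2 * swap 1 3, swap 1 3),
    (swap 0 2, swap 0 2 * swap 1 3),
    (1, swap 0 2)],
    [(List.formPerm [0, 2, 3, 1], List.formPerm [1, 2, 3]),
    (List.formPerm [0, 2, 3], List.formPerm [0, 2, 3, 1]),
    (swap 2 3, List.formPerm [0, 2, 3]),
    (List.formPerm [1, 3, 2], swap 2 3),
    (swap 1 2, List.formPerm [1, 3, 2]),
    (1, swap 1 2)],
    [(List.formPerm [0, 2, 1, 3], List.formPerm [1, 3, 2]),
    (List.formPerm [0, 1, 3], List.formPerm [0, 2, 1, 3]),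
    (List.formPerm [0, 1, 2, 3], List.formPerm [1, 2, 3]),
    (List.formPerm [0, 1, 3], List.formPerm [0, 1, 2, 3]),
    (swap 0 3, List.formPerm [0, 1, 3]),
    (1, swap 0 3)]]

lemma fourTrees_grows : ∀ i, Grows (swapGraph (0 : Fin 4) 1) 1 (fourTrees i) := by
  decide +kernel

/-- The exceptional triple in `Perm (Fin 4)`. -/
def fourTriple : List (Perm (Fin 4)) := [1, List.formPerm [1, 2, 3], List.formPerm [1, 3, 2]]

lemma fourTrees_mem : ∀ i, ∀ s ∈ fourTriple, s = 1 ∨ s ∈ (fourTrees i).map Prod.snd := by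
  decide +kernel

lemma fourTrees_inter : ∀ i j, i ≠ j → ∀ e ∈ fourTrees i, e.2 ∈ (fourTrees j).map Prod.snd →
    e.2 ∈ fourTriple := by
  decide +kernel

set_option synthInstance.maxSize 1000 in
lemma fourTrees_edge : ∀ i j, i ≠ j → ∀ e ∈ fourTrees i, e.1 ∈ fourTriple → e.2 ∈ fourTriple →
    e ∉ fourTrees j ∧ e.swap ∉ fourTrees j := by
  decide +kernel

variable {α : Type*} [Fintype α] [DecidableEq α] {a b c s : α}

lemma swapGraph_comm : swapGraph a b = swapGraph b a := by
  ext σ τ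
  exact exists_congr fun _ => or_comm

lemma connectsSet_fourTriple {f : Perm (Fin 4) → Perm α} (hf : Function.Injective f)
    (hG : ∀ u v, (swapGraph 0 1).Adj u v → (swapGraph a b).Adj (f u) (f v)) :
    ConnectsSet (swapGraph a b)
      {f 1, f (List.formPerm [1, 2, 3]), f (List.formPerm [1, 3, 2])} 4 := by
  have h := connectsSet_of_lists hf hG 1 fourTriple fourTrees fourTrees_grows fourTrees_mem
    (by simp [fourTriple]) fourTrees_inter fourTrees_edge
  have hS : f '' {v | v ∈ fourTriple} =
      {f 1, f (List.formPerm [1, 2, 3]), f (List.formPerm [1, 3, 2])} := by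
    have : {v | v ∈ fourTriple} =
        ({1, List.formPerm [1, 2, 3], List.formPerm [1, 3, 2]} : Set (Perm (Fin 4))) := by
      ext v
      simp [fourTriple]
    rw [this, Set.image_insert_eq, Set.image_pair]
  rwa [hS, Fintype.card_fin] at h

lemma connectsSet_of_rotation (hab : a ≠ b) (hca : c ≠ a) (hcb : c ≠ b) (hsa : s ≠ a)
    (hsb : s ≠ b) (hsc : s ≠ c) (hn : Fintype.card α = 4) {x y z : Perm α}
    (hya : x a = y a) (hza : x a = z a) (hyb : y b = x s) (hys : y s = x c) (hyc : y c = x b)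
    (hzb : z b = x c) (hzs : z s = x b) (hzc : z c = x s) :
    ConnectsSet (swapGraph a b) {x, y, z} 4 := by
  have hinj : Function.Injective ![a, b, s, c] := by
    intro p q h
    fin_cases p <;> fin_cases q <;> simp_all
  let e : Fin 4 ≃ α := Equiv.ofBijective _
    ((Fintype.bijective_iff_injective_and_card _).2 ⟨hinj, by simp [hn]⟩)
  have hmul : ∀ (u : Perm (Fin 4)) (i j : Fin 4),
      x * e.permCongr (u * swap i j) = x * e.permCongr u * swap (e i) (e j) := by
    intro u i j
    rw [permCongr_mul, ← mul_assoc]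
    exact congrArg _ (symm_trans_swap_trans i j e)
  have h := connectsSet_fourTriple (a := a) (b := b) (f := fun g => x * e.permCongr g)
    ((mul_right_injective x).comp e.permCongr.injective) (by
      rintro u _ ⟨i, ⟨hi, rfl⟩ | ⟨hi, rfl⟩⟩
      · refine ⟨e i, Or.inl ⟨e.injective.ne hi, ?_⟩⟩
        rw [hmul]
        rfl
      · refine ⟨e i, Or.inr ⟨e.injective.ne hi, ?_⟩⟩
        rw [hmul]
        rfl)
  have hext : ∀ (w : Perm α) (g : Perm (Fin 4)), (∀ p, w (e p) = x (e (g p))) →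
      x * e.permCongr g = w := by
    intro w g hw
    ext t
    obtain ⟨p, rfl⟩ := e.surjective t
    simp [hw]
  rwa [hext x 1 fun p => rfl, hext y _ ?_, hext z _ ?_] at h
  · intro p
    fin_cases p
    exacts [hza.symm, hzb, hzs, hzc]
  · intro p
    fin_cases p
    exacts [hya.symm, hyb, hys, hyc]

lemma connectsSet_of_exceptional (hab : a ≠ b) (hca : c ≠ a) (hcb : c ≠ b) (hsa : s ≠ a)
    (hsb : s ≠ b) (hsc : s ≠ c) (hn : Fintype.card α = 4) {x y z : Perm α}
    (h : Exceptional a b c s x y z) : ConnectsSet (swapGraph a b) {x, y, z} 4 := by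
  rcases h with ⟨h1, h2, h3, h4, h5, h6, h7, h8⟩ | ⟨h1, h2, h3, h4, h5, h6, h7, h8⟩
  · exact connectsSet_of_rotation hab hca hcb hsa hsb hsc hn h1 h2 (h5.trans h4.symm) h6 h3.symm h7
      (h8.trans h3.symm) h4.symm
  · rw [Set.pair_comm]
    exact connectsSet_of_rotation hab hca hcb hsa hsb hsc hn h2 h1 (h7.trans h4.symm) h8 h3.symm h5
      (h6.trans h3.symm) h4.symm

end Four

section LowerBound

variable {α : Type*} [Fintype α] [DecidableEq α] {a b c : α}

lemma connectsSet_of_three_copies_four (hab : a ≠ b) (hca : c ≠ a) (hcb : c ≠ b)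
    (hn : Fintype.card α = 4) {x y z : Perm α}
    (hxy : x c ≠ y c) (hxz : x c ≠ z c) (hyz : y c ≠ z c) :
    ConnectsSet (swapGraph a b) {x, y, z} (2 * Fintype.card α - 4) := by
  by_contra hnot
  obtain ⟨s, hsa, hsb, hsc⟩ := exists_ne_three hn.ge a b c
  have h := exceptional_of_not_connectsSet hab hca hcb hsa hsb hsc hn.ge hxy hxz hyz hnot
  rw [hn] at hnot
  rcases h with h | h
  · exact hnot (connectsSet_of_exceptional hab hca hcb hsa hsb hsc hn h)
  · rw [swapGraph_comm] at hnot
    exact hnot (connectsSet_of_exceptional hab.symm hcb hca hsb hsa hsc hn h)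

/-- Lower bound for at least four letters. -/
lemma connectsSet_triple (hab : a ≠ b) (hn : 4 ≤ Fintype.card α) {x y z : Perm α}
    (hxy : x ≠ y) (hxz : x ≠ z) (hyz : y ≠ z) :
    ConnectsSet (swapGraph a b) {x, y, z} (2 * Fintype.card α - 4) := by
  obtain ⟨c, hca, hcb, hc⟩ : ∃ c, c ≠ a ∧ c ≠ b ∧ ¬ (x c = y c ∧ x c = z c) := by
    by_contra! h
    have key : ∀ p q : Perm α, (∀ c, c ≠ a → c ≠ b → p c = q c) → p a = q a → p = q := by
      intro p q h ha
      have h' : ∀ c, c ≠ b → p c = q c := fun c hc => by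
        by_cases hca : c = a
        · rw [hca, ha]
        · exact h c hca hc
      ext t
      by_cases ht : t = b
      · by_contra hne
        obtain ⟨t', ht'⟩ := q.surjective (p t)
        by_cases htb : t' = b
        · exact hne (by rw [← ht', htb, ht])
        · exact htb ((p.injective ((h' t' htb).trans ht')).trans ht)
      · exact h' t ht
    have hq : ∀ p q : Perm α, (∀ c, c ≠ a → c ≠ b → p c = q c) → q a = p a ∨ q a = p b := by
      intro p q h
      obtain ⟨t, ht⟩ := p.surjective (q a)
      by_cases hta : t = a
      · exact Or.inl (by rw [← ht, hta])
      · by_cases htb : t = b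
        · exact Or.inr (by rw [← ht, htb])
        · exact absurd (q.injective ((h t hta htb).symm.trans ht)) hta
    have h1 : ∀ c, c ≠ a → c ≠ b → x c = y c := fun c ha hb => (h c ha hb).1
    have h2 : ∀ c, c ≠ a → c ≠ b → x c = z c := fun c ha hb => (h c ha hb).2
    have h3 := hq x y h1
    have h4 := hq x z h2
    have h5 : x a ≠ y a := fun e => hxy (key x y h1 e)
    have h6 : x a ≠ z a := fun e => hxz (key x z h2 e)
    have h7 : y a ≠ z a := fun e =>
      hyz (key y z (fun c ha hb => (h1 c ha hb).symm.trans (h2 c ha hb)) e)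
    clear * - h3 h4 h5 h6 h7
    grind
  by_cases h1 : x c = y c
  · have h2 : z c ≠ x c := fun h => hc ⟨h1, h.symm⟩
    exact connectsSet_of_two_copies hab hca hcb hn hxy h1 h2
  · by_cases h2 : x c = z c
    · rw [Set.pair_comm]
      exact connectsSet_of_two_copies hab hca hcb hn hxz h2 (Ne.symm h1)
    · by_cases h3 : y c = z c
      · rw [Set.insert_comm, Set.pair_comm]
        exact connectsSet_of_two_copies hab hca hcb hn hyz h3 h1
      · by_cases h4 : Fintype.card α = 4
        · exact connectsSet_of_three_copies_four hab hca hcb h4 h1 h2 h3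
        · exact connectsSet_of_three_copies hab hca hcb (by omega) h1 h2 h3

end LowerBound

section Three

lemma adj_three : ∀ σ τ : Perm (Fin 3), Perm.sign σ ≠ Perm.sign τ → (swapGraph 0 1).Adj σ τ := by
  decide

lemma exists_sign_eq_three :
    ∀ x y : Perm (Fin 3), ∃ z, z ≠ x ∧ z ≠ y ∧ Perm.sign z = Perm.sign x := by
  decide

lemma connectsSet_three_of_sign_ne {x y z : Perm (Fin 3)} (hxy : x ≠ y)
    (h1 : Perm.sign x = Perm.sign y) (h2 : Perm.sign x ≠ Perm.sign z) :
    ConnectsSet (swapGraph (0 : Fin 3) 1) {x, y, z} 2 := by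
  obtain ⟨u, huz, -, hu⟩ := exists_sign_eq_three z z
  obtain ⟨v, hvx, hvy, hv⟩ := exists_sign_eq_three x y
  have hxu : x ≠ u := by grind
  have hyu : y ≠ u := by grind
  have hxz : x ≠ z := by grind
  have hyz : y ≠ z := by grind
  have huv : u ≠ v := by grind
  have hvz : v ≠ z := by grind
  have a1 := adj_three x z h2
  have a2 := adj_three z y (h1 ▸ h2.symm)
  have a3 := adj_three x u (hu ▸ h2)
  have a4 := adj_three u y (by rw [hu, ← h1]; exact h2.symm)
  have a5 := adj_three u v (by rw [hu, hv]; exact h2.symm)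
  have a6 := adj_three v z (by rw [hv]; exact h2)
  have h := connectsSet_of_lists (G := swapGraph (0 : Fin 3) 1) Function.injective_id
        (fun _ _ h => h) x [x, y, z]
    ![[(z, y), (x, z)], [(v, z), (u, v), (u, y), (x, u)]]
    (by simp [Fin.forall_fin_two, Grows, a1, a2, a3, a4, a5, a6])
    (by simp only [Fin.forall_fin_two]; simp) (by simp)
    (by simp only [Fin.forall_fin_two]; simp; grind)
    (by simp only [Fin.forall_fin_two]; simp; grind)
  rw [Set.image_id, Fintype.card_fin] at h
  convert h using 1
  ext
  simp

lemma connectsSet_three {x y z : Perm (Fin 3)} (hxy : x ≠ y) (hxz : x ≠ z) (hyz : y ≠ z) :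
    ConnectsSet (swapGraph (0 : Fin 3) 1) {x, y, z} 2 := by
  by_cases h1 : Perm.sign x = Perm.sign y
  · by_cases h2 : Perm.sign x = Perm.sign z
    · obtain ⟨w, hw, hw'⟩ : ∃ w : Fin 2 → Perm (Fin 3), w 0 ≠ w 1 ∧
          ∀ i, Perm.sign (w i) ≠ Perm.sign x := by
        have : ∀ x : Perm (Fin 3), ∃ u v : Perm (Fin 3), u ≠ v ∧
          Perm.sign u ≠ Perm.sign x ∧ Perm.sign v ≠ Perm.sign x := by decide
        obtain ⟨u, v, huv, hu, hv⟩ := this x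
        exact ⟨![u, v], huv, by simp [Fin.forall_fin_two, hu, hv]⟩
      have hne : ∀ i, w i ≠ x ∧ w i ≠ y ∧ w i ≠ z := by grind
      have a : ∀ i p, Perm.sign p = Perm.sign x → (swapGraph 0 1).Adj (w i) p := fun i p h =>
        adj_three _ _ (h ▸ hw' i)
      have h := connectsSet_of_lists (G := swapGraph (0 : Fin 3) 1) Function.injective_id
        (fun _ _ h => h) x [x, y, z]
        (fun i => [(w i, z), (w i, y), (x, w i)])
        (fun i => by simp [Grows, a i z h2.symm, a i y h1.symm, (a i x rfl).symm])
        (by simp) (by simp)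
        (by simp only [Fin.forall_fin_two]; simp; grind)
        (by simp only [Fin.forall_fin_two]; simp; grind)
      rw [Set.image_id, Fintype.card_fin] at h
      convert h using 1
      ext
      simp
    · exact connectsSet_three_of_sign_ne hxy h1 h2
  · by_cases h2 : Perm.sign x = Perm.sign z
    · rw [Set.pair_comm]
      exact connectsSet_three_of_sign_ne hxz h2 h1
    · have h3 : Perm.sign y = Perm.sign z := by
        rcases Int.units_eq_one_or (Perm.sign x) with h | h <;>
        rcases Int.units_eq_one_or (Perm.sign y) with h' | h' <;>
        rcases Int.units_eq_one_or (Perm.sign z) with h'' | h'' <;> simp_all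
      rw [Set.insert_comm, Set.pair_comm]
      exact connectsSet_three_of_sign_ne hyz h3 (Ne.symm h1)

end Three

section UpperBound

variable {V : Type*} {G : SimpleGraph V}

lemma exists_adj_of_isTree {H : G.Subgraph} (hH : H.coe.IsTree) {x z : V} (C : Set V)
    (hx : x ∈ H.verts) (hz : z ∈ H.verts) (hxC : x ∈ C) (hzC : z ∉ C) :
    ∃ u ∈ C, ∃ v ∉ C, H.Adj u v := by
  obtain ⟨w⟩ := hH.connected.preconnected ⟨x, hx⟩ ⟨z, hz⟩
  obtain ⟨d, -, h1, h2⟩ := w.exists_boundary_dart (Subtype.val ⁻¹' C) hxC hzC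
  exact ⟨_, h1, _, h2, d.adj⟩

variable {S : Set V} {r : ℕ} {T : Fin r → G.Subgraph}

lemma exists_neighbor_family (hT : ∀ i, (T i).coe.IsTree) (hS : ∀ i, S ⊆ (T i).verts)
    (he : ∀ i j, i ≠ j → Disjoint (T i).edgeSet (T j).edgeSet) {x y : V} (hx : x ∈ S) (hy : y ∈ S)
    (hxy : x ≠ y) : ∃ f : Fin r → V, (∀ i, (T i).Adj x (f i)) ∧ Function.Injective f := by
  have : ∀ i, ∃ v, (T i).Adj x v := fun i => by
    obtain ⟨u, rfl, v, -, h⟩ := exists_adj_of_isTree (hT i) {x} (hS i hx) (hS i hy) rfl hxy.symm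
    exact ⟨v, h⟩
  choose f hf using this
  refine ⟨f, hf, fun i j hij => ?_⟩
  by_contra hne
  exact Set.disjoint_left.1 (he i j hne) (Subgraph.mem_edgeSet.2 (hf i))
    (Subgraph.mem_edgeSet.2 (hij ▸ hf j))

lemma le_card_of_connectsSet (h : ConnectsSet G S r) {x y : V} (hx : x ∈ S) (hy : y ∈ S)
    (hxy : x ≠ y) {N : Finset V} (hN : ∀ v, G.Adj x v → v ∈ N) : r ≤ N.card := by
  obtain ⟨T, hT, hS, -, he⟩ := h
  obtain ⟨f, hf, hinj⟩ := exists_neighbor_family hT hS he hx hy hxy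
  simpa using Finset.card_le_card_of_injOn (s := Finset.univ) f
    (fun i _ => hN _ (hf i).adj_sub) hinj.injOn

lemma exists_tree_unique_neighbor (hT : ∀ i, (T i).coe.IsTree) (hS : ∀ i, S ⊆ (T i).verts)
    (he : ∀ i j, i ≠ j → Disjoint (T i).edgeSet (T j).edgeSet) {x y : V} (hx : x ∈ S) (hy : y ∈ S)
    (hxy : G.Adj x y) {N : Finset V} (hN : ∀ v, G.Adj x v → v ∈ N) (hr : N.card ≤ r) :
    ∃ i, (T i).Adj x y ∧ ∀ v, (T i).Adj x v → v = y := by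
  obtain ⟨f, hf, hinj⟩ := exists_neighbor_family hT hS he hx hy hxy.ne
  have hsurj : ∀ v ∈ N, ∃ i, f i = v := by
    intro v hv
    obtain ⟨i, -, hi⟩ := Finset.surjOn_of_injOn_of_card_le (s := Finset.univ) f
      (fun i _ => hN _ (hf i).adj_sub) hinj.injOn (by simpa using hr) hv
    exact ⟨i, hi⟩
  obtain ⟨i, rfl⟩ := hsurj y (hN y hxy)
  refine ⟨i, hf i, fun v hv => ?_⟩
  obtain ⟨j, rfl⟩ := hsurj v (hN v hv.adj_sub)
  by_contra hne
  exact Set.disjoint_left.1 (he i j fun h => hne (h ▸ rfl)) (Subgraph.mem_edgeSet.2 hv)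
    (Subgraph.mem_edgeSet.2 (hf j))

/-- Two adjacent vertices of `S` waste an edge. -/
lemma lt_card_of_connectsSet (h : ConnectsSet G S r) {x y z : V} (hx : x ∈ S) (hy : y ∈ S)
    (hz : z ∈ S) (hxy : G.Adj x y) (hzx : z ≠ x) (hzy : z ≠ y) {d : ℕ} {N M : Finset V}
    (hN : ∀ v, G.Adj x v → v ∈ N) (hM : ∀ v, G.Adj y v → v ∈ M) (hNd : N.card ≤ d)
    (hMd : M.card ≤ d) : r < d := by
  by_contra! hr
  obtain ⟨T, hT, hS, -, he⟩ := h
  obtain ⟨i, hi, hi'⟩ := exists_tree_unique_neighbor hT hS he hx hy hxy hN (hNd.trans hr)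
  obtain ⟨j, hj, hj'⟩ := exists_tree_unique_neighbor hT hS he hy hx hxy.symm hM (hMd.trans hr)
  obtain rfl : i = j := by
    by_contra hne
    exact Set.disjoint_left.1 (he i j hne) (Subgraph.mem_edgeSet.2 hi)
      (Subgraph.mem_edgeSet.2 hj.symm)
  obtain ⟨u, hu, v, hv, h⟩ := exists_adj_of_isTree (hT i) {x, y} (hS i hx) (hS i hz) (by simp)
    (by simp [hzx, hzy])
  rcases hu with rfl | rfl
  · exact hv (by simp [hi' v h])
  · exact hv (by simp [hj' v h])

end UpperBound

section Kappa

variable {α : Type*} [Fintype α] [DecidableEq α] {a b : α}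

lemma exists_neighbor_finset (hab : a ≠ b) (σ : Perm α) : ∃ N : Finset (Perm α),
    (∀ τ, (swapGraph a b).Adj σ τ → τ ∈ N) ∧ N.card ≤ 2 * Fintype.card α - 3 := by
  refine ⟨(Finset.univ.erase a).image (fun i => σ * swap a i) ∪
    ((Finset.univ.erase b).erase a).image (fun i => σ * swap b i), ?_, ?_⟩
  · rintro _ ⟨i, ⟨h, rfl⟩ | ⟨h, rfl⟩⟩
    · exact Finset.mem_union_left _ (Finset.mem_image_of_mem _ (by simpa using h))
    · by_cases hi : i = a
      · rw [hi, swap_comm]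
        exact Finset.mem_union_left _ (Finset.mem_image_of_mem _ (by simpa using hab.symm))
      · exact Finset.mem_union_right _ (Finset.mem_image_of_mem _ (by simp [h, hi]))
  · refine (Finset.card_union_le _ _).trans ?_
    have h1 := Finset.card_image_le (s := Finset.univ.erase a) (f := fun i => σ * swap a i)
    have h2 := Finset.card_image_le (s := (Finset.univ.erase b).erase a)
      (f := fun i => σ * swap b i)
    rw [Finset.card_erase_of_mem (Finset.mem_univ a), Finset.card_univ] at h1
    rw [Finset.card_erase_of_mem (by simpa using hab), Finset.card_erase_of_mem (Finset.mem_univ b),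
      Finset.card_univ] at h2
    have h3 : 1 < Fintype.card α := Fintype.one_lt_card_iff.2 ⟨a, b, hab⟩
    omega

lemma kappa3_swapGraph (hab : a ≠ b) (hn : 3 ≤ Fintype.card α)
    (h : ∀ x y z : Perm α, x ≠ y → x ≠ z → y ≠ z →
      ConnectsSet (swapGraph a b) {x, y, z} (2 * Fintype.card α - 4)) :
    kappa3 (swapGraph a b) = 2 * Fintype.card α - 4 := by
  obtain ⟨c, hca, hcb⟩ : ∃ c, c ≠ a ∧ c ≠ b := by
    by_contra! h
    have := Finset.card_le_card (show (Finset.univ : Finset α) ⊆ {a, b} from fun c _ => by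
      by_cases hc : c = a
      · simp [hc]
      · simp [h c hc])
    have := this.trans Finset.card_le_two
    rw [Finset.card_univ] at this
    omega
  have h1 : (1 : Perm α) ≠ swap a b := fun h => hab (swap_eq_one_iff.1 h.symm)
  have h2 : (1 : Perm α) ≠ swap a c := fun h => hca (swap_eq_one_iff.1 h.symm).symm
  have h3 : swap a b ≠ swap a c := fun h => hcb (by
    have := congrArg (fun g : Perm α => g a) h
    simpa using this.symm)
  have hS : ({1, swap a b, swap a c} : Set (Perm α)).ncard = 3 :=
    Set.ncard_eq_three.2 ⟨_, _, _, h1, h2, h3, rfl⟩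
  have hmem : treeConn (swapGraph a b) {1, swap a b, swap a c} ∈
      {k | ∃ S : Set (Perm α), S.ncard = 3 ∧ treeConn (swapGraph a b) S = k} := ⟨_, hS, rfl⟩
  refine le_antisymm ((Nat.sInf_le hmem).trans ?_) (le_csInf ⟨_, hmem⟩ ?_)
  · refine csSup_le' ?_
    intro r hr
    obtain ⟨N, hN, hNc⟩ := exists_neighbor_finset hab 1
    obtain ⟨M, hM, hMc⟩ := exists_neighbor_finset hab (swap a b)
    have hadj : (swapGraph a b).Adj 1 (swap a b) := by
      simpa using adj_mul_swap_left (b := b) (1 : Perm α) hab.symm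
    have := lt_card_of_connectsSet hr (by simp) (by simp) (z := swap a c) (by simp) hadj h2.symm h3.symm
      hN hM hNc hMc
    omega
  · rintro _ ⟨S, hS, rfl⟩
    obtain ⟨x, y, z, hxy, hxz, hyz, rfl⟩ := Set.ncard_eq_three.1 hS
    refine le_csSup ⟨2 * Fintype.card α - 3, fun r hr => ?_⟩ (h x y z hxy hxz hyz)
    obtain ⟨N, hN, hNc⟩ := exists_neighbor_finset hab x
    exact (le_card_of_connectsSet hr (by simp) (y := y) (by simp) hxy hN).trans hNc

lemma splitStar_eq_swapGraph (n : ℕ) (hn : 3 ≤ n) :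
    splitStar n hn = swapGraph ⟨0, by omega⟩ ⟨1, by omega⟩ := by
  have key : ∀ σ τ : Perm (Fin n), (∃ s ∈ ({σ | ∃ i : Fin n, 1 ≤ (i : ℕ) ∧
      σ = swap ⟨0, by omega⟩ i} ∪ {σ | ∃ i : Fin n, 2 ≤ (i : ℕ) ∧ σ = swap ⟨1, by omega⟩ i} :
      Set (Perm (Fin n))), τ = σ * s) ↔ (swapGraph ⟨0, by omega⟩ ⟨1, by omega⟩).Adj σ τ := by
    intro σ τ
    constructor
    · rintro ⟨_, ⟨i, hi, rfl⟩ | ⟨i, hi, rfl⟩, rfl⟩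
      · exact adj_mul_swap_left σ fun h => by simp [h] at hi
      · exact adj_mul_swap_right σ fun h => by simp [h] at hi
    · rintro ⟨i, ⟨hi, rfl⟩ | ⟨hi, rfl⟩⟩
      · exact ⟨_, Or.inl ⟨i, Nat.one_le_iff_ne_zero.2 fun h => hi (Fin.ext h), rfl⟩, rfl⟩
      · by_cases h0 : (i : ℕ) = 0
        · refine ⟨_, Or.inl ⟨⟨1, by omega⟩, le_rfl, rfl⟩, ?_⟩
          rw [swap_comm, show i = ⟨0, by omega⟩ from Fin.ext h0]
        · have h1 : (i : ℕ) ≠ 1 := fun h => hi (Fin.ext h)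
          exact ⟨_, Or.inr ⟨i, by omega, rfl⟩, rfl⟩
  ext σ τ
  rw [splitStar, cayleyGraph, fromRel_adj, key, key]
  exact ⟨fun h => h.2.elim id fun h => h.symm, fun h => ⟨h.ne, Or.inl h⟩⟩

end Kappa

end SplitStar

/-- `κ₃(S_n²) = 2n - 4` for every `n ≥ 3`. -/
theorem stmt_12 (n : ℕ) (hn : 3 ≤ n) :
    kappa3 (splitStar n hn) = 2 * n - 4 := by
  rw [SplitStar.splitStar_eq_swapGraph]
  have hab : (⟨0, by omega⟩ : Fin n) ≠ ⟨1, by omega⟩ := by simp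
  have key := SplitStar.kappa3_swapGraph hab (by simpa using hn) fun x y z hxy hxz hyz => by
    rcases hn.eq_or_lt with rfl | hn
    · exact SplitStar.connectsSet_three hxy hxz hyz
    · exact SplitStar.connectsSet_triple hab (by rwa [Fintype.card_fin]) hxy hxz hyz
  rwa [Fintype.card_fin] at key
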